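/- For any real A, the Spector rank of A equals α if and only if ω₁^A is the (1+α)-th admissible ordinal. -/

import Mathlib

open FirstOrder FirstOrder.Language Nat
open scoped Classical

namespace SpectorRankFormalization

/-- Oracle partial recursive functions: `RecursiveIn O f` means that the partial
function `f` is partial recursive relative to the (total) oracle `O`. -/
inductive RecursiveIn (O : ℕ → ℕ) : (ℕ →. ℕ) → Prop
  | zero : RecursiveIn O (pure 0)
  | succ : RecursiveIn O Nat.succ
  | left : RecursiveIn O ↑fun n : ℕ => n.unpair.1
  | right : RecursiveIn O ↑fun n : ℕ => n.unpair.2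
  | oracle : RecursiveIn O ↑O
  | pair {f g} : RecursiveIn O f → RecursiveIn O g →
      RecursiveIn O fun n => pair <$> f n <*> g n
  | comp {f g} : RecursiveIn O f → RecursiveIn O g →
      RecursiveIn O fun n => g n >>= f
  | prec {f g} : RecursiveIn O f → RecursiveIn O g →
      RecursiveIn O (unpaired fun a n =>
        n.rec (f a) fun y IH => do let i ← IH; g (pair a (pair y i)))
  | rfind {f} : RecursiveIn O f →
      RecursiveIn O fun a => rfind fun n => (fun m => m = 0) <$> f (pair a n)

/-- Function symbols: `0`, successor, `+`, `·`, and a unary symbol standing for a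
function variable (the function quantified in `Σ¹₁`/`Π¹₁` normal forms). -/
inductive Func : ℕ → Type
  | zero : Func 0
  | succ : Func 1
  | fn : Func 1
  | add : Func 2
  | mul : Func 2

/-- Relation symbols: a unary predicate symbol standing for the real (set) parameter,
and `≤`. -/
inductive Rel : ℕ → Type
  | mem : Rel 1
  | le : Rel 2

/-- The language of arithmetic augmented by a set parameter and a function variable. -/
def L : Language := ⟨Func, Rel⟩

/-- The standard model `ℕ`, interpreting the set parameter as `B` and the function
variable as `f`. -/
def str (B : Set ℕ) (f : ℕ → ℕ) : L.Structure ℕ where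
  funMap {n} F v :=
    match F with
    | .zero => 0
    | .succ => v 0 + 1
    | .fn => f (v 0)
    | .add => v 0 + v 1
    | .mul => v 0 * v 1
  RelMap {n} r v :=
    match r with
    | .mem => v 0 ∈ B
    | .le => v 0 ≤ v 1

/-- Realization of a formula with one free number variable at `n`, in the standard
model with set parameter `B` and function parameter `f`. -/
def Realizes (B : Set ℕ) (f : ℕ → ℕ) (θ : L.Formula (Fin 1)) (n : ℕ) : Prop :=
  letI := str B f
  θ.Realize ![n]

/-- `A` is `Σ¹₁` in `B`: membership of `n` in `A` is equivalent to
`∃f θ(n, f, B)` with `θ` arithmetic (first-order in the displayed parameters). -/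
def Sigma11In (B A : Set ℕ) : Prop :=
  ∃ θ : L.Formula (Fin 1), ∀ n, n ∈ A ↔ ∃ f : ℕ → ℕ, Realizes B f θ n

/-- `C` is `Π¹₁` in `B`. -/
def Pi11In (B C : Set ℕ) : Prop := Sigma11In B Cᶜ

/-- `A ≤_H B`: `A` is hyperarithmetical in `B`, i.e. (by Kleene's theorem
`HYP(B) = Δ¹₁(B)`) both `A` and its complement are `Σ¹₁` in `B`. -/
def HypLE (A B : Set ℕ) : Prop := Sigma11In B A ∧ Sigma11In B Aᶜ

/-- `J` is (a copy of) the hyperjump `𝒪^A` of `A`: a `Π¹₁(A)` set of natural numbers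
which is complete for `Π¹₁(A)` sets with respect to many-one reducibility
(Kleene's `𝒪` relativized to `A` is such a set). -/
def IsHyperjump (A J : Set ℕ) : Prop :=
  Pi11In A J ∧ ∀ C : Set ℕ, Pi11In A C → ManyOneReducible (· ∈ C) (· ∈ J)


/-- The relation `A ≺ B` iff `𝒪^A ≤_H B`, whose ordinal rank is the Spector rank. -/
def SpectorRel (A B : Set ℕ) : Prop :=
  ∃ J : Set ℕ, IsHyperjump A J ∧ HypLE J B

/-- The characteristic function of a set of naturals, used as an oracle. -/
noncomputable def charFun (A : Set ℕ) : ℕ → ℕ :=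
  fun n => if n ∈ A then 1 else 0

/-- The relation `r` on `ℕ` is recursive in the real `A`. -/
noncomputable def RelRecursiveIn (A : Set ℕ) (r : ℕ → ℕ → Prop) : Prop :=
  RecursiveIn (charFun A)
    ↑(fun p : ℕ => if r p.unpair.1 p.unpair.2 then 1 else 0)

/-- `r` is a presentation of the ordinal `o`: `r` is a (reflexive) well-ordering of
its domain `{n | r n n}` whose order type is `o`. -/
def IsPresentation (r : ℕ → ℕ → Prop) (o : Ordinal) : Prop :=
  ∃ hwo : IsWellOrder {n // r n n} (fun a b => r a.val b.val ∧ ¬ r b.val a.val),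
    @Ordinal.type {n // r n n} (fun a b => r a.val b.val ∧ ¬ r b.val a.val) hwo = o

/-- `ω₁^A`: the least ordinal that is not recursive in `A`, i.e. the least ordinal
having no `A`-recursive presentation. -/
noncomputable def omega1 (A : Set ℕ) : Ordinal :=
  sInf {o : Ordinal | ¬ ∃ r : ℕ → ℕ → Prop, RelRecursiveIn A r ∧ IsPresentation r o}

/-- Function symbols of the first-order language of set theory: none. -/
inductive SFunc : ℕ → Type

/-- Relation symbols of the first-order language of set theory: `∈`. -/
inductive SRel : ℕ → Type
  | mem : SRel 2

/-- The first-order language of set theory. -/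
def LS : Language := ⟨SFunc, SRel⟩

/-- The atomic membership formula `t ∈ u`. -/
def memF {n : ℕ} (t u : LS.Term (Empty ⊕ Fin n)) : LS.BoundedFormula Empty n :=
  Relations.boundedFormula₂ (SRel.mem : LS.Relations 2) t u

/-- The de Bruijn variable `i` in context `m`. -/
def v' {m : ℕ} (i : ℕ) (h : i < m) : LS.Term (Empty ⊕ Fin m) :=
  Term.var (Sum.inr ⟨i, h⟩)

/-- `Δ₀` (bounded) formulas of set theory: built from atomic formulas by propositional
connectives and bounded quantification `∀ x ∈ t`, `∃ x ∈ t`. -/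
inductive IsDelta0S : ∀ {n : ℕ}, LS.BoundedFormula Empty n → Prop
  | falsum {n} : IsDelta0S (n := n) ⊥
  | equal {n} (t u : LS.Term (Empty ⊕ Fin n)) : IsDelta0S (t.bdEqual u)
  | mem {n} (t u : LS.Term (Empty ⊕ Fin n)) : IsDelta0S (memF t u)
  | imp {n} {θ χ : LS.BoundedFormula Empty n} :
      IsDelta0S θ → IsDelta0S χ → IsDelta0S (θ.imp χ)
  | ball {n} (t : LS.Term (Empty ⊕ Fin n)) {θ : LS.BoundedFormula Empty (n + 1)} :
      IsDelta0S θ →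
      IsDelta0S (((memF (Term.var (Sum.inr (Fin.last n)))
        (t.relabel (Sum.map id Fin.castSucc))).imp θ).all)
  | bex {n} (t : LS.Term (Empty ⊕ Fin n)) {θ : LS.BoundedFormula Empty (n + 1)} :
      IsDelta0S θ →
      IsDelta0S (((memF (Term.var (Sum.inr (Fin.last n)))
        (t.relabel (Sum.map id Fin.castSucc))) ⊓ θ).ex)

/-- Extensionality: `∀x ∀y (∀z (z ∈ x ↔ z ∈ y) → x = y)`. -/
def extAx : LS.Sentence :=
  let inner : LS.BoundedFormula Empty 3 :=
    (memF (v' 2 (by omega)) (v' 0 (by omega))).iff (memF (v' 2 (by omega)) (v' 1 (by omega)))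
  ((inner.all).imp (Term.bdEqual (v' 0 (by omega)) (v' 1 (by omega)))).all.all

/-- Empty set: `∃x ∀y ¬(y ∈ x)`. -/
def emptyAx : LS.Sentence :=
  ((∼(memF (v' 1 (by omega)) (v' 0 (by omega)))).all).ex

/-- Pairing: `∀x ∀y ∃z (x ∈ z ∧ y ∈ z)`. -/
def pairAx : LS.Sentence :=
  let body : LS.BoundedFormula Empty 3 :=
    (memF (v' 0 (by omega)) (v' 2 (by omega))) ⊓ (memF (v' 1 (by omega)) (v' 2 (by omega)))
  body.ex.all.all

/-- Union: `∀x ∃y ∀z ∀w (z ∈ w ∧ w ∈ x → z ∈ y)`. -/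
def unionAx : LS.Sentence :=
  let body : LS.BoundedFormula Empty 4 :=
    ((memF (v' 2 (by omega)) (v' 3 (by omega))) ⊓
      (memF (v' 3 (by omega)) (v' 0 (by omega)))).imp
      (memF (v' 2 (by omega)) (v' 1 (by omega)))
  body.all.all.ex.all

/-- The `Δ₀`-separation axiom for the formula `θ(p₁, …, pₙ, a, x)`:
`∀p ∀a ∃b ∀x (x ∈ b ↔ x ∈ a ∧ θ)`. -/
def sepAx (n : ℕ) (θ : LS.BoundedFormula Empty (n + 2)) : LS.Sentence :=
  let body : LS.BoundedFormula Empty (n + 3) :=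
    (memF (v' (n + 2) (by omega)) (v' (n + 1) (by omega))).iff
      ((memF (v' (n + 2) (by omega)) (v' n (by omega))) ⊓ θ.liftAt 1 (n + 1))
  body.all.ex.alls

/-- The `Δ₀`-collection axiom for the formula `θ(p₁, …, pₙ, a, x, y)`:
`∀p ∀a (∀x ∈ a ∃y θ → ∃b ∀x ∈ a ∃y ∈ b θ)`. -/
def collAx (n : ℕ) (θ : LS.BoundedFormula Empty (n + 3)) : LS.Sentence :=
  let lhs : LS.BoundedFormula Empty (n + 1) :=
    ((memF (v' (n + 1) (by omega)) (v' n (by omega))).imp θ.ex).all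
  let rhs : LS.BoundedFormula Empty (n + 1) :=
    (((memF (v' (n + 2) (by omega)) (v' n (by omega))).imp
        (((memF (v' (n + 3) (by omega)) (v' (n + 1) (by omega))) ⊓
          θ.liftAt 1 (n + 1)).ex)).all).ex
  (lhs.imp rhs).alls

/-- Kripke–Platek set theory `KP`: extensionality, empty set, pairing, union,
`Δ₀`-separation and `Δ₀`-collection (foundation holds automatically in the
well-founded transitive models considered below). -/
def KP : LS.Theory :=
  {extAx, emptyAx, pairAx, unionAx} ∪
    {ψ | ∃ (n : ℕ) (θ : LS.BoundedFormula Empty (n + 2)), IsDelta0S θ ∧ ψ = sepAx n θ} ∪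
    {ψ | ∃ (n : ℕ) (θ : LS.BoundedFormula Empty (n + 3)), IsDelta0S θ ∧ ψ = collAx n θ}

/-- A (transitive) set as an `LS`-structure, with `∈` interpreted by membership. -/
def zStr (x : ZFSet) : LS.Structure {y : ZFSet // y ∈ x} where
  funMap {n} f _ := nomatch f
  RelMap {n} r w :=
    match r with
    | .mem => (w 0).val ∈ (w 1).val

/-- `x` is a model of `KP`. -/
def SatisfiesKP (x : ZFSet) : Prop :=
  letI := zStr x
  ∀ ψ ∈ KP, ψ.Realize {y : ZFSet // y ∈ x}

/-- The ordinal height of a set: its set-theoretic rank (which, for a transitive set,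
is the supremum of the ordinals it contains). -/
noncomputable def height (x : ZFSet) : Ordinal :=
  (ZFSet.mem_wf.apply x).rank

/-- An ordinal is admissible if it is the ordinal height of a (well-founded,
transitive) model of Kripke–Platek set theory `KP`. -/
def Admissible (o : Ordinal.{0}) : Prop :=
  ∃ x : ZFSet, x.IsTransitive ∧ SatisfiesKP x ∧ height x = Ordinal.lift.{1, 0} o

set_option linter.all false
abbrev FE := ℕ → ℕ → ℕ
abbrev NE := ℕ → ℕ

@[reducible] def push {α : Type*} (x : α) (e : ℕ → α) : ℕ → α := fun i => Nat.casesOn i x e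

inductive Ar : (FE → NE → Prop) → Prop
  | add i j k : Ar fun _ e => e i + e j = e k
  | mul i j k : Ar fun _ e => e i * e j = e k
  | eq i j : Ar fun _ e => e i = e j
  | app i j k : Ar fun F e => F i (e j) = e k
  | fls : Ar fun _ _ => False
  | imp {P Q} : Ar P → Ar Q → Ar fun F e => P F e → Q F e
  | all {P} : Ar P → Ar fun F e => ∀ x, P F (push x e)

class ArLike (K : (FE → NE → Prop) → Prop) : Prop where
  ar : ∀ {P}, Ar P → K P
  imp : ∀ {P Q}, K P → K Q → K fun F e => P F e → Q F e
  all : ∀ {P : FE → NE → Prop}, K P → K fun F e => ∀ x, P F (push x e)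
  ren : ∀ {P : FE → NE → Prop} (r s : ℕ → ℕ), K P → K fun F e => P (fun i => F (s i)) (fun i => e (r i))

theorem Ar.ren {P} (h : Ar P) : ∀ r s : ℕ → ℕ, Ar fun F e => P (fun i => F (s i)) (fun i => e (r i)) := by
  induction h with
  | add i j k => exact fun r s => Ar.add _ _ _
  | mul i j k => exact fun r s => Ar.mul _ _ _
  | eq i j => exact fun r s => Ar.eq _ _
  | app i j k => exact fun r s => Ar.app _ _ _
  | fls => exact fun r s => Ar.fls
  | imp _ _ h1 h2 => exact fun r s => Ar.imp (h1 r s) (h2 r s)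
  | @all P _ h =>
    intro r s
    convert Ar.all (h (fun i => Nat.casesOn i 0 fun i => r i + 1) s) using 6
    rename_i i
    cases i <;> rfl

instance : ArLike Ar := ⟨id, Ar.imp, Ar.all, fun r s h => h.ren r s⟩

class Df (K : (FE → NE → Prop) → Prop) (P : FE → NE → Prop) : Prop where
  h : K P

/-- graph of a term -/
class AF (K : (FE → NE → Prop) → Prop) (t : FE → NE → ℕ) : Prop where
  h : Df K fun F e => t F (fun i => e (i+1)) = e 0

section
variable {K : (FE → NE → Prop) → Prop} [ArLike K]
variable {P Q : FE → NE → Prop} {t s : FE → NE → ℕ}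

theorem Df.ar (h : Ar P) : Df K P := ⟨ArLike.ar h⟩
theorem Df.congr (h : Df K P) (h' : ∀ F e, Q F e ↔ P F e) : Df K Q := by
  have : Q = P := by funext F e; exact propext (h' F e)
  rw [this]; exact h
instance (priority := 2000) Df.imp [h1 : Df K P] [h2 : Df K Q] : Df K fun F e => P F e → Q F e :=
  ⟨ArLike.imp h1.h h2.h⟩
instance (priority := 2000) Df.all {P : FE → NE → ℕ → Prop} [h : Df K fun F e => P F (fun i => e (i+1)) (e 0)] :
    Df K fun F e => ∀ x, P F e x := ⟨ArLike.all h.h⟩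
instance (priority := 2000) Df.fls : Df K fun _ _ => False := Df.ar Ar.fls
instance (priority := 2000) Df.tru : Df K fun _ _ => True :=
  (inferInstance : Df K fun _ _ => False → False).congr fun _ _ => by simp
instance (priority := 2000) Df.not [Df K P] : Df K fun F e => ¬ P F e :=
  (inferInstance : Df K fun F e => P F e → False)
instance (priority := 2000) Df.and [Df K P] [Df K Q] : Df K fun F e => P F e ∧ Q F e :=
  (inferInstance : Df K fun F e => ¬ (P F e → ¬ Q F e)).congr fun _ _ => by tauto
instance (priority := 2000) Df.or [Df K P] [Df K Q] : Df K fun F e => P F e ∨ Q F e :=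
  (inferInstance : Df K fun F e => (¬ P F e → Q F e)).congr fun _ _ => by tauto
instance (priority := 2000) Df.iff [Df K P] [Df K Q] : Df K fun F e => P F e ↔ Q F e :=
  (inferInstance : Df K fun F e => (P F e → Q F e) ∧ (Q F e → P F e)).congr fun _ _ => by tauto
instance (priority := 2000) Df.ex {P : FE → NE → ℕ → Prop} [h : Df K fun F e => P F (fun i => e (i+1)) (e 0)] :
    Df K fun F e => ∃ x, P F e x :=
  (inferInstance : Df K fun F e => ¬ ∀ x, ¬ P F e x).congr fun _ _ => by simp
theorem Df.ren (h : Df K P) (r : ℕ → ℕ) (s : ℕ → ℕ) :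
    Df K fun F e => P (fun i => F (s i)) (fun i => e (r i)) := ⟨ArLike.ren r s h.h⟩
theorem Df.sub {P : FE → NE → ℕ → Prop} (h : Df K fun F e => P F (fun i => e (i+1)) (e 0))
    (ht : AF K t) : Df K fun F e => P F e (t F e) := by
  have := ht.h
  exact (inferInstance : Df K fun F e => ∀ x, t F e = x → P F e x).congr fun _ _ => by simp
instance AF.var (i : ℕ) : AF K fun _ e => e i := ⟨Df.ar (Ar.eq _ _)⟩
theorem AF.tail (h : AF K t) : AF K fun F e => t F (fun i => e (i+1)) :=
  ⟨(h.h.ren (fun i => Nat.casesOn (motive := fun _ => ℕ) i 0 fun i => i + 2) id :)⟩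
theorem AF.tail2 (h : AF K t) : AF K fun F e => t F (fun i => e (i+1+1)) := h.tail.tail
theorem AF.tail3 (h : AF K t) : AF K fun F e => t F (fun i => e (i+1+1+1)) := h.tail.tail.tail
theorem Df.sub1 {P : FE → ℕ → Prop} (h : Df K fun F e => P F (e 0)) (ht : AF K t) :
    Df K fun F e => P F (t F e) := Df.sub (P := fun F e x => P F x) h ht
theorem Df.sub2 {P : FE → ℕ → ℕ → Prop} (h : Df K fun F e => P F (e 0) (e 1)) (ht : AF K t) (hs : AF K s) :
    Df K fun F e => P F (t F e) (s F e) :=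
  Df.sub (P := fun F e x => P F (t F e) x) (Df.sub (P := fun F e x => P F x (e 0))
    (h) ht.tail) hs
theorem Df.sub3 {P : FE → ℕ → ℕ → ℕ → Prop} {u} (h : Df K fun F e => P F (e 0) (e 1) (e 2)) (ht : AF K t) (hs : AF K s)
    (hu : AF K u) : Df K fun F e => P F (t F e) (s F e) (u F e) :=
  Df.sub (P := fun F e x => P F (t F e) (s F e) x) (Df.sub (P := fun F e x => P F (t F (fun i => e (i+1))) x (e 0))
    (Df.sub (P := fun F e x => P F x (e 0) (e 1)) h ht.tail2) hs.tail) hu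
theorem AF.mk1 {f : FE → ℕ → ℕ} (h : Df K fun F e => f F (e 0) = e 1) (ht : AF K t) :
    AF K fun F e => f F (t F e) :=
  ⟨Df.sub2 (P := fun F a b => f F a = b) h ht.tail inferInstance⟩
theorem AF.mk2 {f : FE → ℕ → ℕ → ℕ} (h : Df K fun F e => f F (e 0) (e 1) = e 2) (ht : AF K t) (hs : AF K s) :
    AF K fun F e => f F (t F e) (s F e) :=
  ⟨Df.sub3 (P := fun F a b c => f F a b = c) h ht.tail hs.tail inferInstance⟩
instance (priority := 1500) Df.eq [ht : AF K t] [hs : AF K s] : Df K fun F e => t F e = s F e :=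
  Df.sub2 (P := fun F a b => a = b) (Df.ar (Ar.eq _ _)) ht hs
instance (priority := 1500) AF.app (i : ℕ) [ht : AF K t] : AF K fun F e => F i (t F e) :=
  AF.mk1 (f := fun F x => F i x) (Df.ar (Ar.app _ _ _)) ht
instance (priority := 1500) AF.add [ht : AF K t] [hs : AF K s] : AF K fun F e => t F e + s F e :=
  AF.mk2 (f := fun F a b => a + b) (Df.ar (Ar.add _ _ _)) ht hs
instance (priority := 1500) AF.mul [ht : AF K t] [hs : AF K s] : AF K fun F e => t F e * s F e :=
  AF.mk2 (f := fun F a b => a * b) (Df.ar (Ar.mul _ _ _)) ht hs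
theorem AF.const' (c : ℕ) : AF K fun _ _ => c := by
  induction c with
  | zero => exact ⟨(inferInstance : Df K fun F e => e 0 + e 0 = e 0).congr fun F e => by
        simp [eq_comm]⟩
  | succ n ih =>
    have h1 : AF K fun _ _ => 1 :=
      ⟨(inferInstance : Df K fun F e => e 0 * e 0 = e 0 ∧ ¬ e 0 + e 0 = e 0).congr fun F e => by
        constructor
        · intro h; rw [← h]; simp
        · rintro ⟨h, h'⟩
          have : e 0 ≠ 0 := by omega
          simpa [this, eq_comm] using h⟩
    exact (inferInstance : AF K fun _ _ => n + 1)
instance (priority := 500) AF.const (c : ℕ) : AF K fun _ _ => c := AF.const' c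
instance (priority := 1500) Df.const (p : Prop) : Df K fun _ _ => p := by
  by_cases h : p
  · exact Df.tru.congr (by simp [h])
  · exact Df.fls.congr (by simp [h])
instance (priority := 1500) Df.le [ht : AF K t] [hs : AF K s] : Df K fun F e => t F e ≤ s F e :=
  Df.sub2 (P := fun F a b => a ≤ b) ((inferInstance : Df K fun F e => ∃ x, e 0 + x = e 1).congr
    fun F e => ⟨fun h => ⟨_, Nat.add_sub_cancel' h⟩, fun ⟨x, h⟩ => by omega⟩) ht hs
instance (priority := 1500) Df.lt [ht : AF K t] [hs : AF K s] : Df K fun F e => t F e < s F e :=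
  (inferInstance : Df K fun F e => t F e + 1 ≤ s F e)
instance (priority := 1500) AF.succ [ht : AF K t] : AF K fun F e => Nat.succ (t F e) :=
  (inferInstance : AF K fun F e => t F e + 1)
instance (priority := 1500) AF.ite [∀ F e, Decidable (P F e)] [Df K P] [ht : AF K t] [hs : AF K s] :
    AF K fun F e => if P F e then t F e else s F e := by
  have := ht.h; have := hs.h
  have hP : Df K P := inferInstance
  have : Df K fun F e => P F (fun i => e (i+1)) := hP.ren (fun i => i+1) id
  exact ⟨(inferInstance : Df K fun F e => (P F (fun i => e (i+1)) → t F (fun i => e (i+1)) = e 0) ∧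
      (¬ P F (fun i => e (i+1)) → s F (fun i => e (i+1)) = e 0)).congr fun F e => by
      split_ifs with h <;> simp [h]⟩
instance (priority := 1500) AF.pair [ht : AF K t] [hs : AF K s] : AF K fun F e => Nat.pair (t F e) (s F e) :=
  AF.mk2 (f := fun F a b => Nat.pair a b) ((inferInstance : Df K fun F e =>
    (if e 0 < e 1 then e 1 * e 1 + e 0 else e 0 * e 0 + e 0 + e 1) = e 2).congr fun F e => by
      simp only [Nat.pair]) ht hs
instance (priority := 1500) AF.fst [ht : AF K t] : AF K fun F e => (Nat.unpair (t F e)).1 :=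
  AF.mk1 (f := fun F a => (Nat.unpair a).1) ((inferInstance : Df K fun F e =>
    ∃ y, Nat.pair (e 1) y = e 0).congr fun F e => ⟨fun h => ⟨(Nat.unpair (e 0)).2, by rw [← h]; simp⟩,
      fun ⟨y, h⟩ => by rw [← h]; simp⟩) ht
instance (priority := 1500) AF.snd [ht : AF K t] : AF K fun F e => (Nat.unpair (t F e)).2 :=
  AF.mk1 (f := fun F a => (Nat.unpair a).2) ((inferInstance : Df K fun F e =>
    ∃ y, Nat.pair y (e 1) = e 0).congr fun F e => ⟨fun h => ⟨(Nat.unpair (e 0)).1, by rw [← h]; simp⟩,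
      fun ⟨y, h⟩ => by rw [← h]; simp⟩) ht
instance (priority := 1500) AF.beta [ht : AF K t] [hs : AF K s] : AF K fun F e => Nat.beta (t F e) (s F e) :=
  AF.mk2 (f := fun F a b => Nat.beta a b) ((inferInstance : Df K fun F e =>
    ∃ q, (e 0).unpair.1 = ((e 1 + 1) * (e 0).unpair.2 + 1) * q + e 2 ∧ e 2 < (e 1 + 1) * (e 0).unpair.2 + 1).congr
    fun F e => by
      simp only [Nat.beta]
      constructor
      · intro h
        refine ⟨(e 0).unpair.1 / ((e 1 + 1) * (e 0).unpair.2 + 1), ?_, ?_⟩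
        · rw [← h]; exact (Nat.div_add_mod _ _).symm
        · rw [← h]; exact Nat.mod_lt _ (by omega)
      · rintro ⟨q, h1, h2⟩
        rw [h1, Nat.mul_add_mod, Nat.mod_eq_of_lt h2]) ht hs

theorem beta_ex (f : ℕ → ℕ) (n : ℕ) : ∃ c, ∀ i ≤ n, Nat.beta c i = f i :=
  ⟨Nat.unbeta (List.ofFn fun i : Fin (n+1) => f i), fun i hi => by
    have := Nat.beta_unbeta_coe (List.ofFn fun i : Fin (n+1) => f i) ⟨i, by simp; omega⟩
    rw [this]; simp [-List.ofFn_succ]⟩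

theorem rec_graph {O : ℕ → ℕ} (hO : Df K fun _ e => O (e 0) = e 1) {f : ℕ →. ℕ} (hf : RecursiveIn O f) :
    Df K fun _ e => e 1 ∈ f (e 0) := by
  induction hf with
  | zero => exact (inferInstance : Df K fun F e => e 1 = 0).congr fun F e => by simp [pure, PFun.pure]
  | succ => exact (inferInstance : Df K fun F e => e 1 = e 0 + 1).congr fun F e => by simp
  | left => exact (inferInstance : Df K fun F e => e 1 = (e 0).unpair.1).congr fun F e => by simp
  | right => exact (inferInstance : Df K fun F e => e 1 = (e 0).unpair.2).congr fun F e => by simp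
  | oracle => exact hO.congr fun F e => by simp [eq_comm]
  | @pair f g _ _ hf hg =>
    have h1 {t s} [AF K t] [AF K s] : Df K fun F e => s F e ∈ f (t F e) := Df.sub2 (P := fun F a b => b ∈ f a) hf inferInstance inferInstance
    have h2 {t s} [AF K t] [AF K s] : Df K fun F e => s F e ∈ g (t F e) := Df.sub2 (P := fun F a b => b ∈ g a) hg inferInstance inferInstance
    exact (inferInstance : Df K fun F e => ∃ x, x ∈ f (e 0) ∧ ∃ y, y ∈ g (e 0) ∧ e 1 = Nat.pair x y).congr
      fun F e => by simp [Seq.seq, eq_comm]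
  | @comp f g _ _ hf hg =>
    have h1 : Df K fun F e => e 2 ∈ f (e 0) := Df.sub2 (P := fun F a b => b ∈ f a) hf inferInstance inferInstance
    have h2 : Df K fun F e => e 0 ∈ g (e 1) := Df.sub2 (P := fun F a b => b ∈ g a) hg inferInstance inferInstance
    exact (inferInstance : Df K fun F e => ∃ x, x ∈ g (e 0) ∧ e 1 ∈ f x).congr
      fun F e => by exact Part.mem_bind_iff
  | @prec f g _ _ hf hg =>
    have h1 {t s} [AF K t] [AF K s] : Df K fun F e => s F e ∈ f (t F e) := Df.sub2 (P := fun F a b => b ∈ f a) hf inferInstance inferInstance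
    have h2 {t s} [AF K t] [AF K s] : Df K fun F e => s F e ∈ g (t F e) := Df.sub2 (P := fun F a b => b ∈ g a) hg inferInstance inferInstance
    refine (inferInstance : Df K fun F e => ∃ c, Nat.beta c 0 ∈ f (e 0).unpair.1 ∧
      Nat.beta c (e 0).unpair.2 = e 1 ∧ ∀ y, y < (e 0).unpair.2 → Nat.beta c (y+1) ∈
        g (Nat.pair (e 0).unpair.1 (Nat.pair y (Nat.beta c y)))).congr fun F e => ?_
    generalize e 0 = z
    generalize e 1 = m
    simp only [unpaired]
    generalize z.unpair.1 = a
    generalize z.unpair.2 = n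
    constructor
    · intro h
      suffices ∃ q : ℕ → ℕ, q 0 ∈ f a ∧ q n = m ∧ ∀ y < n, q (y+1) ∈ g (Nat.pair a (Nat.pair y (q y))) by
        obtain ⟨q, h0, h1, h2⟩ := this
        obtain ⟨c, hc⟩ := beta_ex q n
        refine ⟨c, by rwa [hc 0 (by omega)], by rwa [hc n le_rfl], fun y hy => ?_⟩
        rw [hc _ hy, hc _ hy.le]; exact h2 y hy
      induction n generalizing m with
      | zero => exact ⟨fun _ => m, h, rfl, by simp⟩
      | succ n ih =>
        simp only [bind, Part.mem_bind_iff] at h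
        obtain ⟨i, hi, h⟩ := h
        obtain ⟨q, h0, h1, h2⟩ := ih _ hi
        refine ⟨fun j => if j ≤ n then q j else m, by simpa using h0, by simp, fun y hy => ?_⟩
        rcases Nat.lt_succ_iff_lt_or_eq.1 hy with hy | rfl
        · simpa [hy.le, Nat.succ_le_of_lt hy] using h2 y hy
        · simpa [h1] using h
    · rintro ⟨c, h0, rfl, h2⟩
      induction n with
      | zero => exact h0
      | succ n ih =>
        simp only [bind, Part.mem_bind_iff]
        exact ⟨_, ih (fun y hy => h2 y (by omega)), h2 n (by omega)⟩
  | @rfind f _ hf =>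
    have h1 {t s} [AF K t] [AF K s] : Df K fun F e => s F e ∈ f (t F e) := Df.sub2 (P := fun F a b => b ∈ f a) hf inferInstance inferInstance
    refine (inferInstance : Df K fun F e => 0 ∈ f (Nat.pair (e 0) (e 1)) ∧ ∀ k, k < e 1 →
      ∃ y, y ∈ f (Nat.pair (e 0) k) ∧ ¬ y = 0).congr fun F e => ?_
    refine (Nat.mem_rfind).trans ?_
    simp

theorem part_rec {O : ℕ → ℕ} {f : ℕ →. ℕ} (hf : Nat.Partrec f) : RecursiveIn O f := by
  induction hf with
  | zero => exact .zero
  | succ => exact .succ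
  | left => exact .left
  | right => exact .right
  | pair _ _ h1 h2 => exact .pair h1 h2
  | comp _ _ h1 h2 => exact .comp h1 h2
  | prec _ _ h1 h2 => exact .prec h1 h2
  | rfind _ h => exact .rfind h

theorem AF.comp {f : ℕ → ℕ} (hf : Computable f) (h : AF K t) : AF K fun F e => f (t F e) :=
  AF.mk1 (f := fun _ a => f a) ((rec_graph (O := fun _ => 0) (K := K) inferInstance
    (part_rec (Partrec.nat_iff.1 hf))).congr fun F e => by simp [eq_comm]) h
theorem AF.prim {f : ℕ → ℕ} (hf : Primrec f) (h : AF K t) : AF K fun F e => f (t F e) := AF.comp hf.to_comp h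
theorem AF.prim2 {f : ℕ → ℕ → ℕ} (hf : Primrec₂ f) (h : AF K t) (h' : AF K s) : AF K fun F e => f (t F e) (s F e) := by
  have : Primrec fun n : ℕ => f n.unpair.1 n.unpair.2 := hf.comp (Primrec.fst.comp Primrec.unpair) (Primrec.snd.comp Primrec.unpair)
  have := AF.prim (K := K) this (inferInstance : AF K fun F e => Nat.pair (t F e) (s F e))
  simpa using this
theorem Df.prim {p : ℕ → Prop} (hp : PrimrecPred p) (h : AF K t) : Df K fun F e => p (t F e) := by
  have : Primrec fun n => if p n then 1 else 0 := Primrec.ite hp (Primrec.const 1) (Primrec.const 0)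
  have := AF.prim (K := K) this h
  exact (inferInstance : Df K fun F e => (if p (t F e) then 1 else 0) = 1).congr fun F e => by
    split_ifs with h <;> simp [h]
theorem Df.prim2 {p : ℕ → ℕ → Prop} (hp : PrimrecRel p) (h : AF K t) (h' : AF K s) : Df K fun F e => p (t F e) (s F e) := by
  have : PrimrecPred fun n : ℕ => p n.unpair.1 n.unpair.2 :=
    hp.comp (Primrec.fst.comp Primrec.unpair) (Primrec.snd.comp Primrec.unpair)
  have := Df.prim (K := K) this (inferInstance : AF K fun F e => Nat.pair (t F e) (s F e))
  simpa using this
end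
theorem Ar.fsub {P} (h : Ar P) : ∀ (r : ℕ → ℕ) (s : ℕ → FE → NE → ℕ → ℕ)
    (_ : ∀ i, AF Ar fun F e => s i F (fun i => e (i+1)) (e 0)),
    Ar fun F e => P (fun i => s i F e) (fun i => e (r i)) := by
  induction h with
  | add i j k => exact fun r s _ => Ar.add _ _ _
  | mul i j k => exact fun r s _ => Ar.mul _ _ _
  | eq i j => exact fun r s _ => Ar.eq _ _
  | app i j k =>
    intro r s h
    have := Df.sub (K := Ar) (P := fun F e z => s i F e z = e (r k)) (t := fun F e => e (r j))
      ((h i).h.ren (push (r k + 1) (push 0 fun i => i+1)) id :) inferInstance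
    exact this.h
  | fls => exact fun r s _ => Ar.fls
  | imp _ _ h1 h2 => exact fun r s h => Ar.imp (h1 r s h) (h2 r s h)
  | @all P _ ih =>
    intro r s h
    convert Ar.all (ih (fun i => Nat.casesOn i 0 fun i => r i + 1) (fun i F e => s i F (fun i => e (i+1))) ?_) using 6
    · rename_i i
      cases i <;> rfl
    · intro i
      exact ⟨((h i).h.ren (push 0 (push 1 fun i => i+3)) id :)⟩

def Sg (A : Set ℕ) (P : FE → NE → Prop) : Prop :=
  ∃ Q, Ar Q ∧ ∀ F e, P F e ↔ ∃ g, Q (push g (push (charFun A) F)) e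
def Dl (A : Set ℕ) (P : FE → NE → Prop) : Prop := Sg A P ∧ Sg A fun F e => ¬ P F e

section
variable {A : Set ℕ} {P Q : FE → NE → Prop}

theorem Sg.congr (h : Sg A P) (h' : ∀ F e, Q F e ↔ P F e) : Sg A Q := by
  have : Q = P := by funext F e; exact propext (h' F e)
  rw [this]; exact h
theorem Sg.ar (h : Ar P) : Sg A P := ⟨_, h.ren id (fun i => i+2), fun F e => ⟨fun h => ⟨0, h⟩, fun ⟨_, h⟩ => h⟩⟩
theorem Sg.mem (i : ℕ) : Sg A fun _ e => e i ∈ A :=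
  ⟨fun F e => F 1 (e i) = 1, (inferInstance : Df Ar fun F e => F 1 (e i) = 1).h, fun F e => by
    simp [charFun]⟩
theorem Sg.nmem (i : ℕ) : Sg A fun _ e => ¬ e i ∈ A :=
  ⟨fun F e => F 1 (e i) = 0, (inferInstance : Df Ar fun F e => F 1 (e i) = 0).h, fun F e => by
    simp [charFun]⟩
theorem Sg.or (h1 : Sg A P) (h2 : Sg A Q) : Sg A fun F e => P F e ∨ Q F e := by
  obtain ⟨P', hP, h1⟩ := h1
  obtain ⟨Q', hQ, h2⟩ := h2
  have := Df.mk hP; have := Df.mk hQ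
  refine ⟨fun F e => P' F e ∨ Q' F e, (inferInstance : Df Ar fun F e => P' F e ∨ Q' F e).h, fun F e => ?_⟩
  simp only [h1, h2, exists_or]
theorem Sg.and (h1 : Sg A P) (h2 : Sg A Q) : Sg A fun F e => P F e ∧ Q F e := by
  obtain ⟨P', hP, h1⟩ := h1
  obtain ⟨Q', hQ, h2⟩ := h2
  have key (c : ℕ) : ∀ i, AF Ar fun F e => (Nat.casesOn (motive := fun _ => ℕ → ℕ) i (fun x => F 0 (Nat.pair c x)) fun i => F (i+1)) (e 0) := by
    intro i
    rcases i with _ | i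
    · exact (inferInstance : AF Ar fun F e => F 0 (Nat.pair c (e 0)))
    · exact (inferInstance : AF Ar fun F e => F (i+1) (e 0))
  refine ⟨_, (@Df.and Ar _ _ _ ⟨hP.fsub (fun i => i) (fun i F e => push (fun x => F 0 (Nat.pair 0 x)) (fun i => F (i+1)) i) (key 0)⟩ ⟨hQ.fsub (fun i => i) (fun i F e => push (fun x => F 0 (Nat.pair 1 x)) (fun i => F (i+1)) i) (key 1)⟩).h, fun F e => ?_⟩
  simp only [h1, h2]
  constructor
  · rintro ⟨⟨f, hf⟩, ⟨g, hg⟩⟩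
    refine ⟨fun x => if x.unpair.1 = 0 then f x.unpair.2 else g x.unpair.2, ?_, ?_⟩
    · convert hf using 1
      funext i; rcases i with _ | i <;> simp
    · convert hg using 1
      funext i; rcases i with _ | i <;> simp
  · rintro ⟨g, h, h'⟩
    exact ⟨⟨_, h⟩, ⟨_, h'⟩⟩
theorem Sg.all (h : Sg A P) : Sg A fun F e => ∀ x, P F (push x e) := by
  obtain ⟨P', hP, h1⟩ := h
  have key : ∀ i, AF Ar fun F e => (Nat.casesOn (motive := fun _ => ℕ → ℕ) i (fun x => F 0 (Nat.pair (e 1) x)) fun i => F (i+1)) (e 0) := by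
    intro i
    rcases i with _ | i
    · exact (inferInstance : AF Ar fun F e => F 0 (Nat.pair (e 1) (e 0)))
    · exact (inferInstance : AF Ar fun F e => F (i+1) (e 0))
  refine ⟨_, Ar.all (hP.fsub (fun i => i) (fun i F e x => (Nat.casesOn (motive := fun _ => ℕ → ℕ) i (fun x => F 0 (Nat.pair (e 0) x)) fun i => F (i+1)) x) key), fun F e => ?_⟩
  simp_rw [h1]
  constructor
  · intro h
    choose g hg using h
    refine ⟨fun x => g x.unpair.1 x.unpair.2, fun x => ?_⟩
    convert hg x using 2 with i
    rcases i with _ | i <;> simp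
  · rintro ⟨g, h⟩ x
    refine ⟨fun z => g (Nat.pair x z), ?_⟩
    convert h x using 1
    funext i; rcases i with _ | i <;> rfl
theorem Sg.ex (h : Sg A P) : Sg A fun F e => ∃ x, P F (push x e) := by
  obtain ⟨P', hP, h1⟩ := h
  have : Df Ar fun F e => P' F (push (e 0) fun i => e (i+1)) := (Df.mk hP).congr fun F e => by
    rw [show (push (e 0) fun i => e (i+1)) = e from funext fun i => by cases i <;> rfl]
  refine ⟨_, (inferInstance : Df Ar fun F e => ∃ x, P' F (push x e)).h, fun F e => ?_⟩
  simp_rw [h1]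
  exact exists_comm
theorem Sg.exf {P : FE → NE → (ℕ → ℕ) → Prop} (h : Sg A fun F e => P (fun i => F (i+1)) e (F 0)) : Sg A fun F e => ∃ g, P F e g := by
  obtain ⟨P', hP, h1⟩ := h
  let s (i : ℕ) (F : FE) (e : NE) : ℕ → ℕ := Nat.casesOn (motive := fun _ => ℕ → ℕ) i (fun x => F 0 (Nat.pair 0 x)) fun i =>
    Nat.casesOn (motive := fun _ => ℕ → ℕ) i (fun x => F 1 x) fun i =>  Nat.casesOn (motive := fun _ => ℕ → ℕ) i (fun x => F 0 (Nat.pair 1 x)) fun i x => F (i+2) x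
  have key : ∀ i, AF Ar fun F e => s i F (fun i => e (i+1)) (e 0) := by
    rintro (_ | _ | _ | i)
    · exact (inferInstance : AF Ar fun F e => F 0 (Nat.pair 0 (e 0)))
    · exact (inferInstance : AF Ar fun F e => F 1 (e 0))
    · exact (inferInstance : AF Ar fun F e => F 0 (Nat.pair 1 (e 0)))
    · exact (inferInstance : AF Ar fun F e => F (i+2) (e 0))
  refine ⟨_, hP.fsub (fun i => i) s key, fun F e => ?_⟩
  have h1 (g) : P F e g ↔ _ := h1 (push g F) e
  simp_rw [h1]
  constructor
  · rintro ⟨f, g, h⟩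
    refine ⟨fun x => if x.unpair.1 = 0 then g x.unpair.2 else f x.unpair.2, ?_⟩
    convert h using 1
    funext i; rcases i with _ | _ | _ | i <;> simp [s]
  · rintro ⟨g, h⟩
    refine ⟨fun x => g (Nat.pair 1 x), fun x => g (Nat.pair 0 x), ?_⟩
    convert h using 1
    funext i; rcases i with _ | _ | _ | i <;> rfl
theorem Sg.ren (h : Sg A P) (r s : ℕ → ℕ) : Sg A fun F e => P (fun i => F (s i)) (fun i => e (r i)) := by
  obtain ⟨P', hP, h1⟩ := h
  refine ⟨_, hP.ren r (push 0 (push 1 fun i => s i + 2)), fun F e => ?_⟩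
  simp only [h1]
  refine exists_congr fun g => iff_of_eq ?_
  congr 1
  funext i
  rcases i with _ | _ | i <;> rfl
theorem Ar.not (h : Ar P) : Ar fun F e => ¬ P F e := h.imp Ar.fls
instance : ArLike (Dl A) where
  ar h := ⟨Sg.ar h, Sg.ar h.not⟩
  imp h1 h2 := ⟨(h1.2.or h2.1).congr fun F e => by tauto, (h1.1.and h2.2).congr fun F e => by tauto⟩
  all h := ⟨h.1.all, h.2.ex.congr fun F e => by simp⟩
  ren r s h := ⟨h.1.ren r s, h.2.ren r s⟩

theorem Df.sg (h : Df (Dl A) P) : Df (Sg A) P := ⟨h.h.1⟩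
theorem Df.nsg (h : Df (Dl A) P) : Df (Sg A) fun F e => ¬ P F e := ⟨h.h.2⟩
theorem Df.scongr (h : Df (Sg A) P) (h' : ∀ F e, Q F e ↔ P F e) : Df (Sg A) Q := ⟨h.h.congr h'⟩
instance (priority := 3000) Sgi.and [h1 : Df (Sg A) P] [h2 : Df (Sg A) Q] : Df (Sg A) fun F e => P F e ∧ Q F e := ⟨h1.h.and h2.h⟩
instance (priority := 3000) Sgi.or [h1 : Df (Sg A) P] [h2 : Df (Sg A) Q] : Df (Sg A) fun F e => P F e ∨ Q F e := ⟨h1.h.or h2.h⟩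
instance (priority := 3000) Sgi.imp [h1 : Df (Dl A) P] [h2 : Df (Sg A) Q] : Df (Sg A) fun F e => P F e → Q F e :=
  ⟨(h1.h.2.or h2.h).congr fun F e => by tauto⟩
instance (priority := 3000) Sgi.all {P : FE → NE → ℕ → Prop} [h : Df (Sg A) fun F e => P F (fun i => e (i+1)) (e 0)] :
    Df (Sg A) fun F e => ∀ x, P F e x := ⟨h.h.all⟩
instance (priority := 3000) Sgi.ex {P : FE → NE → ℕ → Prop} [h : Df (Sg A) fun F e => P F (fun i => e (i+1)) (e 0)] :
    Df (Sg A) fun F e => ∃ x, P F e x := ⟨h.h.ex⟩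
instance (priority := 3000) Sgi.exf {P : FE → NE → (ℕ → ℕ) → Prop} [h : Df (Sg A) fun F e => P (fun i => F (i+1)) e (F 0)] :
    Df (Sg A) fun F e => ∃ x, P F e x := ⟨h.h.exf⟩
instance (priority := 500) Sgi.dl [h : Df (Dl A) P] : Df (Sg A) P := h.sg
theorem Df.mkDl (h1 : Df (Sg A) P) (h2 : Df (Sg A) fun F e => ¬ P F e) : Df (Dl A) P := ⟨h1.h, h2.h⟩
theorem Df.sren (h : Df (Sg A) P) (r s : ℕ → ℕ) : Df (Sg A) fun F e => P (fun i => F (s i)) (fun i => e (r i)) := ⟨h.h.ren r s⟩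
theorem Df.ssub {P : FE → NE → ℕ → Prop} {t} (h : Df (Sg A) fun F e => P F (fun i => e (i+1)) (e 0))
    (ht : AF (Dl A) t) : Df (Sg A) fun F e => P F e (t F e) := by
  have := ht.h
  exact (inferInstance : Df (Sg A) fun F e => ∀ x, t F e = x → P F e x).scongr fun _ _ => by simp
theorem Df.ssub1 {P : FE → ℕ → Prop} {t} (h : Df (Sg A) fun F e => P F (e 0)) (ht : AF (Dl A) t) :
    Df (Sg A) fun F e => P F (t F e) := Df.ssub (P := fun F e x => P F x) h ht
theorem Df.ssub2 {P : FE → ℕ → ℕ → Prop} {t s} (h : Df (Sg A) fun F e => P F (e 0) (e 1)) (ht : AF (Dl A) t) (hs : AF (Dl A) s) :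
    Df (Sg A) fun F e => P F (t F e) (s F e) :=
  Df.ssub (P := fun F e x => P F (t F e) x) (Df.ssub (P := fun F e x => P F x (e 0))
    (h) ht.tail) hs
theorem Df.sfsub {P : FE → NE → (ℕ → ℕ) → Prop} {g : FE → NE → ℕ → ℕ} (h : Df (Sg A) fun F e => P (fun i => F (i+1)) e (F 0))
    (hg : AF (Dl A) fun F e => g F (fun i => e (i+1)) (e 0)) : Df (Sg A) fun F e => P F e (g F e) := by
  have : Df (Dl A) fun F e => g (fun i => F (i+1)) (fun i => e (i+1)) (e 0) = F 0 (e 0) :=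
    Df.sub (P := fun F e z => g (fun i => F (i+1)) (fun i => e (i+1)) (e 0) = z) (hg.h.ren id fun i => i+1) inferInstance
  refine (inferInstance : Df (Sg A) fun F e => ∃ f : ℕ → ℕ, (∀ x, g F e x = f x) ∧ P F e f).scongr fun F e => ?_
  exact ⟨fun h => ⟨_, fun _ => rfl, h⟩, fun ⟨f, h, h'⟩ => by rwa [show g F e = f from funext h]⟩
theorem Df.fsub {P : FE → NE → (ℕ → ℕ) → Prop} {g : FE → NE → ℕ → ℕ} (h : Df (Dl A) fun F e => P (fun i => F (i+1)) e (F 0))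
    (hg : AF (Dl A) fun F e => g F (fun i => e (i+1)) (e 0)) : Df (Dl A) fun F e => P F e (g F e) :=
  Df.mkDl (Df.sfsub h.sg hg) (Df.sfsub (P := fun F e g => ¬ P F e g) h.nsg hg)
instance memA {t} [ht : AF (Dl A) t] : Df (Dl A) fun F e => t F e ∈ A :=
  Df.sub1 (P := fun F x => x ∈ A) ⟨Sg.mem 0, Sg.nmem 0⟩ ht
instance chA {t} [ht : AF (Dl A) t] : AF (Dl A) fun F e => charFun A (t F e) :=
  (inferInstance : AF (Dl A) fun F e => if t F e ∈ A then 1 else 0)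

/-- hyperarithmetic function, set and relation -/
def HF (A : Set ℕ) (f : ℕ → ℕ) : Prop := AF (Dl A) fun _ e => f (e 0)
theorem HF.app {f} (h : HF A f) {t} (ht : AF (Dl A) t) : AF (Dl A) fun F e => f (t F e) :=
  AF.mk1 (f := fun _ x => f x) (h.h.ren (push 1 fun _ => 0) id) ht
theorem HF.sg {f} (h : Df (Sg A) fun F e => f (e 0) = e 1) : HF A f := by
  refine ⟨Df.mkDl (h.sren (push 1 fun _ => 0) id) ?_⟩
  have := h.sren (push 2 fun _ => 0) id
  exact (inferInstance : Df (Sg A) fun F e => ∃ z, f (e 1) = z ∧ ¬ z = e 0).scongr fun F e => by simp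
end

theorem Ar.term (n : ℕ) (t : L.Term (Fin 1 ⊕ Fin n)) : AF Ar fun F e =>
    @Term.realize L ℕ (str {x | F 1 x = 1} (F 0)) _ (Sum.elim (fun _ => e n) (fun i : Fin n => e (n-1-i))) t := by
  induction t with
  | var i => rcases i with i | i <;> simp only [Term.realize, Sum.elim] <;> infer_instance
  | @func l f ts ih =>
    cases f with
    | zero => exact (inferInstance : AF Ar fun F e => 0)
    | succ => have := ih 0; exact AF.succ
    | fn => have := ih 0; exact AF.app 0
    | add => have := ih 0; have := ih 1; exact AF.add
    | mul => have := ih 0; have := ih 1; exact AF.mul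

theorem Ar.form (n : ℕ) (θ : L.BoundedFormula (Fin 1) n) : Df Ar fun F e =>
    @BoundedFormula.Realize L ℕ (str {x | F 1 x = 1} (F 0)) _ n θ (fun _ => e n) (fun i : Fin n => e (n-1-i)) := by
  induction θ with
  | falsum => exact Df.fls
  | equal t u =>
    have := Ar.term _ t; have := Ar.term _ u
    exact Df.eq
  | rel r ts =>
    cases r with
    | mem =>
      have := Ar.term _ (ts 0)
      exact @Df.eq Ar _ _ _ (AF.app 1) (AF.const 1)
    | le =>
      have := Ar.term _ (ts 0)
      have := Ar.term _ (ts 1)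
      exact Df.le
  | imp _ _ h1 h2 => exact Df.imp
  | @all n θ h =>
    refine Df.congr (⟨Ar.all h.h⟩) fun F e => ?_
    letI := str {x | F 1 x = 1} (F 0)
    rw [BoundedFormula.realize_all]
    refine forall_congr' fun x => iff_of_eq ?_
    congr 1
    funext i
    refine Fin.lastCases ?_ (fun j => ?_) i
    · simp
    · simp only [Fin.snoc_castSucc, Fin.val_castSucc]
      rw [show n + 1 - 1 - (j : ℕ) = (n - 1 - j) + 1 by omega]

def envm (m : ℕ) (xs : Fin m → ℕ) (n : ℕ) : NE := fun i =>
  if h : i < m then xs ⟨m - 1 - i, by omega⟩ else if i = m then n else 0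
def tmm (m i : ℕ) : L.Term (Fin 1 ⊕ Fin m) :=
  if h : i < m then Term.var (Sum.inr ⟨m - 1 - i, by omega⟩) else if i = m then Term.var (Sum.inl 0) else Term.func (Func.zero : L.Functions 0) ![]
theorem tmm_real (B f m i n xs) : @Term.realize L ℕ (str B f) _ (Sum.elim ![n] xs) (tmm m i) = envm m xs n i := by
  unfold tmm envm
  split_ifs with h h' <;> simp [Term.realize]
  rfl
noncomputable def fenv (B : Set ℕ) (f : ℕ → ℕ) : FE := push f (push (charFun B) fun _ _ => 0)

theorem Ar.toForm {P} (h : Ar P) : ∀ m, ∃ θ : L.BoundedFormula (Fin 1) m, ∀ B f n xs,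
    @BoundedFormula.Realize L ℕ (str B f) _ m θ ![n] xs ↔ P (fenv B f) (envm m xs n) := by
  induction h with
  | add i j k =>
    refine fun m => ⟨(Term.func (Func.add : L.Functions 2) ![tmm m i, tmm m j]).bdEqual (tmm m k), fun B f n xs => ?_⟩
    simp only [← tmm_real B f]; exact Iff.rfl
  | mul i j k =>
    refine fun m => ⟨(Term.func (Func.mul : L.Functions 2) ![tmm m i, tmm m j]).bdEqual (tmm m k), fun B f n xs => ?_⟩
    simp only [← tmm_real B f]; exact Iff.rfl
  | eq i j =>
    refine fun m => ⟨(tmm m i).bdEqual (tmm m j), fun B f n xs => ?_⟩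
    simp [BoundedFormula.Realize, Term.bdEqual, Term.realize, tmm_real]
  | app i j k =>
    intro m
    let z : L.Term (Fin 1 ⊕ Fin m) := Term.func (Func.zero : L.Functions 0) ![]
    let o : L.Term (Fin 1 ⊕ Fin m) := Term.func (Func.succ : L.Functions 1) ![z]
    rcases i with _ | _ | i
    · refine ⟨(Term.func (Func.fn : L.Functions 1) ![tmm m j]).bdEqual (tmm m k), fun B f n xs => ?_⟩
      simp only [← tmm_real B f]; exact Iff.rfl
    · refine ⟨((BoundedFormula.rel (Rel.mem : L.Relations 1) ![tmm m j]).imp ((tmm m k).bdEqual o)) ⊓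
        ((∼ (BoundedFormula.rel (Rel.mem : L.Relations 1) ![tmm m j])).imp ((tmm m k).bdEqual z)), fun B f n xs => ?_⟩
      letI := str B f
      rw [BoundedFormula.realize_inf, BoundedFormula.realize_imp, BoundedFormula.realize_imp, BoundedFormula.realize_not]
      have h1 : (BoundedFormula.rel (Rel.mem : L.Relations 1) ![tmm m j]).Realize ![n] xs ↔ envm m xs n j ∈ B := by
        rw [← tmm_real B f]; exact Iff.rfl
      have h2 : ((tmm m k).bdEqual o).Realize ![n] xs ↔ envm m xs n k = 1 := by
        rw [← tmm_real B f]; exact Iff.rfl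
      have h3 : ((tmm m k).bdEqual z).Realize ![n] xs ↔ envm m xs n k = 0 := by
        rw [← tmm_real B f]; exact Iff.rfl
      rw [h1, h2, h3]
      show _ ↔ charFun B _ = _
      unfold charFun
      split_ifs with h <;> simp [h, eq_comm]
    · refine ⟨(tmm m k).bdEqual z, fun B f n xs => ?_⟩
      refine Iff.trans ?_ eq_comm
      simp only [← tmm_real B f]; exact Iff.rfl
  | fls => exact fun m => ⟨⊥, fun B f n xs => Iff.rfl⟩
  | imp _ _ h1 h2 =>
    intro m
    obtain ⟨θ, h1⟩ := h1 m
    obtain ⟨χ, h2⟩ := h2 m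
    refine ⟨θ.imp χ, fun B f n xs => ?_⟩
    letI := str B f
    rw [BoundedFormula.realize_imp, h1, h2]
  | all _ h =>
    intro m
    obtain ⟨θ, h⟩ := h (m+1)
    refine ⟨θ.all, fun B f n xs => ?_⟩
    letI := str B f
    rw [BoundedFormula.realize_all]
    refine forall_congr' fun x => ?_
    rw [h]
    refine iff_of_eq ?_
    congr 1
    funext i
    rcases i with _ | i
    · simp [envm, Fin.snoc]
    · simp only [envm, add_lt_add_iff_right, add_left_inj]
      congr! 2 with h
      simp only [Fin.snoc]
      rw [dif_pos (by dsimp; omega)]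
      simp only [cast_eq]
      congr 1
      ext
      simp; omega

theorem sigma_iff (A X : Set ℕ) : Sigma11In A X ↔ Df (Sg A) fun _ e => e 0 ∈ X := by
  constructor
  · rintro ⟨θ, h⟩
    refine ⟨_, (Ar.form 0 θ).h, fun F e => (h (e 0)).trans (exists_congr fun g => iff_of_eq ?_)⟩
    unfold Realizes Formula.Realize
    congr 1
    · congr 1
      ext x; simp [charFun]
    · funext i; fin_cases i; rfl
    · exact Subsingleton.elim _ _
  · rintro ⟨⟨Q, hQ, h⟩⟩
    obtain ⟨θ, hθ⟩ := hQ.toForm 0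
    refine ⟨θ, fun n => (h (fun _ _ => 0) (push n fun _ => 0)).trans (exists_congr fun g => ?_)⟩
    letI := str A g
    rw [Realizes, Formula.Realize, hθ]
    refine iff_of_eq ?_
    congr 1
    funext i
    rcases i with _ | i <;> simp [envm]

theorem hyp_iff (A X : Set ℕ) : HypLE X A ↔ Df (Dl A) fun _ e => e 0 ∈ X :=
  ⟨fun h => Df.mkDl ((sigma_iff _ _).1 h.1) ((sigma_iff _ _).1 h.2), fun h => ⟨(sigma_iff _ _).2 h.sg, (sigma_iff _ _).2 h.nsg⟩⟩

theorem recIn_graph {A : Set ℕ} {f : ℕ → ℕ} (h : RecursiveIn (charFun A) f) : HF A f :=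
  HF.sg ((rec_graph (K := Dl A) inferInstance h).congr fun F e => by simp [eq_comm]).sg

theorem relRec_dl {A : Set ℕ} {r : ℕ → ℕ → Prop} (h : RelRecursiveIn A r) : Df (Dl A) fun _ e => r (e 0) (e 1) := by
  have h : HF A fun p : ℕ => if r p.unpair.1 p.unpair.2 then 1 else 0 := recIn_graph (by
    unfold RelRecursiveIn at h; refine Eq.mp (congrArg _ ?_) h; funext p; simp only [PFun.coe_val]; split_ifs <;> rfl)
  have := h.app (inferInstance : AF (Dl A) fun F e => Nat.pair (e 0) (e 1))
  exact (inferInstance : Df (Dl A) fun F e => (if r (Nat.pair (e 0) (e 1)).unpair.1 (Nat.pair (e 0) (e 1)).unpair.2 then 1 else 0) = 1).congr fun F e => by simp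
inductive PR : (FE → NE → ℕ → ℕ) → Prop
  | prim {f : ℕ → ℕ} : Primrec f → PR fun _ _ n => f n
  | fn (i : ℕ) {Φ} : PR Φ → PR fun F e n => F i (Φ F e n)
  | ev {Φ} : PR Φ → PR fun F e n => e (Φ F e n)
  | comp {f : ℕ → ℕ → ℕ} {Φ Ψ} : Primrec₂ f → PR Φ → PR Ψ → PR fun F e n => f (Φ F e n) (Ψ F e n)

theorem PR.pre {Φ} (h : PR Φ) {f : ℕ → ℕ} (hf : Primrec f) : PR fun F e n => Φ F e (f n) := by
  induction h with
  | prim h => exact .prim (h.comp hf)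
  | fn i _ h => exact .fn i h
  | ev _ h => exact .ev h
  | comp h _ _ h1 h2 => exact .comp h h1 h2

theorem PR.sub {Φ} (h : PR Φ) {Θ : ℕ → FE → NE → ℕ → ℕ} {E : FE → NE → ℕ → ℕ} (hΘ : ∀ i, PR (Θ i)) (hE : PR E) 
    {p q : ℕ → ℕ} (hp : Primrec p) (hq : Primrec q) :
    PR fun F e n => Φ (fun i y => Θ i F e (Nat.pair (p n) y)) (fun i => E F e (Nat.pair (p n) i)) (q n) := by
  have key {Θ Φ : FE → NE → ℕ → ℕ} (hΘ : PR Θ) (h : PR Φ) : PR fun F e n => Θ F e (Nat.pair (p n) (Φ F e n)) := by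
    induction hΘ with
    | @prim f hf => exact .comp (f := fun a b => f (Nat.pair a b)) (hf.comp₂ Primrec₂.natPair) (.prim hp) h
    | fn i _ h => exact .fn i h
    | ev _ h => exact .ev h
    | comp h _ _ h1 h2 => exact .comp h h1 h2
  induction h with
  | prim h => exact .prim (h.comp hq)
  | fn i _ h => exact key (hΘ i) h
  | ev _ h => exact key hE h
  | comp h _ _ h1 h2 => exact .comp h h1 h2

theorem PR.id : PR fun _ _ n => n := .prim Primrec.id
theorem PR.c (k : ℕ) : PR fun _ _ _ => k := .prim (Primrec.const k)
theorem prim_fst : Primrec fun n : ℕ => n.unpair.1 := Primrec.fst.comp Primrec.unpair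
theorem prim_snd : Primrec fun n : ℕ => n.unpair.2 := Primrec.snd.comp Primrec.unpair
theorem PR.ite {Φ Ψ Ω} (h1 : PR Φ) (h2 : PR Ψ) (h3 : PR Ω) : PR fun F e n => if Φ F e n = 0 then Ψ F e n else Ω F e n := by
  have h : Primrec₂ fun a b : ℕ => if a = 0 then b.unpair.1 else b.unpair.2 :=
    Primrec.ite (Primrec.eq.comp Primrec.fst (Primrec.const 0)) (prim_fst.comp Primrec.snd) (prim_snd.comp Primrec.snd)
  have := PR.comp h h1 (PR.comp Primrec₂.natPair h2 h3)
  simpa using this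

def NF (P : FE → NE → Prop) : Prop := ∃ Φ, PR Φ ∧ ∀ F e, P F e ↔ ∃ g, ∀ n, Φ (push g F) e n = 0

theorem NF.congr {P Q} (h : NF P) (h' : ∀ F e, Q F e ↔ P F e) : NF Q := by
  have : Q = P := by funext F e; exact propext (h' F e)
  rw [this]; exact h

theorem NF.or {P Q} (h1 : NF P) (h2 : NF Q) : NF fun F e => P F e ∨ Q F e := by
  obtain ⟨Φ, hΦ, h1⟩ := h1
  obtain ⟨Ψ, hΨ, h2⟩ := h2
  have key : ∀ i, PR fun F e n => push (fun x => F 0 (x+1)) (fun i => F (i+1)) i n.unpair.2 := by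
    rintro (_ | i)
    · exact .fn 0 (.prim (Primrec.succ.comp prim_snd))
    · exact .fn (i+1) (.prim prim_snd)
  have key2 : PR fun F e n => e n.unpair.2 := .ev (.prim prim_snd)
  refine ⟨_, PR.ite (.fn 0 (.c 0)) (hΦ.sub key key2 (Primrec.const 0) Primrec.id) (hΨ.sub key key2 (Primrec.const 0) Primrec.id), fun F e => ?_⟩
  simp only [h1, h2, Nat.unpair_pair]
  constructor
  · rintro (⟨g, h⟩ | ⟨g, h⟩)
    · exact ⟨push 0 g, h⟩
    · exact ⟨push 1 g, h⟩
  · rintro ⟨g, h⟩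
    by_cases h0 : g 0 = 0
    · exact Or.inl ⟨fun x => g (x+1), fun n => by have := h n; rw [if_pos (show push g F 0 0 = 0 from h0)] at this; exact this⟩
    · exact Or.inr ⟨fun x => g (x+1), fun n => by have := h n; rw [if_neg (show ¬ push g F 0 0 = 0 from h0)] at this; exact this⟩

theorem NF.ex {P} (h1 : NF P) : NF fun F e => ∃ x, P F (push x e) := by
  obtain ⟨Φ, hΦ, h1⟩ := h1
  have key : ∀ i, PR fun F e n => push (fun x => F 0 (x+1)) (fun i => F (i+1)) i n.unpair.2 := by
    rintro (_ | i)
    · exact .fn 0 (.prim (Primrec.succ.comp prim_snd))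
    · exact .fn (i+1) (.prim prim_snd)
  have key2 : PR fun F e n => if n.unpair.2 = 0 then F 0 0 else e (n.unpair.2 - 1) :=
    .ite (.prim prim_snd) (.fn 0 (.c 0)) (.ev (.prim (Primrec.pred.comp prim_snd)))
  refine ⟨_, hΦ.sub key key2 (Primrec.const 0) Primrec.id, fun F e => ?_⟩
  have e1 (x : ℕ) : (fun i => if i = 0 then x else e (i-1)) = push x e := by funext i; cases i <;> rfl
  simp only [h1, Nat.unpair_pair, e1]
  exact ⟨fun ⟨x, g, h⟩ => ⟨push x g, h⟩, fun ⟨g, h⟩ => ⟨g 0, fun x => g (x+1), h⟩⟩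

theorem NF.all {P} (h1 : NF P) : NF fun F e => ∀ x, P F (push x e) := by
  obtain ⟨Φ, hΦ, h1⟩ := h1
  have key : ∀ i, PR fun F e n => push (fun x => F 0 x) (fun i x => F (i+1) x.unpair.2) i n := by
    rintro (_ | i)
    · exact .fn 0 .id
    · exact .fn (i+1) (.prim prim_snd)
  have key2 : PR fun F e n => if n.unpair.2 = 0 then n.unpair.1 else e (n.unpair.2 - 1) :=
    .ite (.prim prim_snd) (.prim prim_fst) (.ev (.prim (Primrec.pred.comp prim_snd)))
  refine ⟨_, hΦ.sub key key2 prim_fst prim_snd, fun F e => ?_⟩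
  have e1 (x : ℕ) : (fun i => if i = 0 then x else e (i-1)) = push x e := by funext i; cases i <;> rfl
  simp only [h1, Nat.unpair_pair, e1]
  constructor
  · intro h
    choose g h using h
    refine ⟨fun x => g x.unpair.1 x.unpair.2, fun n => ?_⟩
    convert h n.unpair.1 n.unpair.2 using 2
    funext i y
    rcases i with _ | i <;> simp [push]
  · rintro ⟨g, h⟩ x
    refine ⟨fun y => g (Nat.pair x y), fun n => ?_⟩
    have := h (Nat.pair x n)
    simp only [Nat.unpair_pair] at this
    convert this using 2
    funext i y
    rcases i with _ | i <;> simp [push]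

theorem NF.and {P Q} (h1 : NF P) (h2 : NF Q) : NF fun F e => P F e ∧ Q F e := by
  obtain ⟨Φ, hΦ, h1⟩ := h1
  obtain ⟨Ψ, hΨ, h2⟩ := h2
  have key : ∀ i, PR fun F e n => push (fun x => F 0 x) (fun i x => F (i+1) x.unpair.2) i n := by
    rintro (_ | i)
    · exact .fn 0 .id
    · exact .fn (i+1) (.prim prim_snd)
  have key2 : PR fun F e n => e n.unpair.2 := .ev (.prim prim_snd)
  refine ⟨_, PR.ite (.prim prim_fst) (hΦ.sub key key2 (Primrec.const 0) prim_snd) (hΨ.sub key key2 (Primrec.const 1) prim_snd), fun F e => ?_⟩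
  simp only [h1, h2, Nat.unpair_pair]
  constructor
  · rintro ⟨⟨f, hf⟩, g, hg⟩
    refine ⟨fun x => if x.unpair.1 = 0 then f x.unpair.2 else g x.unpair.2, fun n => ?_⟩
    split_ifs with h
    · convert hf n.unpair.2 using 2
      funext i y
      rcases i with _ | i <;> simp [push]
    · convert hg n.unpair.2 using 2
      funext i y
      rcases i with _ | i <;> simp [push]
  · rintro ⟨g, h⟩
    refine ⟨⟨fun y => g (Nat.pair 0 y), fun n => ?_⟩, ⟨fun y => g (Nat.pair 1 y), fun n => ?_⟩⟩
    · have := h (Nat.pair 0 n)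
      simp only [Nat.unpair_pair, if_true] at this
      convert this using 2
      funext i y
      rcases i with _ | i <;> simp [push]
    · have := h (Nat.pair 1 n)
      simp only [Nat.unpair_pair, one_ne_zero, if_false] at this
      convert this using 2
      funext i y
      rcases i with _ | i <;> simp [push]

theorem NF.base {Φ Ψ} (h1 : PR Φ) (h2 : PR Ψ) : (NF fun F e => Φ F e 0 = Ψ F e 0) ∧ NF fun F e => ¬ Φ F e 0 = Ψ F e 0 := by
  have key : ∀ i, PR fun F e n => F (i+1) n.unpair.2 := fun i => .fn (i+1) (.prim prim_snd)
  have key2 : PR fun F e n => e n.unpair.2 := .ev (.prim prim_snd)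
  have h1 := h1.sub key key2 (Primrec.const 0) (Primrec.const 0)
  have h2 := h2.sub key key2 (Primrec.const 0) (Primrec.const 0)
  have hf : Primrec₂ fun a b : ℕ => if a = b then 0 else 1 := Primrec.ite (Primrec.eq.comp Primrec.fst Primrec.snd) (Primrec.const 0) (Primrec.const 1)
  have hg : Primrec₂ fun a b : ℕ => if a = b then 1 else 0 := Primrec.ite (Primrec.eq.comp Primrec.fst Primrec.snd) (Primrec.const 1) (Primrec.const 0)
  exact ⟨⟨_, .comp hf h1 h2, fun F e => by simp; exact ⟨fun h => ⟨0, h⟩, fun ⟨_, h⟩ => h⟩⟩, ⟨_, .comp hg h1 h2, fun F e => by simp; exact ⟨fun h => ⟨0, h⟩, fun ⟨_, h⟩ => h⟩⟩⟩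

theorem Ar.nf {P} (h : Ar P) : NF P ∧ NF fun F e => ¬ P F e := by
  induction h with
  | add i j k => exact NF.base (Φ := fun F e _ => e i + e j) (.comp Primrec.nat_add (.ev (.c i)) (.ev (.c j))) (.ev (.c k))
  | mul i j k => exact NF.base (Φ := fun F e _ => e i * e j) (.comp Primrec.nat_mul (.ev (.c i)) (.ev (.c j))) (.ev (.c k))
  | eq i j => exact NF.base (.ev (.c i)) (.ev (.c j))
  | app i j k => exact NF.base (.fn i (.ev (.c j))) (.ev (.c k))
  | fls =>
    have h1 := NF.base (.c 0) (.c 1)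
    exact ⟨h1.1.congr (by simp), h1.2.congr (by simp)⟩
  | imp _ _ h1 h2 => exact ⟨(h1.2.or h2.1).congr fun F e => by tauto, (h1.1.and h2.2).congr fun F e => by tauto⟩
  | all _ h => exact ⟨h.1.all, h.2.ex.congr fun F e => by simp⟩

/-- reversed restriction -/
def rs (x : ℕ → ℕ) : ℕ → List ℕ
  | 0 => []
  | k+1 => x k :: rs x k
@[simp] theorem rs_len (x k) : (rs x k).length = k := by induction k <;> simp [rs, *]
theorem rs_get (x k i) : (rs x k).reverse[i]? = if i < k then some (x i) else none := by
  induction k with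
  | zero => simp [rs]
  | succ k ih =>
    simp only [rs, List.reverse_cons, List.getElem?_append, List.length_reverse, rs_len, ih]
    split_ifs with h1 h2 h2
    · rfl
    · omega
    · have : i = k := by omega
      simp [this]
    · have : i - k ≠ 0 := by omega
      obtain ⟨j, hj⟩ := Nat.exists_eq_succ_of_ne_zero this
      rw [hj]; simp
theorem rs_drop (x k j) (h : j ≤ k) : (rs x k).drop j = rs x (k - j) := by
  induction k generalizing j with
  | zero => simp [rs]
  | succ k ih =>
    cases j with
    | zero => simp
    | succ j => rw [show k + 1 - (j+1) = k - j by omega]; simpa [rs] using ih j (by omega)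

def fe2 (g a : ℕ → ℕ) : FE := push g (push a fun _ _ => 0)

theorem PR.use {Φ} (h : PR Φ) : ∃ ph : (List ℕ × List ℕ) × ℕ → Option ℕ, Primrec ph ∧
    ∀ g a m, (∀ k v, ph ((rs g k, rs a k), m) = some v → Φ (fe2 g a) (fun _ => 0) m = v) ∧
      ∃ K, ∀ k, K ≤ k → ph ((rs g k, rs a k), m) = some (Φ (fe2 g a) (fun _ => 0) m) := by
  induction h with
  | @prim f hf => exact ⟨fun p => some (f p.2), Primrec.option_some.comp (hf.comp Primrec.snd), fun g a m => ⟨by simp, 0, by simp⟩⟩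
  | @fn i Φ _ h =>
    obtain ⟨ph, hph, h⟩ := h
    rcases i with _ | _ | i
    · refine ⟨fun p => (ph p).bind fun v => p.1.1.reverse[v]?, Primrec.option_bind hph (Primrec.list_getElem?.comp (Primrec.list_reverse.comp (Primrec.fst.comp (Primrec.fst.comp Primrec.fst))) Primrec.snd), fun g a m => ⟨fun k v h' => ?_, ?_⟩⟩
      · simp only [Option.bind_eq_some_iff, rs_get, Option.ite_none_right_eq_some, Option.some.injEq] at h'
        obtain ⟨w, hw, hwk, rfl⟩ := h'
        simp only [(h g a m).1 k w hw]; rfl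
      · obtain ⟨K, hK⟩ := (h g a m).2
        refine ⟨K + Φ (fe2 g a) (fun _ => 0) m + 1, fun k hk => ?_⟩
        simp only [hK k (by omega), Option.bind_some, rs_get]
        rw [if_pos (by omega)]; rfl
    · refine ⟨fun p => (ph p).bind fun v => p.1.2.reverse[v]?, Primrec.option_bind hph (Primrec.list_getElem?.comp (Primrec.list_reverse.comp (Primrec.snd.comp (Primrec.fst.comp Primrec.fst))) Primrec.snd), fun g a m => ⟨fun k v h' => ?_, ?_⟩⟩
      · simp only [Option.bind_eq_some_iff, rs_get, Option.ite_none_right_eq_some, Option.some.injEq] at h'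
        obtain ⟨w, hw, hwk, rfl⟩ := h'
        simp only [(h g a m).1 k w hw]; rfl
      · obtain ⟨K, hK⟩ := (h g a m).2
        refine ⟨K + Φ (fe2 g a) (fun _ => 0) m + 1, fun k hk => ?_⟩
        simp only [hK k (by omega), Option.bind_some, rs_get]
        rw [if_pos (by omega)]; rfl
    · exact ⟨fun p => some 0, Primrec.const _, fun g a m => ⟨fun k v h => (Option.some.inj h :), 0, fun k _ => rfl⟩⟩
  | ev _ _ => exact ⟨fun p => some 0, Primrec.const _, fun g a m => ⟨fun k v h => by simpa using h, 0, fun k _ => rfl⟩⟩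
  | @comp f Φ Ψ hf _ _ h1 h2 =>
    obtain ⟨ph, hph, h1⟩ := h1
    obtain ⟨ψ, hψ, h2⟩ := h2
    refine ⟨fun p => (ph p).bind fun v => (ψ p).map fun w => f v w, Primrec.option_bind hph (Primrec.option_map (hψ.comp Primrec.fst) (hf.comp (Primrec.snd.comp Primrec.fst) Primrec.snd).to₂), fun g a m => ⟨fun k v h' => ?_, ?_⟩⟩
    · simp only [Option.bind_eq_some_iff, Option.map_eq_some_iff] at h'
      obtain ⟨x, hx, y, hy, rfl⟩ := h'
      simp only [(h1 g a m).1 k x hx, (h2 g a m).1 k y hy]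
    · obtain ⟨K, hK⟩ := (h1 g a m).2
      obtain ⟨K', hK'⟩ := (h2 g a m).2
      refine ⟨K + K', fun k hk => ?_⟩
      simp only [hK k (by omega), hK' k (by omega), Option.bind_some, Option.map_some]

open Nat.Partrec (Code)

def good (e n : ℕ) (τ σ : List ℕ) : Prop :=
  ∀ j < σ.length + 1, Code.evaln σ.length (Denumerable.ofNat Code e) (Encodable.encode (n, (σ.drop j, τ.drop j))) ≠ some 1

theorem good_prim : PrimrecPred fun p : (ℕ × ℕ) × (List ℕ × List ℕ) => good p.1.1 p.1.2 p.2.1 p.2.2 := by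
  have h1 : PrimrecRel fun (j : ℕ) (p : (ℕ × ℕ) × (List ℕ × List ℕ)) =>
      Code.evaln p.2.2.length (Denumerable.ofNat Code p.1.1) (Encodable.encode (p.1.2, (p.2.2.drop j, p.2.1.drop j))) ≠ some 1 := by
    refine PrimrecPred.not (Primrec.eq.comp (Code.primrec_evaln.comp (Primrec.pair (Primrec.pair ?_ ?_) ?_)) (Primrec.const _))
    · exact Primrec.list_length.comp (Primrec.snd.comp (Primrec.snd.comp Primrec.snd))
    · exact (Primrec.ofNat Code).comp (Primrec.fst.comp (Primrec.fst.comp Primrec.snd))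
    · exact Primrec.encode.comp (Primrec.pair (Primrec.snd.comp (Primrec.fst.comp Primrec.snd)) (Primrec.pair
        (Primrec.list_drop.comp Primrec.fst (Primrec.snd.comp (Primrec.snd.comp Primrec.snd)))
        (Primrec.list_drop.comp Primrec.fst (Primrec.fst.comp (Primrec.snd.comp Primrec.snd)))))
  have := h1.forall_mem_list.comp (f := fun p : (ℕ × ℕ) × (List ℕ × List ℕ) => List.range (p.2.2.length + 1)) (g := fun p => p)
    (Primrec.list_range.comp (Primrec.succ.comp (Primrec.list_length.comp (Primrec.snd.comp Primrec.snd)))) Primrec.id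
  exact this.of_eq fun p => by simp [good]

theorem F1aux {A X : Set ℕ} (h : Df (Sg A) fun _ e => e 0 ∈ X) :
    ∃ c, ∀ n, n ∈ X ↔ ∃ g, ∀ k, good c n (rs (charFun A) k) (rs g k) := by
  obtain ⟨Q, hQ, h⟩ := h.h
  obtain ⟨⟨Φ, hΦ, h1⟩, _⟩ := hQ.nf
  let Θ : ℕ → FE → NE → ℕ → ℕ := fun i F e m => push (fun x => F 0 (Nat.pair 0 x)) (push (fun x => F 0 (Nat.pair 1 x)) (push (fun x => F 1 x) fun _ _ => 0)) i m.unpair.2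
  have key : ∀ i, PR (Θ i) := by
    rintro (_ | _ | _ | i)
    · exact .fn 0 (.prim (Primrec₂.natPair.comp (Primrec.const 0) prim_snd))
    · exact .fn 0 (.prim (Primrec₂.natPair.comp (Primrec.const 1) prim_snd))
    · exact .fn 1 (.prim prim_snd)
    · exact .c 0
  have key2 : PR fun F e n => if n.unpair.2 = 0 then n.unpair.1 else 0 := .ite (.prim prim_snd) (.prim prim_fst) (.c 0)
  obtain ⟨ph, hph, hu⟩ := (hΦ.sub key key2 prim_fst prim_snd).use
  have hX : ∀ n, n ∈ X ↔ ∃ g, ∀ m k, ph ((rs g k, rs (charFun A) k), Nat.pair n m) ≠ none → ph ((rs g k, rs (charFun A) k), Nat.pair n m) = some 0 := by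
    intro n
    have e1 : n ∈ X ↔ ∃ g, ∀ m, Φ (fun i y => Θ i (fe2 g (charFun A)) (fun _ => 0) (Nat.pair n y)) (fun i => if i = 0 then n else 0) m = 0 := by
      refine (h (fun _ _ => 0) (push n fun _ => 0)).trans ?_
      have : (push n fun _ => 0 : NE) = fun i => if i = 0 then n else 0 := by funext i; cases i <;> rfl
      rw [this]
      simp only [h1]
      constructor
      · rintro ⟨f, g, h⟩
        refine ⟨fun x => if x.unpair.1 = 0 then g x.unpair.2 else f x.unpair.2, fun m => ?_⟩
        convert h m using 2
        funext i y
        rcases i with _ | _ | _ | i <;> simp [Θ, fe2]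
      · rintro ⟨g, h⟩
        refine ⟨fun y => g (Nat.pair 1 y), fun y => g (Nat.pair 0 y), fun m => ?_⟩
        convert h m using 2
        funext i y
        rcases i with _ | _ | _ | i <;> simp [Θ, fe2]
    rw [e1]
    refine exists_congr fun g => forall_congr' fun m => ?_
    obtain ⟨h1, K, h2⟩ := hu g (charFun A) (Nat.pair n m)
    simp only [Nat.unpair_pair] at h1 h2
    constructor
    · intro h k hk
      obtain ⟨v, hv⟩ := Option.ne_none_iff_exists'.1 hk
      rw [hv, ← h1 k v hv, h]
    · intro h
      have := h K
      rw [h2 K le_rfl] at this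
      simpa using this
  let ψ : ℕ × (List ℕ × List ℕ) → ℕ := fun p => if ∀ m ∈ List.range p.2.1.length, ph (p.2, Nat.pair p.1 m) ≠ none → ph (p.2, Nat.pair p.1 m) = some 0 then 0 else 1
  have hψ : Primrec ψ := by
    refine Primrec.ite ?_ (Primrec.const 0) (Primrec.const 1)
    have h1 : Primrec fun x : ℕ × (ℕ × (List ℕ × List ℕ)) => ph (x.2.2, Nat.pair x.2.1 x.1) :=
      hph.comp (Primrec.pair (Primrec.snd.comp Primrec.snd) (Primrec₂.natPair.comp (Primrec.fst.comp Primrec.snd) Primrec.fst))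
    have h2 : PrimrecRel fun (m : ℕ) (p : ℕ × (List ℕ × List ℕ)) => ph (p.2, Nat.pair p.1 m) ≠ none → ph (p.2, Nat.pair p.1 m) = some 0 :=
      (PrimrecPred.or (Primrec.eq.comp h1 (Primrec.const none)) (Primrec.eq.comp h1 (Primrec.const (some 0)))).of_eq fun x => by tauto
    exact h2.forall_mem_list.comp (Primrec.list_range.comp (Primrec.list_length.comp (Primrec.fst.comp Primrec.snd))) Primrec.id
  have hψ' : Nat.Partrec fun n => (Denumerable.ofNat (ℕ × (List ℕ × List ℕ)) n |> ψ : Part ℕ) := by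
    have := (hψ.comp (Primrec.ofNat (ℕ × (List ℕ × List ℕ)))).to_comp
    exact Partrec.nat_iff.1 this
  obtain ⟨c, hc⟩ := Code.exists_code.1 hψ'
  have hc' : ∀ p v, v ∈ Code.eval c (Encodable.encode p) ↔ v = ψ p := fun p v => by rw [hc]; simp only [Denumerable.ofNat_encode]; simp
  refine ⟨Encodable.encode c, fun n => ?_⟩
  rw [hX]
  refine exists_congr fun g => ?_
  constructor
  · intro h k j hj hbad
    rw [Denumerable.ofNat_encode] at hbad
    have h1 := (hc' _ _).1 (Code.evaln_sound hbad)
    rw [rs_len] at hj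
    rw [rs_drop _ _ _ (by omega), rs_drop _ _ _ (by omega)] at h1
    simp only [ψ] at h1
    rw [if_pos (fun m _ => h m _)] at h1
    omega
  · intro h m k hk
    by_contra hne
    obtain ⟨v, hv⟩ := Option.ne_none_iff_exists'.1 hk
    have hvm := (hu g (charFun A) (Nat.pair n m)).1 _ _ hv
    obtain ⟨K, hK⟩ := (hu g (charFun A) (Nat.pair n m)).2
    rw [hvm, ← hv] at hK
    have h1 : 1 ∈ Code.eval c (Encodable.encode (n, (rs g (K+m+1), rs (charFun A) (K+m+1)))) := by
      rw [hc']
      simp only [ψ]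
      rw [if_neg]
      intro h
      have := h m (by simp)
      rw [hK _ (by omega)] at this
      exact hne (this hk)
    obtain ⟨s, hs⟩ := Code.evaln_complete.1 h1
    refine h (K + m + 1 + s) s (by rw [rs_len]; omega) ?_
    rw [Denumerable.ofNat_encode, rs_drop _ _ _ (by omega), rs_drop _ _ _ (by omega), rs_len, show K + m + 1 + s - s = K + m + 1 by omega]
    exact Code.evaln_mono (by omega) hs
def RT (O : ℕ → ℕ) (f : ℕ → ℕ) : Prop := RecursiveIn O (f : ℕ →. ℕ)
theorem RT.prim {O f} (h : Primrec f) : RT O f := part_rec (Partrec.nat_iff.1 h.to_comp)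
theorem RT.orc {O} : RT O O := RecursiveIn.oracle
theorem RT.comp {O f g} (h : RT O f) (h' : RT O g) : RT O fun n => f (g n) := by
  have := RecursiveIn.comp h h'
  refine (congrArg (RecursiveIn O) ?_).mpr this
  funext n; exact (Part.bind_some (g n) (f : ℕ →. ℕ)).symm
theorem RT.pair {O f g} (h : RT O f) (h' : RT O g) : RT O fun n => Nat.pair (f n) (g n) := by
  have := RecursiveIn.pair h h'
  refine (congrArg (RecursiveIn O) ?_).mpr this
  funext n; simp [Seq.seq]
theorem RT.prim2 {O f g} {h : ℕ → ℕ → ℕ} (hh : Primrec₂ h) (h1 : RT O f) (h2 : RT O g) : RT O fun n => h (f n) (g n) := by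
  have h3 : Primrec fun n : ℕ => h n.unpair.1 n.unpair.2 := hh.comp prim_fst prim_snd
  have := RT.comp (RT.prim (O := O) h3) (h1.pair h2)
  simpa using this
theorem RT.prec {O f g} (h : RT O f) (h' : RT O g) :
    RT O fun n => Nat.rec (f n.unpair.1) (fun y ih => g (Nat.pair n.unpair.1 (Nat.pair y ih))) n.unpair.2 := by
  have := RecursiveIn.prec h h'
  refine (congrArg (RecursiveIn O) ?_).mpr this
  funext n
  simp only [Nat.unpaired, PFun.coe_val]
  generalize n.unpair.2 = k
  induction k with
  | zero => rfl
  | succ k ih => simp only [← ih]; simp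

theorem rs_rec (O) : RT O fun k => Encodable.encode (rs O k) := by
  have h := RT.prec (O := O) (f := fun _ => 0) (g := fun p => Nat.succ (Nat.pair (O p.unpair.2.unpair.1) p.unpair.2.unpair.2)) (RT.prim (Primrec.const 0))
    (RT.comp (RT.prim Primrec.succ) (RT.pair (RT.comp RT.orc (RT.prim (prim_fst.comp prim_snd))) (RT.prim (prim_snd.comp prim_snd))))
  have h2 := h.comp (RT.pair (RT.prim (Primrec.const 0)) (RT.prim Primrec.id))
  convert h2 using 2 with k
  simp only [Nat.unpair_pair, id]
  induction k with
  | zero => rfl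
  | succ k ih =>
    simp only [rs, Encodable.encode_list_cons, ih, Nat.unpair_pair, Encodable.encode_nat]

def nd (u : ℕ) : ℕ × ℕ × List ℕ := Denumerable.ofNat _ u
def root (e n : ℕ) : ℕ := Encodable.encode (e, n, ([] : List ℕ))
theorem nd_enc (p : ℕ × ℕ × List ℕ) : nd (Encodable.encode p) = p := Denumerable.ofNat_encode p
theorem root_prim : Primrec₂ root := Primrec.encode.comp (Primrec.pair Primrec.fst (Primrec.pair Primrec.snd (Primrec.const [])))
theorem nd_prim : Primrec nd := Primrec.ofNat _

def edge (t m u : ℕ) : Prop :=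
  ((nd m).1 = (nd u).1 ∧ (nd m).2.1 = (nd u).2.1) ∧ ((nd m).2.2 ≠ [] ∧ (nd m).2.2.tail = (nd u).2.2) ∧
   (Denumerable.ofNat (List ℕ) t).length = (nd m).2.2.length ∧ good (nd m).1 (nd m).2.1 (Denumerable.ofNat (List ℕ) t) (nd m).2.2

theorem edge_prim : PrimrecPred fun p : ℕ × ℕ × ℕ => edge p.1 p.2.1 p.2.2 := by
  have m := nd_prim.comp (Primrec.fst.comp (Primrec.snd (α := ℕ) (β := ℕ × ℕ)))
  have u := nd_prim.comp (Primrec.snd.comp (Primrec.snd (α := ℕ) (β := ℕ × ℕ)))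
  have t := (Primrec.ofNat (List ℕ)).comp (Primrec.fst (α := ℕ) (β := ℕ × ℕ))
  have s := Primrec.snd.comp (Primrec.snd.comp m)
  refine .and (.and (Primrec.eq.comp (Primrec.fst.comp m) (Primrec.fst.comp u)) (Primrec.eq.comp (Primrec.fst.comp (Primrec.snd.comp m)) (Primrec.fst.comp (Primrec.snd.comp u)))) (.and (.and (.not (Primrec.eq.comp s (Primrec.const []))) ?_) (.and ?_ ?_))
  · exact Primrec.eq.comp (Primrec.list_tail.comp s) (Primrec.snd.comp (Primrec.snd.comp u))
  · exact Primrec.eq.comp (Primrec.list_length.comp t) (Primrec.list_length.comp s)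
  · exact good_prim.comp (Primrec.pair (Primrec.pair (Primrec.fst.comp m) (Primrec.fst.comp (Primrec.snd.comp m))) (Primrec.pair t s))

attribute [irreducible] edge

instance edge_df {K} [ArLike K] {t m u} [ht : AF K t] [hm : AF K m] [hu : AF K u] : Df K fun F e => edge (t F e) (m F e) (u F e) := by
  have h : PrimrecRel fun a b : ℕ => edge a b.unpair.1 b.unpair.2 :=
    edge_prim.comp (Primrec.pair Primrec.fst (Primrec.pair (prim_fst.comp Primrec.snd) (prim_snd.comp Primrec.snd)))
  exact (Df.prim2 h ht (inferInstance : AF K fun F e => Nat.pair (m F e) (u F e))).congr fun F e => by simp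

def tr (A : Set ℕ) (m u : ℕ) : Prop := edge (Encodable.encode (rs (charFun A) (nd m).2.2.length)) m u

theorem tr_iff (A : Set ℕ) (e n σ e' n' σ') : tr A (Encodable.encode (e, n, σ)) (Encodable.encode (e', n', σ')) ↔
    e = e' ∧ n = n' ∧ σ ≠ [] ∧ σ.tail = σ' ∧ good e n (rs (charFun A) σ.length) σ := by
  simp only [tr, edge, nd_enc, Denumerable.ofNat_encode, rs_len]
  tauto

theorem tr_rec (A) : RT (charFun A) fun n => if tr A n.unpair.1 n.unpair.2 then 1 else 0 := by
  have h : Primrec₂ fun t n : ℕ => if edge t n.unpair.1 n.unpair.2 then 1 else 0 := Primrec.ite 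
    (edge_prim.comp (Primrec.pair Primrec.fst (Primrec.pair (prim_fst.comp Primrec.snd) (prim_snd.comp Primrec.snd)))) (Primrec.const 1) (Primrec.const 0)
  refine RT.prim2 h ((rs_rec _).comp (g := fun n => (nd n.unpair.1).2.2.length) (RT.prim ?_)) (RT.prim Primrec.id)
  exact Primrec.list_length.comp (Primrec.snd.comp (Primrec.snd.comp (nd_prim.comp prim_fst)))

theorem tr_rel (A) : RelRecursiveIn A (tr A) := by
  have := tr_rec A
  unfold RelRecursiveIn
  refine (congrArg (RecursiveIn (charFun A)) ?_).mpr this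
  funext n
  simp only [PFun.coe_val]
  split_ifs <;> rfl

instance tr_df {A : Set ℕ} {m u} [hm : AF (Dl A) m] [hu : AF (Dl A) u] : Df (Dl A) fun F e => tr A (m F e) (u F e) :=
  Df.sub2 (P := fun _ => tr A) (relRec_dl (tr_rel A)) hm hu

theorem F1 {A X : Set ℕ} (h : Df (Sg A) fun _ e => e 0 ∈ X) : ∃ c, ∀ n, n ∈ X ↔ ¬ Acc (tr A) (root c n) := by
  obtain ⟨c, hc⟩ := F1aux h
  refine ⟨c, fun n => ?_⟩
  rw [hc, not_acc_iff_exists_descending_chain]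
  constructor
  · rintro ⟨g, hg⟩
    refine ⟨fun k => Encodable.encode (c, n, rs g k), rfl, fun k => ?_⟩
    rw [tr_iff]
    refine ⟨rfl, rfl, by simp [rs], rfl, ?_⟩
    rw [rs_len]; exact hg _
  · rintro ⟨f, h0, hf⟩
    have key : ∀ k, ∃ σ : List ℕ, f k = Encodable.encode (c, n, σ) ∧ σ.length = k := by
      intro k
      induction k with
      | zero => exact ⟨[], h0, rfl⟩
      | succ k ih =>
        obtain ⟨σ, h1, h2⟩ := ih
        obtain ⟨⟨e, m, τ⟩, h3⟩ : ∃ p : ℕ × ℕ × List ℕ, f (k+1) = Encodable.encode p := ⟨nd (f (k+1)), (Denumerable.encode_ofNat _).symm⟩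
        have := hf k
        rw [h1, h3, tr_iff] at this
        obtain ⟨rfl, rfl, h4, h5, _⟩ := this
        refine ⟨τ, h3, ?_⟩
        rw [← h2, ← h5]
        cases τ <;> simp at h4 ⊢
    choose σ h1 h2 using key
    have h3 : ∀ k, σ (k+1) = (σ (k+1)).headD 0 :: σ k ∧ good c n (rs (charFun A) (k+1)) (σ (k+1)) := by
      intro k
      have := hf k
      rw [h1, h1, tr_iff, h2] at this
      obtain ⟨_, _, h4, h5, h6⟩ := this
      refine ⟨?_, h6⟩
      rw [← h5]
      generalize σ (k+1) = l at *
      cases l <;> simp at h4 ⊢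
    refine ⟨fun k => (σ (k+1)).headD 0, fun k => ?_⟩
    have h4 : rs (fun k => (σ (k+1)).headD 0) k = σ k := by
      induction k with
      | zero => exact (List.length_eq_zero_iff.1 (h2 0)).symm
      | succ k ih => rw [rs, ih, ← (h3 k).1]
    rw [h4]
    cases k with
    | zero =>
      rw [List.length_eq_zero_iff.1 (h2 0)]
      intro j _
      simp [Nat.Partrec.Code.evaln]
    | succ k => exact (h3 k).2

theorem nacc_sg {A : Set ℕ} {E : ℕ → ℕ → Prop} (h : Df (Sg A) fun _ e => E (e 0) (e 1)) : Df (Sg A) fun _ e => ¬ Acc E (e 0) := by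
  have h1 {t s} [ht : AF (Dl A) t] [hs : AF (Dl A) s] : Df (Sg A) fun F e => E (t F e) (s F e) := Df.ssub2 (P := fun _ => E) h ht hs
  refine (inferInstance : Df (Sg A) fun _ e => ∃ f : ℕ → ℕ, f 0 = e 0 ∧ ∀ n, E (f (n+1)) (f n)).scongr fun F e => ?_
  exact not_acc_iff_exists_descending_chain

def WF (A : Set ℕ) : Set ℕ := {u | Acc (tr A) u}
theorem F2 (A : Set ℕ) : Df (Sg A) fun _ e => ¬ e 0 ∈ WF A := nacc_sg (inferInstance : Df (Dl A) fun _ e => tr A (e 0) (e 1)).sg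
theorem F3 (A : Set ℕ) : ¬ Df (Sg A) fun _ e => e 0 ∈ WF A := by
  intro h
  have h2 : Df (Sg A) fun F e => e 0 ∈ {n | root n n ∈ WF A} :=
    Df.ssub1 (P := fun _ n => n ∈ WF A) h (AF.prim (f := fun n => root n n) (root_prim.comp Primrec.id Primrec.id) (AF.var 0))
  obtain ⟨c, hc⟩ := F1 h2
  have := hc c
  simp only [Set.mem_setOf_eq, WF] at this
  tauto

noncomputable def rk {α : Type} (R : α → α → Prop) (x : α) : Ordinal.{0} := if h : Acc R x then h.rank else 0
section
variable {α β : Type} {R : α → α → Prop} {E : β → β → Prop}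
theorem rk_acc {x} (h : Acc R x) : rk R x = h.rank := dif_pos h
theorem rk_lt {x y} (h : Acc R y) (h' : R x y) : rk R x < rk R y := by
  rw [rk_acc h, rk_acc (h.inv h')]; exact h.rank_lt_of_rel h'
theorem rk_le {y o} (h : Acc R y) : rk R y ≤ o ↔ ∀ x, R x y → rk R x < o := by
  rw [rk_acc h, h.rank_eq, Ordinal.iSup_le_iff]
  constructor
  · intro h1 x hx
    have := h1 ⟨x, hx⟩
    rw [rk_acc (h.inv hx)]
    exact Order.succ_le_iff.1 this
  · rintro h1 ⟨x, hx⟩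
    have := h1 x hx
    rw [rk_acc (h.inv hx)] at this
    exact Order.succ_le_iff.2 this
theorem lt_rk {y o} (h : Acc R y) : o < rk R y ↔ ∃ x, R x y ∧ o ≤ rk R x := by
  have := rk_le (o := o) h
  rw [← not_le, this]; push Not; rfl
theorem rk_mem {y o} (h : Acc R y) (ho : o ≤ rk R y) : ∃ x, Acc R x ∧ rk R x = o := by
  rw [rk_acc h] at ho
  obtain ⟨x, hx, h2⟩ := h.mem_range_rank_of_le ho
  exact ⟨x, hx, by rw [rk_acc hx]; exact h2⟩

def IsSim (R : α → α → Prop) (E : β → β → Prop) (S : α → β → Prop) : Prop := ∀ a b, S a b → ∀ a', R a' a → ∃ b', E b' b ∧ S a' b'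
def Sim (R : α → α → Prop) (E : β → β → Prop) (x : α) (y : β) : Prop := ∃ S, IsSim R E S ∧ S x y
theorem sim_iff {x y} (hy : Acc E y) : Sim R E x y ↔ Acc R x ∧ rk R x ≤ rk E y := by
  constructor
  · rintro ⟨S, hS, h⟩
    induction hy generalizing x with
    | intro y hy ih =>
      have h1 : Acc R x := ⟨_, fun a ha => by
        obtain ⟨b, hb, hs⟩ := hS x y h a ha
        exact (ih b hb hs).1⟩
      refine ⟨h1, (rk_le h1).2 fun a ha => ?_⟩
      obtain ⟨b, hb, hs⟩ := hS x y h a ha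
      exact (ih b hb hs).2.trans_lt (rk_lt ⟨_, hy⟩ hb)
  · rintro ⟨h1, h2⟩
    refine ⟨fun a b => Acc R a ∧ Acc E b ∧ rk R a ≤ rk E b, ?_, h1, hy, h2⟩
    rintro a b ⟨h1, h2, h3⟩ a' ha
    obtain ⟨b', hb, h4⟩ := (lt_rk h2).1 ((rk_lt h1 ha).trans_le h3)
    exact ⟨b', hb, h1.inv ha, h2.inv hb, h4⟩
end

theorem sim_sg {A : Set ℕ} {R E : ℕ → ℕ → Prop} (hR : Df (Dl A) fun _ e => R (e 0) (e 1)) (hE : Df (Sg A) fun _ e => E (e 0) (e 1)) :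
    Df (Sg A) fun _ e => Sim R E (e 0) (e 1) := by
  have h1 {t s} [ht : AF (Dl A) t] [hs : AF (Dl A) s] : Df (Sg A) fun F e => E (t F e) (s F e) := Df.ssub2 (P := fun _ => E) hE ht hs
  have h2 {t s} [ht : AF (Dl A) t] [hs : AF (Dl A) s] : Df (Dl A) fun F e => R (t F e) (s F e) := Df.sub2 (P := fun _ => R) hR ht hs
  refine (inferInstance : Df (Sg A) fun _ e => ∃ f : ℕ → ℕ, f (Nat.pair (e 0) (e 1)) = 0 ∧
    ∀ a b, f (Nat.pair a b) = 0 → ∀ a', R a' a → ∃ b', E b' b ∧ f (Nat.pair a' b') = 0).scongr fun F e => ?_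
  constructor
  · rintro ⟨S, hS, h⟩
    refine ⟨fun n => if S n.unpair.1 n.unpair.2 then 0 else 1, by simpa using h, ?_⟩
    intro a b hab a' ha
    obtain ⟨b', h1, h2⟩ := hS a b (by simpa using hab) a' ha
    exact ⟨b', h1, by simpa using h2⟩
  · rintro ⟨f, h, hf⟩
    exact ⟨fun a b => f (Nat.pair a b) = 0, hf, h⟩

noncomputable def w1 (A : Set ℕ) : Ordinal.{0} := ⨆ u : {u // Acc (tr A) u}, Order.succ (rk (tr A) u)
theorem lt_w1' {A o} : o < w1 A ↔ ∃ u, Acc (tr A) u ∧ o ≤ rk (tr A) u := by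
  rw [w1, Ordinal.lt_iSup_iff]
  simp [Order.lt_succ_iff]
theorem lt_w1 {A o} : o < w1 A ↔ ∃ u, Acc (tr A) u ∧ rk (tr A) u = o := by
  rw [lt_w1']
  constructor
  · rintro ⟨u, h, h1⟩
    exact rk_mem h h1
  · rintro ⟨u, h, rfl⟩; exact ⟨u, h, le_rfl⟩
theorem rk_lt_w1 {A u} (h : Acc (tr A) u) : rk (tr A) u < w1 A := lt_w1.2 ⟨u, h, rfl⟩

theorem F5 {A : Set ℕ} {E : ℕ → ℕ → Prop} (hE : Df (Sg A) fun _ e => E (e 0) (e 1)) {y} (hy : Acc E y) : rk E y < w1 A := by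
  by_contra hlt
  rw [not_lt] at hlt
  apply F3 A
  have h1 : Df (Sg A) fun _ e => Sim (tr A) E (e 0) y :=
    Df.ssub2 (P := fun _ => Sim (tr A) E) (sim_sg inferInstance hE) (AF.var 0) (AF.const y)
  refine h1.scongr fun F e => ?_
  rw [sim_iff hy]
  exact ⟨fun h => ⟨h, (rk_lt_w1 h).le.trans hlt⟩, fun h => h.1⟩

theorem Df.strans {A B : Set ℕ} (hB : Df (Dl A) fun _ e => e 0 ∈ B) {P} (h : Df (Sg B) P) : Df (Sg A) P := by
  obtain ⟨Q, hQ, h⟩ := h.h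
  have := hB
  have h2 : Df (Sg A) fun F e => ∃ g, Q (push g (push (charFun B) F)) e := by
    have : AF (Dl A) fun F e => charFun B (e 0) := (inferInstance : AF (Dl A) fun F e => if e 0 ∈ B then 1 else 0)
    have h3 : Df (Sg A) fun F e => ∃ g, Q (push g (push (F 0) fun i => F (i+1))) e := ⟨Sg.exf (P := fun F e g => Q (push g (push (F 0) fun i => F (i+1))) e) (by
      have h4 := (Df.ar (K := Dl A) hQ).sg.h
      refine h4.congr fun F e => iff_of_eq (congrArg₂ Q ?_ rfl)
      funext i; rcases i with _ | _ | i <;> rfl)⟩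
    exact Df.sfsub (P := fun F e f => ∃ g, Q (push g (push f F)) e) (g := fun _ _ => charFun B) h3 this
  exact h2.scongr h
theorem Df.trans {A B : Set ℕ} (hB : Df (Dl A) fun _ e => e 0 ∈ B) {P} (h : Df (Dl B) P) : Df (Dl A) P :=
  Df.mkDl (Df.strans hB h.sg) (Df.strans hB h.nsg)

theorem mor_dl {A J C : Set ℕ} (hJ : Df (Dl A) fun _ e => e 0 ∈ J) (h : ManyOneReducible (· ∈ C) (· ∈ J)) : Df (Dl A) fun _ e => e 0 ∈ C := by
  obtain ⟨f, hf, h⟩ := h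
  exact (Df.sub1 (P := fun _ n => n ∈ J) hJ (AF.comp hf (AF.var 0))).congr fun F e => h _

theorem F7a {A B : Set ℕ} (h : SpectorRel B A) : w1 B < w1 A := by
  obtain ⟨J, ⟨hJ1, hJ2⟩, hJ⟩ := h
  rw [hyp_iff] at hJ
  have hB : Df (Dl A) fun _ e => e 0 ∈ B := mor_dl hJ (hJ2 B ((sigma_iff _ _).2 (inferInstance : Df (Dl B) fun _ e => e 0 ∈ B).nsg))
  have hW : Df (Dl A) fun _ e => e 0 ∈ WF B := mor_dl hJ (hJ2 _ ((sigma_iff _ _).2 (F2 B)))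
  have hT : Df (Dl A) fun _ e => tr B (e 0) (e 1) := Df.trans hB inferInstance
  have h1 {t s} [ht : AF (Dl A) t] [hs : AF (Dl A) s] : Df (Dl A) fun F e => tr B (t F e) (s F e) := Df.sub2 (P := fun _ => tr B) hT ht hs
  have h2 {t} [ht : AF (Dl A) t] : Df (Dl A) fun F e => t F e ∈ WF B := Df.sub1 (P := fun _ n => n ∈ WF B) hW ht
  let E : ℕ → ℕ → Prop := fun x y => (y = 0 ∧ ∃ u, x = u+1 ∧ u ∈ WF B) ∨ ∃ u v, x = u+1 ∧ y = v+1 ∧ v ∈ WF B ∧ tr B u v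
  have hE : Df (Sg A) fun _ e => E (e 0) (e 1) := (inferInstance : Df (Sg A) fun _ e => (e 1 = 0 ∧ ∃ u, e 0 = u+1 ∧ u ∈ WF B) ∨ ∃ u v, e 0 = u+1 ∧ e 1 = v+1 ∧ v ∈ WF B ∧ tr B u v)
  have h3 : ∀ u, u ∈ WF B → Acc E (u+1) ∧ rk E (u+1) = rk (tr B) u := by
    intro u hu
    induction hu with
    | intro u hu ih =>
      have a1 : ∀ x, E x (u+1) ↔ ∃ v, x = v+1 ∧ tr B v u := by
        intro x
        constructor
        · rintro (⟨h, _⟩ | ⟨v, w, rfl, h, _, h'⟩)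
          · omega
          · obtain rfl : u = w := by omega
            exact ⟨v, rfl, h'⟩
        · rintro ⟨v, rfl, h⟩
          exact Or.inr ⟨v, u, rfl, rfl, ⟨_, hu⟩, h⟩
      have h4 : Acc E (u+1) := ⟨_, fun x hx => by obtain ⟨v, rfl, hv⟩ := (a1 x).1 hx; exact (ih v hv).1⟩
      refine ⟨h4, le_antisymm ((rk_le h4).2 fun x hx => ?_) ((rk_le ⟨_, hu⟩).2 fun v hv => ?_)⟩
      · obtain ⟨v, rfl, hv⟩ := (a1 x).1 hx
        rw [(ih v hv).2]; exact rk_lt ⟨_, hu⟩ hv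
      · rw [← (ih v hv).2]; exact rk_lt h4 ((a1 _).2 ⟨v, rfl, hv⟩)
  have a2 : ∀ u, u ∈ WF B → E (u+1) 0 := fun u hu => Or.inl ⟨rfl, u, rfl, hu⟩
  have h4 : Acc E 0 := ⟨_, fun x hx => by
    rcases hx with ⟨_, u, rfl, hu⟩ | ⟨v, w, rfl, h, _, h'⟩
    · exact (h3 u hu).1
    · omega⟩
  refine lt_of_le_of_lt ?_ (F5 hE h4)
  rw [w1, Ordinal.iSup_le_iff]
  rintro ⟨u, hu⟩
  rw [Order.succ_le_iff]
  simp only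
  rw [← (h3 u hu).2]
  exact rk_lt h4 (a2 u hu)

theorem F7b {A B : Set ℕ} (hB : Df (Dl A) fun _ e => e 0 ∈ B) (h : w1 B < w1 A) : SpectorRel B A := by
  obtain ⟨w, hw, hw2⟩ := lt_w1.1 h
  have hT : Df (Dl A) fun _ e => tr B (e 0) (e 1) := Df.trans hB inferInstance
  refine ⟨WF B, ⟨(sigma_iff _ _).2 (F2 B), fun C hC => ?_⟩, (hyp_iff _ _).2 (Df.mkDl ?_ (Df.strans hB (F2 B)))⟩
  · obtain ⟨c, hc⟩ := F1 ((sigma_iff _ _).1 hC)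
    refine ⟨fun n => root c n, (root_prim.comp (Primrec.const c) Primrec.id).to_comp, fun n => ?_⟩
    have := hc n
    simp only [Set.mem_compl_iff] at this
    exact not_iff_not.1 this
  · refine (Df.ssub2 (P := fun _ => Sim (tr B) (tr A)) (sim_sg hT inferInstance) (AF.var 0) (AF.const w)).scongr fun F e => ?_
    rw [sim_iff hw, hw2]
    exact ⟨fun h => ⟨h, (rk_lt_w1 h).le⟩, fun h => h.1⟩
def sPart (r : ℕ → ℕ → Prop) (a b : {n // r n n}) : Prop := r a.val b.val ∧ ¬ r b.val a.val

theorem rk_typein {α : Type} (s : α → α → Prop) [IsWellOrder α s] (a : α) : rk s a = Ordinal.typein s a := by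
  rw [← IsWellFounded.rank_eq_typein, rk_acc (IsWellFounded.apply s a)]
  rfl

theorem pres_rk {E : ℕ → ℕ → Prop} (htr : ∀ a b c, E a b → E b c → E a c) {p} (hp : Acc E p)
    (htri : ∀ a b, E a p → E b p → E a b ∨ a = b ∨ E b a) :
    IsPresentation (fun m n => E m p ∧ E n p ∧ (E m n ∨ m = n)) (rk E p) := by
  set r : ℕ → ℕ → Prop := fun m n => E m p ∧ E n p ∧ (E m n ∨ m = n) with hr
  have hac : ∀ a, E a p → Acc E a := fun a h => hp.inv h
  have hirr : ∀ a b, E a p → E a b → ¬ E b a := fun a b h h1 h2 => by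
    have := rk_lt (hac a h) (htr _ _ _ h1 h2)
    exact lt_irrefl _ this
  have hs : ∀ a b : {n // r n n}, sPart r a b ↔ E a.1 b.1 := by
    rintro ⟨a, ha, _⟩ ⟨b, hb, _⟩
    constructor
    · rintro ⟨⟨_, _, h | h⟩, h'⟩
      · exact h
      · exact absurd ⟨hb, ha, Or.inr h.symm⟩ h'
    · intro h
      refine ⟨⟨ha, hb, Or.inl h⟩, fun ⟨_, _, h'⟩ => ?_⟩
      simp only at h h'
      rcases h' with h' | h'
      · exact hirr _ _ ha h h'
      · subst h'; exact hirr _ _ ha h h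
  have hsim1 : IsSim (sPart r) E fun a b => b = a.1 := by
    rintro a b rfl a' h
    exact ⟨_, (hs _ _).1 h, rfl⟩
  have hsim2 : IsSim E (sPart r) fun b a => b = a.1 := by
    rintro b a rfl b' h
    have := htr _ _ _ h a.2.1
    exact ⟨⟨b', this, this, Or.inr rfl⟩, (hs _ _).2 h, rfl⟩
  have hacc : ∀ a : {n // r n n}, Acc (sPart r) a := fun a => ((sim_iff (hac a.1 a.2.1)).1 ⟨_, hsim1, rfl⟩).1
  have hrk : ∀ a : {n // r n n}, rk (sPart r) a = rk E a.1 := fun a =>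
    le_antisymm ((sim_iff (hac a.1 a.2.1)).1 ⟨_, hsim1, rfl⟩).2 ((sim_iff (hacc a)).1 ⟨_, hsim2, rfl⟩).2
  have hwo : IsWellOrder {n // r n n} (sPart r) :=
    { wf := ⟨hacc⟩
      trichotomous := by
        intro a b h1 h2
        rw [hs] at h1 h2
        have := htri a.1 b.1 a.2.1 b.2.1
        apply Subtype.ext
        tauto }
  refine ⟨hwo, ?_⟩
  change @Ordinal.type _ (sPart r) hwo = _
  apply le_antisymm
  · by_contra h
    rw [not_le] at h
    obtain ⟨a, ha⟩ := Ordinal.typein_surj (sPart r) h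
    rw [← rk_typein, hrk] at ha
    exact (rk_lt hp a.2.1).ne ha
  · rw [rk_le hp]
    intro x hx
    have := Ordinal.typein_lt_type (sPart r) (⟨x, hx, hx, Or.inr rfl⟩ : {n // r n n})
    rwa [← rk_typein, hrk] at this

theorem pres_lt {A : Set ℕ} {r : ℕ → ℕ → Prop} (h : RelRecursiveIn A r) {o} (ho : IsPresentation r o) : o < w1 A := by
  have hr := relRec_dl h
  have h1 {t s} [ht : AF (Dl A) t] [hs : AF (Dl A) s] : Df (Dl A) fun F e => r (t F e) (s F e) := Df.sub2 (P := fun _ => r) hr ht hs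
  obtain ⟨hwo, rfl⟩ := ho
  change IsWellOrder {n // r n n} (sPart r) at hwo
  change @Ordinal.type _ (sPart r) hwo < _
  let E : ℕ → ℕ → Prop := fun x y => (y = 0 ∧ ∃ u, x = u+1 ∧ r u u) ∨ ∃ u v, x = u+1 ∧ y = v+1 ∧ r u u ∧ r v v ∧ r u v ∧ ¬ r v u
  have hE : Df (Sg A) fun _ e => E (e 0) (e 1) := (inferInstance : Df (Sg A) fun _ e => (e 1 = 0 ∧ ∃ u, e 0 = u+1 ∧ r u u) ∨ ∃ u v, e 0 = u+1 ∧ e 1 = v+1 ∧ r u u ∧ r v v ∧ r u v ∧ ¬ r v u)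
  have hsim1 : IsSim (sPart r) E fun a b => b = a.1+1 := by
    rintro a b rfl a' h
    exact ⟨a'.1+1, Or.inr ⟨a'.1, a.1, rfl, rfl, a'.2, a.2, h⟩, rfl⟩
  have hsim2 : IsSim E (sPart r) fun b a => b = a.1+1 := by
    rintro b a rfl b' (⟨h, _⟩ | ⟨u, v, rfl, hv, hu, _, h2⟩)
    · omega
    · obtain rfl : a.1 = v := by omega
      exact ⟨⟨u, hu⟩, h2, rfl⟩
  have hac : ∀ a : {n // r n n}, Acc (sPart r) a := fun a => hwo.wf.apply a
  have hac2 : ∀ a : {n // r n n}, Acc E (a.1+1) := fun a => ((sim_iff (hac a)).1 ⟨_, hsim2, rfl⟩).1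
  have h0 : Acc E 0 := by
    refine ⟨_, ?_⟩
    rintro x (⟨_, u, rfl, hu⟩ | ⟨u, v, rfl, hv, _⟩)
    · exact hac2 ⟨u, hu⟩
    · omega
  refine lt_of_le_of_lt ?_ (F5 hE h0)
  by_contra h
  rw [not_le] at h
  obtain ⟨a, ha⟩ := Ordinal.typein_surj (sPart r) h
  rw [← rk_typein] at ha
  have h2 := ((sim_iff (hac2 a)).1 ⟨_, hsim1, rfl⟩).2
  have h3 : E (a.1+1) 0 := Or.inl ⟨rfl, _, rfl, a.2⟩
  exact ((rk_lt h0 h3).trans_le' h2).ne ha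

/-- Kleene-Brouwer -/
def kb : List ℕ → List ℕ → Prop
  | [], _ => False
  | _ :: _, [] => True
  | a :: l, b :: m => a < b ∨ (a = b ∧ kb l m)
theorem kb_trans : ∀ a b c, kb a b → kb b c → kb a c
  | [], _, _ => fun h _ => h.elim
  | _ :: _, [], _ => fun _ h => by simp [kb] at h
  | _ :: _, _ :: _, [] => fun _ _ => trivial
  | a :: l, b :: m, c :: n => by
    have := kb_trans l m n
    simp only [kb]
    rintro (h1 | ⟨rfl, h1⟩) (h2 | ⟨rfl, h2⟩)
    · left; omega
    · left; omega
    · left; omega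
    · right; exact ⟨rfl, this h1 h2⟩
theorem kb_tri : ∀ a b, kb a b ∨ a = b ∨ kb b a
  | [], [] => by simp
  | [], _ :: _ => by simp [kb]
  | _ :: _, [] => by simp [kb]
  | a :: l, b :: m => by
    have := kb_tri l m
    rcases lt_trichotomy a b with h | rfl | h
    · simp [kb, h]
    · simp [kb, this]
    · simp [kb, h]
theorem kb_app (a b c) : kb (a ++ b) (a ++ c) ↔ kb b c := by
  induction a with
  | nil => rfl
  | cons x a ih => simp [kb, ih]
theorem kb_iff : ∀ a b : List ℕ, kb a b ↔ ∃ i < a.length, a.take i = b.take i ∧ (b.length = i ∨ (i < b.length ∧ a.getD i 0 < b.getD i 0))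
  | [], _ => by simp [kb]
  | x :: a, [] => by
    simp only [kb, true_iff]
    exact ⟨0, by simp, by simp⟩
  | x :: a, y :: b => by
    have ih := kb_iff a b
    simp only [kb, ih]
    constructor
    · rintro (h | ⟨rfl, i, h1, h2, h3⟩)
      · exact ⟨0, by simp, by simp [h]⟩
      · exact ⟨i+1, by simpa using h1, by simp [h2], by simpa using h3⟩
    · rintro ⟨i, h1, h2, h3⟩
      cases i with
      | zero => left; simpa using h3
      | succ i =>
        simp only [List.take_succ_cons, List.cons.injEq] at h2
        exact Or.inr ⟨h2.1, i, by simpa using h1, h2.2, by simpa using h3⟩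

theorem kb_prim : PrimrecRel kb := by
  have h1 : PrimrecRel fun (i : ℕ) (p : List ℕ × List ℕ) => p.1.take i = p.2.take i ∧ (p.2.length = i ∨ (i < p.2.length ∧ p.1.getD i 0 < p.2.getD i 0)) := by
    have a := Primrec.fst.comp (Primrec.snd (α := ℕ) (β := List ℕ × List ℕ))
    have b := Primrec.snd.comp (Primrec.snd (α := ℕ) (β := List ℕ × List ℕ))
    have i := Primrec.fst (α := ℕ) (β := List ℕ × List ℕ)
    refine .and (Primrec.eq.comp (Primrec.list_take.comp i a) (Primrec.list_take.comp i b)) (.or (Primrec.eq.comp (Primrec.list_length.comp b) i) (.and (Primrec.nat_lt.comp i (Primrec.list_length.comp b)) 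
      (Primrec.nat_lt.comp ((Primrec.list_getD 0).comp a i) ((Primrec.list_getD 0).comp b i))))
  have := h1.exists_mem_list.comp (f := fun p : List ℕ × List ℕ => List.range p.1.length) (g := fun p => p)
    (Primrec.list_range.comp (Primrec.list_length.comp Primrec.fst)) Primrec.id
  exact this.of_eq fun p => by simp [kb_iff]

theorem kb_wf (T : List ℕ → Prop) (hT : ∀ l x, T (l ++ [x]) → T l) {a}
    (ha : Acc (fun b a => T b ∧ ∃ x, b = a ++ [x]) a) : ∀ v, Acc (fun b c => (T b ∧ a <+: b) ∧ (T c ∧ a <+: c) ∧ kb b c) v := by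
  have hT' : ∀ l m, T (l ++ m) → T l := by
    intro l m
    induction m using List.reverseRecOn with
    | nil => simp
    | append_singleton m x ih => 
      intro h
      rw [← List.append_assoc] at h
      exact ih (hT _ _ h)
  induction ha with
  | intro a _ ih =>
  have key : ∀ x v, T v → a ++ [x] <+: v → Acc (fun b c => (T b ∧ a <+: b) ∧ (T c ∧ a <+: c) ∧ kb b c) v := by
    intro x
    induction x using Nat.strong_induction_on with
    | _ x ihx =>
    intro v hv hav
    have hTx : T (a ++ [x]) := by
      obtain ⟨m, rfl⟩ := hav
      exact hT' _ _ hv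
    have := ih _ ⟨hTx, x, rfl⟩ v
    induction this with
    | intro v _ ihv =>
    refine ⟨_, ?_⟩
    rintro w ⟨⟨hw, haw⟩, _, hk⟩
    obtain ⟨m, rfl⟩ := haw
    obtain ⟨n, rfl⟩ := hav
    rw [List.append_assoc, kb_app] at hk
    cases m with
    | nil => exact hk.elim
    | cons y m =>
      have hp : a ++ [y] <+: a ++ y :: m := ⟨m, by simp⟩
      rcases hk with h | ⟨h, hk⟩
      · exact ihx y h _ hw hp
      · subst h
        refine ihv _ ⟨⟨hw, hp⟩, ⟨hv, by simp⟩, ?_⟩ hw hp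
        simp only [List.append_assoc, kb_app]
        exact Or.inr ⟨rfl, hk⟩
  intro v
  refine ⟨_, ?_⟩
  rintro w ⟨⟨hw, haw⟩, ⟨hv, hav⟩, hk⟩
  obtain ⟨m, rfl⟩ := haw
  obtain ⟨n, rfl⟩ := hav
  rw [kb_app] at hk
  cases m with
  | nil => exact hk.elim
  | cons y m => exact key y _ hw ⟨m, by simp⟩

def RD (A : Set ℕ) (P : ℕ → Prop) : Prop := RT (charFun A) fun n => if P n then 1 else 0
theorem RD.prim {A P} (h : PrimrecPred P) : RD A P := RT.prim (Primrec.ite h (Primrec.const 1) (Primrec.const 0))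
theorem RD.congr {A P Q} (h : RD A P) (h' : ∀ n, Q n ↔ P n) : RD A Q := by
  have : Q = P := funext fun n => propext (h' n)
  rw [this]; exact h
theorem RD.comp {A P f} (h : RD A P) (hf : RT (charFun A) f) : RD A fun n => P (f n) := RT.comp h hf
theorem RD.and {A P Q} (h : RD A P) (h' : RD A Q) : RD A fun n => P n ∧ Q n := by
  have := RT.prim2 Primrec.nat_mul h h'
  unfold RD
  convert this using 2 with n
  by_cases h1 : P n <;> by_cases h2 : Q n <;> simp [h1, h2]
theorem RD.or {A P Q} (h : RD A P) (h' : RD A Q) : RD A fun n => P n ∨ Q n := by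
  have := RT.prim2 (Primrec.nat_max) h h'
  unfold RD
  convert this using 2 with n
  by_cases h1 : P n <;> by_cases h2 : Q n <;> simp [h1, h2]
theorem RD.rel {A} {r : ℕ → ℕ → Prop} (h : RD A fun n => r n.unpair.1 n.unpair.2) : RelRecursiveIn A r := by
  unfold RelRecursiveIn
  refine (congrArg (RecursiveIn (charFun A)) ?_).mpr h
  funext n
  simp only [PFun.coe_val]
  split_ifs <;> rfl

def TT (A : Set ℕ) (c n : ℕ) (σ l : List ℕ) : Prop := l = [] ∨ good c n (rs (charFun A) (l.reverse ++ σ).length) (l.reverse ++ σ)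
theorem good_tail (A : Set ℕ) {e n σ x} (h : good e n (rs (charFun A) (x :: σ).length) (x :: σ)) : good e n (rs (charFun A) σ.length) σ := by
  intro j hj h'
  refine h (j+1) (by simpa using hj) ?_
  simp only [List.length_cons, List.drop_succ_cons, rs]
  exact Nat.Partrec.Code.evaln_mono (Nat.le_succ _) h'

theorem w1_pres {A o} (h : o < w1 A) : ∃ r : ℕ → ℕ → Prop, RelRecursiveIn A r ∧ IsPresentation r o := by
  obtain ⟨u, hu, rfl⟩ := lt_w1.1 h
  obtain ⟨⟨c, n, σ⟩, rfl⟩ : ∃ p : ℕ × ℕ × List ℕ, u = Encodable.encode p := ⟨nd u, (Denumerable.encode_ofNat _).symm⟩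
  have hT1 : ∀ l x, TT A c n σ (l ++ [x]) → TT A c n σ l := by
    rintro l x (h | h)
    · simp at h
    · right
      have : (l ++ [x]).reverse ++ σ = x :: (l.reverse ++ σ) := by simp
      rw [this] at h
      exact good_tail A h
  let C : List ℕ → List ℕ → Prop := fun b a => TT A c n σ b ∧ ∃ x, b = a ++ [x]
  let E : ℕ → ℕ → Prop := fun x y => TT A c n σ (Denumerable.ofNat (List ℕ) x) ∧ TT A c n σ (Denumerable.ofNat (List ℕ) y) ∧ kb (Denumerable.ofNat (List ℕ) x) (Denumerable.ofNat (List ℕ) y)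
  have hsim : IsSim C (tr A) fun l v => v = Encodable.encode (c, n, l.reverse ++ σ) := by
    rintro l v rfl l' ⟨h, x, rfl⟩
    refine ⟨_, ?_, rfl⟩
    rw [tr_iff]
    simp only [true_and]
    refine ⟨by simp, by simp, ?_⟩
    rcases h with h | h
    · simp at h
    · exact h
  have hC : Acc C [] := ((sim_iff hu).1 ⟨_, hsim, rfl⟩).1
  have hkb := kb_wf _ hT1 hC
  have hEw : ∀ x, Acc E x := by
    intro x
    refine ((sim_iff (hkb (Denumerable.ofNat (List ℕ) x))).1 ⟨fun x l => l = Denumerable.ofNat (List ℕ) x, ?_, rfl⟩).1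
    rintro x l rfl x' ⟨h1, h2, h3⟩
    exact ⟨_, ⟨⟨h1, List.nil_prefix⟩, ⟨h2, List.nil_prefix⟩, h3⟩, rfl⟩
  have hle : rk (tr A) (Encodable.encode (c, n, σ)) ≤ rk E (Encodable.encode ([] : List ℕ)) := by
    refine ((sim_iff (hEw _)).1 ⟨fun v x => ∃ l, TT A c n σ l ∧ v = Encodable.encode (c, n, l.reverse ++ σ) ∧ x = Encodable.encode l, ?_, [], Or.inl rfl, rfl, rfl⟩).2
    rintro v x ⟨l, hl, rfl, rfl⟩ v' hv
    obtain ⟨⟨c', n', τ⟩, rfl⟩ : ∃ p : ℕ × ℕ × List ℕ, v' = Encodable.encode p := ⟨nd v', (Denumerable.encode_ofNat _).symm⟩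
    rw [tr_iff] at hv
    obtain ⟨rfl, rfl, h1, h2, h3⟩ := hv
    cases τ with
    | nil => simp at h1
    | cons y τ =>
      simp only [List.tail_cons] at h2
      subst h2
      have h4 : TT A c' n' σ (l ++ [y]) := Or.inr (by simpa using h3)
      refine ⟨Encodable.encode (l ++ [y]), ?_, l ++ [y], h4, by simp, rfl⟩
      simp only [E, Denumerable.ofNat_encode]
      refine ⟨h4, hl, ?_⟩
      have := (kb_app l [y] []).2 trivial
      simpa using this
  obtain ⟨p, hp, hp2⟩ := rk_mem (hEw _) hle
  rw [← hp2]
  refine ⟨_, RD.rel ?_, pres_rk ?_ hp ?_⟩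
  · have ht : RD A fun m => TT A c n σ (Denumerable.ofNat (List ℕ) m) := by
      have h1 : Primrec fun m : ℕ => (Denumerable.ofNat (List ℕ) m).reverse ++ σ :=
        Primrec.list_append.comp (Primrec.list_reverse.comp (Primrec.ofNat _)) (Primrec.const σ)
      refine RD.or (RD.prim (Primrec.eq.comp (Primrec.ofNat _) (Primrec.const []))) ?_
      have h2 : PrimrecPred fun m : ℕ => good c n (Denumerable.ofNat (List ℕ) m.unpair.1) ((Denumerable.ofNat (List ℕ) m.unpair.2).reverse ++ σ) :=
        good_prim.comp (Primrec.pair (Primrec.const (c, n)) (Primrec.pair ((Primrec.ofNat _).comp prim_fst) (h1.comp prim_snd)))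
      exact ((RD.prim (A := A) h2).comp (((rs_rec (charFun A)).comp (RT.prim (Primrec.list_length.comp h1))).pair (RT.prim Primrec.id))).congr fun m => by simp
    have hE {f g : ℕ → ℕ} (hf : Primrec f) (hg : Primrec g) : RD A fun m => E (f m) (g m) :=
      (ht.comp (RT.prim hf)).and ((ht.comp (RT.prim hg)).and (RD.prim (kb_prim.comp ((Primrec.ofNat _).comp hf) ((Primrec.ofNat _).comp hg))))
    exact (hE prim_fst (Primrec.const p)).and ((hE prim_snd (Primrec.const p)).and ((hE prim_fst prim_snd).or (RD.prim (Primrec.eq.comp prim_fst prim_snd))))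
  · rintro a b c ⟨h1, h2, h3⟩ ⟨h4, h5, h6⟩
    exact ⟨h1, h5, kb_trans _ _ _ h3 h6⟩
  · rintro a b ⟨h1, h2, h3⟩ ⟨h4, h5, h6⟩
    rcases kb_tri (Denumerable.ofNat (List ℕ) a) (Denumerable.ofNat (List ℕ) b) with h | h | h
    · exact Or.inl ⟨h1, h4, h⟩
    · right; left
      rw [← Denumerable.encode_ofNat (α := List ℕ) a, h, Denumerable.encode_ofNat]
    · exact Or.inr (Or.inr ⟨h4, h1, h⟩)

theorem omega1_eq (A) : omega1 A = w1 A := by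
  unfold omega1
  apply le_antisymm
  · apply csInf_le'
    rintro ⟨r, h1, h2⟩
    exact lt_irrefl _ (pres_lt h1 h2)
  · refine le_csInf ⟨w1 A, ?_⟩ ?_
    · rintro ⟨r, h1, h2⟩
      exact lt_irrefl _ (pres_lt h1 h2)
    · intro o ho
      by_contra h
      exact ho (w1_pres (not_le.1 h))

theorem omega_lt_w1 (A) : Ordinal.omega0 < w1 A := by
  have h1 : Df (Sg A) fun _ e => e 0 < e 1 ∨ False := inferInstance
  let E : ℕ → ℕ → Prop := fun x y => (y = 0 ∧ x ≠ 0) ∨ (x ≠ 0 ∧ y ≠ 0 ∧ x < y)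
  have hE : Df (Sg A) fun _ e => E (e 0) (e 1) := (inferInstance : Df (Sg A) fun _ e => (e 1 = 0 ∧ e 0 ≠ 0) ∨ (e 0 ≠ 0 ∧ e 1 ≠ 0 ∧ e 0 < e 1))
  have h2 : ∀ n, Acc E (n+1) ∧ (n : Ordinal) ≤ rk E (n+1) := by
    intro n
    induction n using Nat.strong_induction_on with
    | _ n ih =>
    have : Acc E (n+1) := by
      refine ⟨_, ?_⟩
      rintro y (⟨h, _⟩ | ⟨h1, _, h2⟩)
      · omega
      · obtain ⟨m, rfl⟩ := Nat.exists_eq_succ_of_ne_zero h1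
        exact (ih m (by omega)).1
    refine ⟨this, ?_⟩
    cases n with
    | zero => simp
    | succ n =>
      have h3 := rk_lt this (x := n+1) (Or.inr ⟨by omega, by omega, by omega⟩)
      have := (ih n (by omega)).2.trans_lt h3
      rw [Nat.cast_succ, ← Order.succ_eq_add_one]
      exact Order.succ_le_of_lt this
  have h3 : Acc E 0 := by
    refine ⟨_, ?_⟩
    rintro y (⟨_, h1⟩ | ⟨h1, h, h2⟩)
    · obtain ⟨m, rfl⟩ := Nat.exists_eq_succ_of_ne_zero h1
      exact (h2 m).1
    · omega
  refine lt_of_le_of_lt ?_ (F5 hE h3)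
  rw [Ordinal.omega0_le]
  intro n
  exact (h2 n).2.trans (rk_lt h3 (Or.inl ⟨rfl, by omega⟩)).le
abbrev El (M : ZFSet.{0}) := {y : ZFSet.{0} // y ∈ M}
def rz (M : ZFSet.{0}) {n : ℕ} (θ : LS.BoundedFormula Empty n) (xs : Fin n → El M) : Prop :=
  letI := zStr M
  θ.Realize default xs
section
variable {M : ZFSet.{0}} {n : ℕ} {θ χ : LS.BoundedFormula Empty n} {xs : Fin n → El M}
theorem rz_imp : rz M (θ.imp χ) xs ↔ (rz M θ xs → rz M χ xs) := by
  letI := zStr M; exact BoundedFormula.realize_imp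
theorem rz_inf : rz M (θ ⊓ χ) xs ↔ (rz M θ xs ∧ rz M χ xs) := by
  letI := zStr M; exact BoundedFormula.realize_inf
theorem rz_iff : rz M (θ.iff χ) xs ↔ (rz M θ xs ↔ rz M χ xs) := by
  letI := zStr M; exact BoundedFormula.realize_iff
theorem rz_not : rz M (∼θ) xs ↔ ¬ rz M θ xs := by
  letI := zStr M; exact BoundedFormula.realize_not
theorem rz_bot : rz M (⊥ : LS.BoundedFormula Empty n) xs ↔ False := by
  letI := zStr M; exact BoundedFormula.realize_bot
theorem rz_all {θ : LS.BoundedFormula Empty (n+1)} : rz M θ.all xs ↔ ∀ x, rz M θ (Fin.snoc xs x) := by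
  letI := zStr M; exact BoundedFormula.realize_all
theorem rz_ex {θ : LS.BoundedFormula Empty (n+1)} : rz M θ.ex xs ↔ ∃ x, rz M θ (Fin.snoc xs x) := by
  letI := zStr M; exact BoundedFormula.realize_ex
def tv {n : ℕ} (t : LS.Term (Empty ⊕ Fin n)) : Fin n := match t with
  | .var (.inr i) => i
  | .var (.inl i) => i.elim
  | .func f _ => nomatch f
theorem tv_eq {n : ℕ} (t : LS.Term (Empty ⊕ Fin n)) : t = Term.var (Sum.inr (tv t)) := by
  rcases t with (i | i) | ⟨f, _⟩
  · exact i.elim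
  · rfl
  · exact nomatch f
theorem rz_mem {t u : LS.Term (Empty ⊕ Fin n)} : rz M (memF t u) xs ↔ (xs (tv t)).1 ∈ (xs (tv u)).1 := by
  rw [tv_eq t, tv_eq u]
  letI := zStr M
  exact BoundedFormula.realize_rel₂
theorem rz_eq {t u : LS.Term (Empty ⊕ Fin n)} : rz M (t.bdEqual u) xs ↔ xs (tv t) = xs (tv u) := by
  rw [tv_eq t, tv_eq u]
  letI := zStr M
  exact BoundedFormula.realize_bdEqual _ _
theorem rz_lift {n : ℕ} {θ : LS.BoundedFormula Empty n} {m : ℕ} {xs : Fin (n+1) → El M} (h : m ≤ n) :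
    rz M (θ.liftAt 1 m) xs ↔ rz M θ (xs ∘ fun i => if (i : ℕ) < m then Fin.castSucc i else i.succ) := by
  letI := zStr M
  exact BoundedFormula.realize_liftAt_one h
end

structure KPs (M : ZFSet.{0}) : Prop where
  ext : ∀ x y : El M, (∀ z : El M, z.1 ∈ x.1 ↔ z.1 ∈ y.1) → x = y
  emp : ∃ x : El M, ∀ y : El M, ¬ y.1 ∈ x.1
  pair : ∀ x y : El M, ∃ z : El M, x.1 ∈ z.1 ∧ y.1 ∈ z.1
  union : ∀ x : El M, ∃ y : El M, ∀ z w : El M, z.1 ∈ w.1 → w.1 ∈ x.1 → z.1 ∈ y.1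
  sep : ∀ n (θ : LS.BoundedFormula Empty (n+2)), IsDelta0S θ → ∀ xs : Fin (n+1) → El M, ∃ b : El M, ∀ x : El M,
    x.1 ∈ b.1 ↔ x.1 ∈ (xs (Fin.last n)).1 ∧ rz M θ (Fin.snoc xs x)
  coll : ∀ n (θ : LS.BoundedFormula Empty (n+3)), IsDelta0S θ → ∀ xs : Fin (n+1) → El M,
    (∀ x : El M, x.1 ∈ (xs (Fin.last n)).1 → ∃ y, rz M θ (Fin.snoc (Fin.snoc xs x : Fin (n+2) → El M) y)) →
     ∃ b : El M, ∀ x : El M, x.1 ∈ (xs (Fin.last n)).1 → ∃ y : El M, y.1 ∈ b.1 ∧ rz M θ (Fin.snoc (Fin.snoc xs x : Fin (n+2) → El M) y)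

theorem sent_rz (M : ZFSet.{0}) (θ : LS.Sentence) : (letI := zStr M; θ.Realize (El M)) ↔ ∀ xs, rz M θ xs := by
  letI := zStr M
  constructor
  · intro h xs
    rw [Subsingleton.elim xs default]; exact h
  · intro h; exact h default
theorem alls_rz (M : ZFSet.{0}) {n} (θ : LS.BoundedFormula Empty n) : (∀ xs, rz M θ.alls xs) ↔ ∀ xs, rz M θ xs := by
  letI := zStr M
  have : (θ.alls).Realize (default : Empty → El M) ↔ ∀ xs, θ.Realize default xs := BoundedFormula.realize_alls
  constructor
  · intro h xs
    exact this.1 (h default) xs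
  · intro h xs
    rw [Subsingleton.elim xs default]; exact this.2 h

theorem snoc_at {α : Type*} {n : ℕ} (xs : Fin n → α) (x : α) (i : ℕ) (h : i < n+1) : (Fin.snoc xs x : Fin (n+1) → α) ⟨i, h⟩ = if h' : i < n then xs ⟨i, h'⟩ else x := by
  simp [Fin.snoc]

theorem ext_rz (M) : (∀ xs, rz M extAx xs) ↔ ∀ x y : El M, (∀ z : El M, z.1 ∈ x.1 ↔ z.1 ∈ y.1) → x = y := by
  simp only [extAx, rz_all, rz_imp, rz_iff, rz_mem, rz_eq, v', tv, snoc_at]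
  simp
theorem emp_rz (M) : (∀ xs, rz M emptyAx xs) ↔ ∃ x : El M, ∀ y : El M, ¬ y.1 ∈ x.1 := by
  simp only [emptyAx, rz_all, rz_ex, rz_not, rz_mem, rz_eq, v', tv, snoc_at]
  simp
theorem pair_rz (M) : (∀ xs, rz M pairAx xs) ↔ ∀ x y : El M, ∃ z : El M, x.1 ∈ z.1 ∧ y.1 ∈ z.1 := by
  simp only [pairAx, rz_all, rz_ex, rz_inf, rz_mem, rz_eq, v', tv, snoc_at]
  simp
theorem union_rz (M) : (∀ xs, rz M unionAx xs) ↔ ∀ x : El M, ∃ y : El M, ∀ z w : El M, z.1 ∈ w.1 → w.1 ∈ x.1 → z.1 ∈ y.1 := by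
  simp only [unionAx, rz_all, rz_ex, rz_imp, rz_inf, rz_mem, rz_eq, v', tv, snoc_at]
  simp
theorem sep_rz (M n) (θ : LS.BoundedFormula Empty (n+2)) : (∀ xs, rz M (sepAx n θ) xs) ↔ ∀ xs : Fin (n+1) → El M, ∃ b : El M, ∀ x : El M,
    x.1 ∈ b.1 ↔ x.1 ∈ (xs (Fin.last n)).1 ∧ rz M θ (Fin.snoc xs x) := by
  simp only [sepAx]
  rw [alls_rz]
  simp only [rz_all, rz_ex, rz_iff, rz_inf, rz_mem, v', tv, snoc_at]
  refine forall_congr' fun xs => exists_congr fun b => forall_congr' fun x => ?_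
  rw [rz_lift (by omega)]
  have : ((Fin.snoc (Fin.snoc xs b : Fin (n+2) → El M) x : Fin (n+3) → El M) ∘ fun i : Fin (n+2) => if (i : ℕ) < n + 1 then Fin.castSucc i else i.succ) = Fin.snoc xs x := by
    funext i
    rcases Fin.eq_castSucc_or_eq_last i with ⟨j, rfl⟩ | rfl
    · simp only [Function.comp]
      rw [if_pos (show (j.castSucc : ℕ) < n+1 from j.2)]
      simp [Fin.snoc_castSucc]
    · simp
  rw [this]
  simp
  exact fun _ => Iff.rfl
theorem coll_rz (M n) (θ : LS.BoundedFormula Empty (n+3)) : (∀ xs, rz M (collAx n θ) xs) ↔ ∀ xs : Fin (n+1) → El M,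
    (∀ x : El M, x.1 ∈ (xs (Fin.last n)).1 → ∃ y, rz M θ (Fin.snoc (Fin.snoc xs x : Fin (n+2) → El M) y)) →
     ∃ b : El M, ∀ x : El M, x.1 ∈ (xs (Fin.last n)).1 → ∃ y : El M, y.1 ∈ b.1 ∧ rz M θ (Fin.snoc (Fin.snoc xs x : Fin (n+2) → El M) y) := by
  simp only [collAx]
  rw [alls_rz]
  simp only [rz_all, rz_ex, rz_imp, rz_iff, rz_inf, rz_mem, v', tv, snoc_at]
  have (xs : Fin (n+1) → El M) (b x y) : (rz M (θ.liftAt 1 (n+1)) (Fin.snoc (Fin.snoc (Fin.snoc xs b : Fin (n+2) → El M) x : Fin (n+3) → El M) y)) ↔ rz M θ (Fin.snoc (Fin.snoc xs x : Fin (n+2) → El M) y) := by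
    rw [rz_lift (by omega)]
    have : ((Fin.snoc (Fin.snoc (Fin.snoc xs b : Fin (n+2) → El M) x : Fin (n+3) → El M) y : Fin (n+4) → El M) ∘ fun i : Fin (n+3) => if (i : ℕ) < n + 1 then Fin.castSucc i else i.succ) = Fin.snoc (Fin.snoc xs x : Fin (n+2) → El M) y := by
      funext i
      rcases Fin.eq_castSucc_or_eq_last i with ⟨j, rfl⟩ | rfl
      · rcases Fin.eq_castSucc_or_eq_last j with ⟨j, rfl⟩ | rfl
        · simp only [Function.comp]
          rw [if_pos (show (j.castSucc.castSucc : ℕ) < n+1 from j.2)]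
          simp [Fin.snoc_castSucc]
        · simp
          rw [← Fin.castSucc_succ, Fin.snoc_castSucc, Fin.succ_last, Fin.snoc_last]
      · simp
    rw [this]
  simp only [this]
  simp
  rfl

theorem kp_iff (M : ZFSet.{0}) : SatisfiesKP M ↔ KPs M := by
  unfold SatisfiesKP
  constructor
  · intro h
    have h' : ∀ ψ ∈ KP, ∀ xs, rz M ψ xs := fun ψ hψ => (sent_rz M ψ).1 (h ψ hψ)
    exact ⟨(ext_rz M).1 (h' _ (by simp [KP])), (emp_rz M).1 (h' _ (by simp [KP])), (pair_rz M).1 (h' _ (by simp [KP])), (union_rz M).1 (h' _ (by simp [KP])),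
      fun n θ hθ => (sep_rz M n θ).1 (h' _ (Or.inl (Or.inr ⟨n, θ, hθ, rfl⟩))), fun n θ hθ => (coll_rz M n θ).1 (h' _ (Or.inr ⟨n, θ, hθ, rfl⟩))⟩
  · intro h ψ hψ
    refine (sent_rz M ψ).2 ?_
    rcases hψ with (hψ | ⟨n, θ, hθ, rfl⟩) | ⟨n, θ, hθ, rfl⟩
    · simp only [Set.mem_insert_iff, Set.mem_singleton_iff] at hψ
      rcases hψ with rfl | rfl | rfl | rfl
      · exact (ext_rz M).2 h.ext
      · exact (emp_rz M).2 h.emp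
      · exact (pair_rz M).2 h.pair
      · exact (union_rz M).2 h.union
    · exact (sep_rz M n θ).2 (h.sep n θ hθ)
    · exact (coll_rz M n θ).2 (h.coll n θ hθ)
section
variable {A : Set ℕ}
def SS (A : Set ℕ) (x y : ℕ) : Prop := Sim (tr A) (tr A) x y
instance ss_sg {t s} [ht : AF (Dl A) t] [hs : AF (Dl A) s] : Df (Sg A) fun F e => SS A (t F e) (s F e) :=
  Df.ssub2 (P := fun _ => SS A) (sim_sg inferInstance inferInstance) ht hs
theorem ss_ill {x y : ℕ} (hx : Acc (tr A) x) (hy : ¬ Acc (tr A) y) : SS A x y := by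
  refine ⟨fun a b => ¬ Acc (tr A) b, fun a b hb a' _ => ?_, hy⟩
  by_contra hc
  push Not at hc
  exact hb ⟨_, fun b' h' => hc b' h'⟩
def ST (A : Set ℕ) (u x : ℕ) : Prop := ∃ x', tr A x' x ∧ SS A u x'
instance st_sg {t s} [ht : AF (Dl A) t] [hs : AF (Dl A) s] : Df (Sg A) fun F e => ST A (t F e) (s F e) :=
  Df.ssub2 (P := fun _ => ST A) (inferInstance : Df (Sg A) fun F e => ∃ x', tr A x' (e 1) ∧ SS A (e 0) x') ht hs
theorem st_iff {u x : ℕ} (hu : Acc (tr A) u) : ST A u x ↔ ¬ SS A x u := by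
  constructor
  · rintro ⟨x', h1, h2⟩ h
    obtain ⟨h3, h4⟩ := (sim_iff hu).1 h
    obtain ⟨h5, h6⟩ := (sim_iff (h3.inv h1)).1 h2
    exact absurd (rk_lt h3 h1) (not_lt.2 (h4.trans h6))
  · intro h
    by_cases hx : Acc (tr A) x
    · have : rk (tr A) u < rk (tr A) x := by
        by_contra hc; exact h ((sim_iff hu).2 ⟨hx, not_lt.1 hc⟩)
      obtain ⟨x', h1, h2⟩ := (lt_rk hx).1 this
      exact ⟨x', h1, (sim_iff (hx.inv h1)).2 ⟨hu, h2⟩⟩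
    · by_contra hc
      refine hx ⟨_, fun x' h' => ?_⟩
      by_contra h2
      exact hc ⟨x', h', ss_ill hu h2⟩
theorem ss_dl {u : ℕ} (hu : Acc (tr A) u) : Df (Dl A) fun _ e => SS A (e 0) u :=
  Df.mkDl inferInstance ((inferInstance : Df (Sg A) fun _ e => ST A u (e 0)).scongr fun _ e => (st_iff hu).symm)
theorem bound {X : Set ℕ} (hX : Df (Sg A) fun _ e => e 0 ∈ X) (h : ∀ x ∈ X, Acc (tr A) x) : ∃ u, Acc (tr A) u ∧ ∀ x ∈ X, SS A x u := by
  by_contra hc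
  push Not at hc
  have h1 {t} [ht : AF (Dl A) t] : Df (Sg A) fun F e => t F e ∈ X := Df.ssub1 (P := fun _ x => x ∈ X) hX ht
  refine F3 A ((inferInstance : Df (Sg A) fun _ e => ∃ x, x ∈ X ∧ SS A (e 0) x).scongr fun _ e => ?_)
  constructor
  · intro hu
    obtain ⟨x, hx, h2⟩ := hc _ hu
    obtain ⟨x', h3, h4⟩ := (st_iff hu).2 h2
    refine ⟨x, hx, (sim_iff (h x hx)).2 ?_⟩
    obtain ⟨h5, h6⟩ := (sim_iff ((h x hx).inv h3)).1 h4
    exact ⟨h5, h6.trans (rk_lt (h x hx) h3).le⟩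
  · rintro ⟨x, hx, h2⟩
    exact ((sim_iff (h x hx)).1 h2).1
theorem graph_code {y : ℕ → ℕ} (hy : HF A y) : ∃ c u, Acc (tr A) u ∧ ∀ x v, y x = v ↔ SS A (root c (Nat.pair x v)) u := by
  have h0 {t} [ht : AF (Dl A) t] : AF (Dl A) fun F e => y (t F e) := hy.app ht
  obtain ⟨c, hc⟩ := F1 (A := A) (X := {p | ¬ y p.unpair.1 = p.unpair.2}) (inferInstance : Df (Dl A) fun F e => ¬ y (e 0).unpair.1 = (e 0).unpair.2).sg
  have hc' (p : ℕ) : y p.unpair.1 = p.unpair.2 ↔ Acc (tr A) (root c p) := by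
    have := hc p; simp only [Set.mem_setOf_eq] at this; tauto
  have h1 {t s} [ht : AF (Dl A) t] [hs : AF (Dl A) s] : AF (Dl A) fun F e => root (t F e) (s F e) := AF.prim2 root_prim ht hs
  obtain ⟨u, hu, h⟩ := bound (A := A) (X := {z | ∃ p : ℕ, y p.unpair.1 = p.unpair.2 ∧ z = root c p})
    (inferInstance : Df (Sg A) fun F e => ∃ p : ℕ, y p.unpair.1 = p.unpair.2 ∧ e 0 = root c p) (by
      rintro _ ⟨p, hp, rfl⟩; exact (hc' p).1 hp)
  refine ⟨c, u, hu, fun x v => ⟨fun hxv => h _ ⟨Nat.pair x v, by simpa using hxv, rfl⟩, fun hxv => ?_⟩⟩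
  have := (hc' (Nat.pair x v)).2 ((sim_iff hu).1 hxv).1
  simpa using this
theorem kreisel {P : (ℕ → ℕ) → ℕ → Prop} (hP : Df (Sg A) fun F e => ¬ P (F 0) (e 0)) (h : ∀ k, ∃ y, HF A y ∧ P y k) :
    ∃ Y : ℕ → ℕ → ℕ, AF (Dl A) (fun _ e => Y (e 0) (e 1)) ∧ ∀ k, P (Y k) k := by
  have hr {t s} [ht : AF (Dl A) t] [hs : AF (Dl A) s] : AF (Dl A) fun F e => root (t F e) (s F e) := AF.prim2 root_prim ht hs
  let Q (k i : ℕ) : Prop := Acc (tr A) i.unpair.2 ∧ ∃ y, (∀ x v, y x = v ↔ SS A (root i.unpair.1 (Nat.pair x v)) i.unpair.2) ∧ P y k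
  have hP' {t} [ht : AF (Dl A) t] : Df (Sg A) fun F e => ¬ P (F 0) (t F e) := Df.ssub1 (P := fun F x => ¬ P (F 0) x) hP ht
  have hW {t} [ht : AF (Dl A) t] : Df (Sg A) fun F e => ¬ Acc (tr A) (t F e) := Df.ssub1 (P := fun F x => ¬ Acc (tr A) x) (F2 A) ht
  have hQ : Df (Sg A) fun F e => ¬ Q (e 0) (e 1) := by
    refine (inferInstance : Df (Sg A) fun F e => ¬ Acc (tr A) (e 1).unpair.2 ∨ (∃ x, ∀ v, ST A (e 1).unpair.2 (root (e 1).unpair.1 (Nat.pair x v)))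
      ∨ (∃ x, ∃ v, ∃ w, ¬ v = w ∧ SS A (root (e 1).unpair.1 (Nat.pair x v)) (e 1).unpair.2 ∧ SS A (root (e 1).unpair.1 (Nat.pair x w)) (e 1).unpair.2)
      ∨ (∃ y : ℕ → ℕ, (∀ x, SS A (root (e 1).unpair.1 (Nat.pair x (y x))) (e 1).unpair.2) ∧ ¬ P y (e 0))).scongr fun F e => ?_
    by_cases hu : Acc (tr A) (e 1).unpair.2
    · simp only [Q, hu, true_and, not_true, false_or, st_iff hu]
      generalize hG : (fun x v => SS A (root (e 1).unpair.1 (Nat.pair x v)) (e 1).unpair.2) = G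
      have hG' x v : SS A (root (e 1).unpair.1 (Nat.pair x v)) (e 1).unpair.2 = G x v := by rw [← hG]
      simp only [hG']
      constructor
      · intro hn
        by_contra hc
        push Not at hc
        obtain ⟨h1, h2, h3⟩ := hc
        choose y hy using h1
        refine hn ⟨y, fun x v => ⟨fun h => h ▸ hy x, fun h => ?_⟩, h3 y hy⟩
        by_contra h4
        exact h2 x _ _ h4 (hy x) h
      · rintro h ⟨y, h1, h2⟩
        rcases h with ⟨x, h⟩ | ⟨x, v, w, h3, h4, h5⟩ | ⟨y', h3, h4⟩
        · exact h _ ((h1 x _).1 rfl)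
        · exact h3 (((h1 _ _).2 h4).symm.trans ((h1 _ _).2 h5))
        · have : y = y' := funext fun x => (h1 _ _).2 (h3 x)
          exact h4 (this ▸ h2)
    · simp [Q, hu]
  obtain ⟨d, hd⟩ := F1 (A := A) (X := {n | ¬ Q n.unpair.1 n.unpair.2})
    (Df.ssub2 (P := fun F a b => ¬ Q a b) hQ (inferInstance : AF (Dl A) fun F e => (e 0).unpair.1) (inferInstance : AF (Dl A) fun F e => (e 0).unpair.2))
  have hd' (k i : ℕ) : Q k i ↔ Acc (tr A) (root d (Nat.pair k i)) := by
    have := hd (Nat.pair k i); simp only [Set.mem_setOf_eq, Nat.unpair_pair] at this; exact not_iff_not.1 this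
  have hex (k) : ∃ i, Q k i := by
    obtain ⟨y, hy, hp⟩ := h k
    obtain ⟨c, u, hu, hg⟩ := graph_code hy
    exact ⟨Nat.pair c u, by simpa [Q] using ⟨hu, y, hg, hp⟩⟩
  have hw : ∃ w, Acc (tr A) w ∧ ∀ k, ∃ i, SS A (root d (Nat.pair k i)) w := by
    by_contra hc
    push Not at hc
    refine F3 A ((inferInstance : Df (Sg A) fun F e => ∃ k, ∀ i, ST A (e 0) (root d (Nat.pair k i))).scongr fun F e => ?_)
    constructor
    · intro hu
      obtain ⟨k, hk⟩ := hc _ hu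
      exact ⟨k, fun i => (st_iff hu).2 (hk i)⟩
    · rintro ⟨k, hk⟩
      obtain ⟨i, hi⟩ := hex k
      obtain ⟨x', h1, h2⟩ := hk i
      exact ((sim_iff (((hd' k i).1 hi).inv h1)).1 h2).1
  obtain ⟨w, hw, hi⟩ := hw
  have hsd {t} [ht : AF (Dl A) t] : Df (Dl A) fun F e => SS A (t F e) w := Df.sub1 (P := fun _ x => SS A x w) (ss_dl hw) ht
  let I (k : ℕ) : ℕ := Nat.find (hi k)
  have hI : HF A I := by
    refine HF.sg ((inferInstance : Df (Dl A) fun F e => SS A (root d (Nat.pair (e 0) (e 1))) w ∧ ∀ j, j < e 1 → ¬ SS A (root d (Nat.pair (e 0) j)) w).sg.scongr fun F e => ?_)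
    simp only [I, Nat.find_eq_iff]
  have hI' {t} [ht : AF (Dl A) t] : AF (Dl A) fun F e => I (t F e) := hI.app ht
  have hIQ k : Q k (I k) := (hd' _ _).2 ((sim_iff hw).1 (Nat.find_spec (hi k))).1
  choose hIa Y hY hYP using hIQ
  refine ⟨Y, ?_, hYP⟩
  have : HF A fun p => Y p.unpair.1 p.unpair.2 := HF.sg
    ((inferInstance : Df (Sg A) fun F e => SS A (root (I (e 0).unpair.1).unpair.1 (Nat.pair (e 0).unpair.2 (e 1))) (I (e 0).unpair.1).unpair.2).scongr fun F e => hY _ _ _)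
  have := this.app (inferInstance : AF (Dl A) fun _ e => Nat.pair (e 0) (e 1))
  simpa using this
end
noncomputable def col (W : ℕ → ℕ → Prop) (k : ℕ) : ZFSet.{0} :=
  if h : WellFounded W then h.fix (fun k f => ZFSet.range fun j : {j // W j k} => f j.1 j.2) k else ∅
theorem mem_col {W : ℕ → ℕ → Prop} (h : WellFounded W) {k x} : x ∈ col W k ↔ ∃ j, W j k ∧ x = col W j := by
  have this (k) : col W k = ZFSet.range fun j : {j // W j k} => col W j.1 := by
    simp only [col, h, dif_pos]; rw [h.fix_eq]
  rw [this k]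
  simp [eq_comm]
theorem col_emb {W U : ℕ → ℕ → Prop} (h : WellFounded W) (h' : WellFounded U) (f : ℕ → ℕ) (hf : ∀ k x, U x (f k) ↔ ∃ j, x = f j ∧ W j k) (k) :
    col U (f k) = col W k := by
  induction k using h.induction with
  | _ k ih =>
    ext x
    rw [mem_col h, mem_col h']
    constructor
    · rintro ⟨_, h1, rfl⟩
      obtain ⟨j, rfl, h2⟩ := (hf _ _).1 h1
      exact ⟨j, h2, ih j h2⟩
    · rintro ⟨j, h1, rfl⟩
      exact ⟨f j, (hf _ _).2 ⟨j, rfl, h1⟩, (ih j h1).symm⟩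
theorem acc_emb {W U : ℕ → ℕ → Prop} (f : ℕ → ℕ) (hf : ∀ k x, U x (f k) ↔ ∃ j, x = f j ∧ W j k) {k} (h : Acc W k) : Acc U (f k) := by
  induction h with
  | intro k _ ih => exact ⟨_, fun x hx => by
      obtain ⟨j, rfl, h⟩ := (hf _ _).1 hx
      exact ih j h⟩
theorem col_rank {W : ℕ → ℕ → Prop} (h : WellFounded W) (k) : (col W k).rank = rk W k := by
  induction k using h.induction with
  | _ k ih =>
    apply le_antisymm
    · rw [ZFSet.rank_le_iff]
      intro x hx
      obtain ⟨j, h1, rfl⟩ := (mem_col h).1 hx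
      rw [ih j h1]; exact rk_lt (h.apply k) h1
    · rw [rk_le (h.apply k)]
      intro j hj
      rw [← ih j hj]
      exact ZFSet.rank_lt_of_mem ((mem_col h).2 ⟨j, hj, rfl⟩)
section
variable {A : Set ℕ}
def HW (A : Set ℕ) (W : ℕ → ℕ → Prop) : Prop := WellFounded W ∧ Df (Dl A) fun _ e => W (e 0) (e 1)
noncomputable def MA (A : Set ℕ) : ZFSet.{0} := ZFSet.range fun p : {p : (ℕ → ℕ → Prop) × ℕ // HW A p.1} => col p.1.1 p.1.2
theorem mem_MA {x} : x ∈ MA A ↔ ∃ W k, HW A W ∧ x = col W k := by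
  simp only [MA, ZFSet.mem_range]
  constructor
  · rintro ⟨⟨⟨W, k⟩, h⟩, rfl⟩; exact ⟨W, k, h, rfl⟩
  · rintro ⟨W, k, h, rfl⟩; exact ⟨⟨⟨W, k⟩, h⟩, rfl⟩
theorem MA_trans : (MA A).IsTransitive := by
  intro x hx y hy
  obtain ⟨W, k, h, rfl⟩ := mem_MA.1 hx
  obtain ⟨j, _, rfl⟩ := (mem_col h.1).1 hy
  exact mem_MA.2 ⟨W, j, h, rfl⟩
theorem MA_rank : (MA A).rank = w1 A := by
  apply le_antisymm
  · rw [ZFSet.rank_le_iff]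
    intro x hx
    obtain ⟨W, k, h, rfl⟩ := mem_MA.1 hx
    rw [col_rank h.1]
    exact F5 h.2.sg (h.1.apply k)
  · by_contra hc
    rw [not_le] at hc
    obtain ⟨u, hu, hr⟩ := lt_w1.1 hc
    have hsd {t} [ht : AF (Dl A) t] : Df (Dl A) fun F e => SS A (t F e) u := Df.sub1 (P := fun _ x => SS A x u) (ss_dl hu) ht
    let W (m n : ℕ) : Prop := tr A m n ∧ SS A n u
    have hW : HW A W := by
      refine ⟨⟨fun n => ?_⟩, (inferInstance : Df (Dl A) fun F e => tr A (e 0) (e 1) ∧ SS A (e 1) u)⟩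
      by_cases hn : SS A n u
      · have h1 := ((sim_iff hu).1 hn).1
        clear hn
        induction h1 with
        | intro n _ ih => exact ⟨_, fun m hm => ih m hm.1⟩
      · exact ⟨_, fun m hm => absurd hm.2 hn⟩
    have h1 : Sim (tr A) W u u := by
      refine ⟨fun a b => a = b ∧ SS A a u, ?_, rfl, (sim_iff hu).2 ⟨hu, le_rfl⟩⟩
      rintro a b ⟨rfl, h⟩ a' ha
      obtain ⟨h1, h2⟩ := (sim_iff hu).1 h
      exact ⟨a', ⟨ha, h⟩, rfl, (sim_iff hu).2 ⟨h1.inv ha, (rk_lt h1 ha).le.trans h2⟩⟩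
    have h2 := ((sim_iff (hW.1.apply u)).1 h1).2
    have h3 : col W u ∈ MA A := mem_MA.2 ⟨W, u, hW, rfl⟩
    have h4 := ZFSet.rank_lt_of_mem h3
    rw [col_rank hW.1] at h4
    exact absurd (h2.trans_lt h4) (by rw [hr]; exact lt_irrefl _)
def jn (V : ℕ → ℕ → ℕ → Prop) (a b : ℕ) : Prop := a.unpair.1 = b.unpair.1 ∧ V a.unpair.1 a.unpair.2 b.unpair.2
theorem jn_emb (V : ℕ → ℕ → ℕ → Prop) (i k x) : jn V x (Nat.pair i k) ↔ ∃ j, x = Nat.pair i j ∧ V i j k := by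
  simp only [jn, Nat.unpair_pair]
  constructor
  · rintro ⟨h1, h2⟩; exact ⟨x.unpair.2, by rw [← h1]; simp, h1 ▸ h2⟩
  · rintro ⟨j, rfl, h⟩; simpa using h
theorem jn_wf {V : ℕ → ℕ → ℕ → Prop} (h : ∀ i, WellFounded (V i)) : WellFounded (jn V) := ⟨fun n => by
  rw [← Nat.pair_unpair n]
  exact acc_emb (fun k => Nat.pair n.unpair.1 k) (jn_emb V _) ((h _).apply _)⟩
theorem jn_wf' {V : ℕ → ℕ → ℕ → Prop} (h : WellFounded (jn V)) (i) : WellFounded (V i) := by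
  have := InvImage.wf (fun k => Nat.pair i k) h
  refine Subrelation.wf ?_ this
  intro a b hab
  exact (jn_emb _ _ _ _).2 ⟨a, rfl, hab⟩
theorem jn_col {V : ℕ → ℕ → ℕ → Prop} (h : ∀ i, WellFounded (V i)) (i k) : col (jn V) (Nat.pair i k) = col (V i) k :=
  col_emb (h i) (jn_wf h) (fun k => Nat.pair i k) (jn_emb V i) k
theorem jn_hw {V : ℕ → ℕ → ℕ → Prop} (h : ∀ i, WellFounded (V i)) (h' : Df (Dl A) fun _ e => V (e 0) (e 1) (e 2)) : HW A (jn V) := by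
  have h1 {t s r} [ht : AF (Dl A) t] [hs : AF (Dl A) s] [hr : AF (Dl A) r] : Df (Dl A) fun F e => V (t F e) (s F e) (r F e) := Df.sub3 (P := fun _ => V) h' ht hs hr
  exact ⟨jn_wf h, (inferInstance : Df (Dl A) fun F e => (e 0).unpair.1 = (e 1).unpair.1 ∧ V (e 0).unpair.1 (e 0).unpair.2 (e 1).unpair.2)⟩
def j2 (W V : ℕ → ℕ → Prop) (i : ℕ) : ℕ → ℕ → Prop := fun a b => (i = 0 ∧ W a b) ∨ (i ≠ 0 ∧ V a b)
theorem j2_0 (W V) : j2 W V 0 = W := by funext a b; simp [j2]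
theorem j2_1 (W V) : j2 W V 1 = V := by funext a b; simp [j2]
theorem j2_wf {W V} (hW : WellFounded W) (hV : WellFounded V) (i) : WellFounded (j2 W V i) := by
  by_cases h : i = 0
  · subst h; rwa [j2_0]
  · have : j2 W V i = V := by funext a b; simp [j2, h]
    rwa [this]
theorem join2 {W V} (hW : HW A W) (hV : HW A V) : HW A (jn (j2 W V)) := by
  have h1 {t s} [ht : AF (Dl A) t] [hs : AF (Dl A) s] : Df (Dl A) fun F e => W (t F e) (s F e) := Df.sub2 (P := fun _ => W) hW.2 ht hs
  have h2 {t s} [ht : AF (Dl A) t] [hs : AF (Dl A) s] : Df (Dl A) fun F e => V (t F e) (s F e) := Df.sub2 (P := fun _ => V) hV.2 ht hs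
  exact jn_hw (j2_wf hW.1 hV.1) (inferInstance : Df (Dl A) fun F e => (e 0 = 0 ∧ W (e 1) (e 2)) ∨ (e 0 ≠ 0 ∧ V (e 1) (e 2)))
theorem join_fin {n} (xs : Fin n → El (MA A)) : ∃ W, HW A W ∧ ∃ ks : Fin n → ℕ, ∀ i, (xs i).1 = col W (ks i) := by
  induction n with
  | zero => exact ⟨fun _ _ => False, ⟨⟨fun a => ⟨_, fun _ h => h.elim⟩⟩, inferInstance⟩, fun _ => 0, fun i => i.elim0⟩
  | succ n ih =>
    obtain ⟨W, hW, ks, hk⟩ := ih fun i => xs i.castSucc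
    obtain ⟨V, l, hV, hl⟩ := mem_MA.1 (xs (Fin.last n)).2
    refine ⟨_, join2 hW hV, Fin.snoc (fun i => Nat.pair 0 (ks i)) (Nat.pair 1 l), fun i => ?_⟩
    rcases Fin.eq_castSucc_or_eq_last i with ⟨j, rfl⟩ | rfl
    · rw [Fin.snoc_castSucc, jn_col (j2_wf hW.1 hV.1), j2_0]; exact hk j
    · rw [Fin.snoc_last, jn_col (j2_wf hW.1 hV.1), j2_1]; exact hl
theorem setform {W} (hW : HW A W) {Z : Set ℕ} (hZ : Df (Dl A) fun _ e => e 0 ∈ Z) : ∃ b : El (MA A), ∀ x, x ∈ b.1 ↔ ∃ j ∈ Z, x = col W j := by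
  have h1 {t s} [ht : AF (Dl A) t] [hs : AF (Dl A) s] : Df (Dl A) fun F e => W (t F e) (s F e) := Df.sub2 (P := fun _ => W) hW.2 ht hs
  have h2 {t} [ht : AF (Dl A) t] : Df (Dl A) fun F e => t F e ∈ Z := Df.sub1 (P := fun _ x => x ∈ Z) hZ ht
  let U (x y : ℕ) : Prop := ∃ a, x = a + 1 ∧ ((y = 0 ∧ a ∈ Z) ∨ ∃ b, y = b+1 ∧ W a b)
  have hemb (k x : ℕ) : U x (k+1) ↔ ∃ j, x = j + 1 ∧ W j k := by simp [U]
  have hacc (k) : Acc U (k+1) := acc_emb (fun k => k+1) hemb (hW.1.apply k)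
  have hU : HW A U := by
    refine ⟨⟨fun n => ⟨_, ?_⟩⟩, (inferInstance : Df (Dl A) fun F e => ∃ a, e 0 = a + 1 ∧ ((e 1 = 0 ∧ a ∈ Z) ∨ ∃ b, e 1 = b+1 ∧ W a b))⟩
    rintro _ ⟨a, rfl, _⟩; exact hacc a
  refine ⟨⟨col U 0, mem_MA.2 ⟨U, 0, hU, rfl⟩⟩, fun x => ?_⟩
  rw [mem_col hU.1]
  have := col_emb hW.1 hU.1 (fun k => k+1) hemb
  constructor
  · rintro ⟨_, ⟨a, rfl, (⟨_, h⟩ | ⟨b, h, _⟩)⟩, rfl⟩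
    · exact ⟨a, h, this a⟩
    · omega
  · rintro ⟨j, hj, rfl⟩
    exact ⟨j+1, ⟨j, rfl, Or.inl ⟨rfl, hj⟩⟩, (this j).symm⟩

def sat (R E : ℕ → ℕ → Prop) : ∀ {n}, LS.BoundedFormula Empty n → NE → Prop
  | _, .falsum, _ => False
  | n, .equal t u, e => E (e (n - 1 - tv t)) (e (n - 1 - tv u))
  | n, .rel (l := 2) r ts, e => ∃ c, R c (e (n - 1 - tv (ts 1))) ∧ E (e (n - 1 - tv (ts 0))) c
  | n, .rel _ _, e => False
  | n, .imp θ χ, e => sat R E θ e → sat R E χ e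
  | n, .all θ, e => ∀ x, sat R E θ (push x e)
theorem sat_df {K} [ArLike K] {R E : FE → ℕ → ℕ → Prop} (hR : Df K fun F e => R F (e 0) (e 1)) (hE : Df K fun F e => E F (e 0) (e 1)) {n}
    (θ : LS.BoundedFormula Empty n) : Df K fun F e => sat (R F) (E F) θ e := by
  have h1 {t s} [ht : AF K t] [hs : AF K s] : Df K fun F e => R F (t F e) (s F e) := Df.sub2 (P := R) hR ht hs
  have h2 {t s} [ht : AF K t] [hs : AF K s] : Df K fun F e => E F (t F e) (s F e) := Df.sub2 (P := E) hE ht hs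
  induction θ with
  | falsum => simp only [sat]; infer_instance
  | equal t u => simp only [sat]; infer_instance
  | @rel n l r ts =>
    cases r
    change Df K fun F e => ∃ c, R F c (e (n - 1 - tv (ts 1))) ∧ E F (e (n - 1 - tv (ts 0))) c
    infer_instance
  | imp θ χ ih1 ih2 => simp only [sat]; infer_instance
  | all θ ih =>
    simp only [sat]
    refine @Df.all K _ (fun F e x => sat (R F) (E F) θ (push x e)) (ih.congr fun F e => ?_)
    have : push (e 0) (fun i => e (i+1)) = e := by funext i; cases i <;> rfl
    rw [this]
theorem sat_ok {M : ZFSet.{0}} (hM : M.IsTransitive) {R E : ℕ → ℕ → Prop} (hR : WellFounded R) (hE : ∀ a b, E a b ↔ col R a = col R b)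
    {n} {θ : LS.BoundedFormula Empty n} (hθ : IsDelta0S θ) : ∀ (xs : Fin n → El M) (e : NE), (∀ i, (xs i).1 = col R (e (n - 1 - i))) →
      (rz M θ xs ↔ sat R E θ e) := by
  have hmem (a b : ℕ) : col R a ∈ col R b ↔ ∃ c, R c b ∧ E a c := by rw [mem_col hR]; simp only [hE]
  have hsnoc {n} (xs : Fin n → El M) (e : NE) (h : ∀ i, (xs i).1 = col R (e (n - 1 - i))) (x : El M) (c : ℕ) (hx : x.1 = col R c) :
     ∀ i, ((Fin.snoc xs x : Fin (n+1) → El M) i).1 = col R (push c e (n + 1 - 1 - i)) := by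
    intro i
    rcases Fin.eq_castSucc_or_eq_last i with ⟨j, rfl⟩ | rfl
    · rw [Fin.snoc_castSucc, h]
      have : n + 1 - 1 - (j.castSucc : ℕ) = (n - 1 - j) + 1 := by have := j.2; simp; omega
      rw [this]
    · rw [Fin.snoc_last]; simp [hx]
  have hball {n} (xs : Fin n → El M) (e : NE) (h : ∀ i, (xs i).1 = col R (e (n - 1 - i))) (t : LS.Term (Empty ⊕ Fin n)) (x : El M) :
      rz M (memF (Term.var (Sum.inr (Fin.last n))) (t.relabel (Sum.map id Fin.castSucc))) (Fin.snoc xs x) ↔ ∃ c, R c (e (n - 1 - tv t)) ∧ x.1 = col R c := by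
    rw [rz_mem]
    rw [tv_eq t]
    simp only [Term.relabel, Sum.map, Sum.elim_inr, tv, Function.comp, Fin.snoc_castSucc, Fin.snoc_last]
    rw [h, mem_col hR]
  have hball2 {n} (e : NE) (t : LS.Term (Empty ⊕ Fin n)) (c : ℕ) :
      sat R E (memF (Term.var (Sum.inr (Fin.last n))) (t.relabel (Sum.map id Fin.castSucc))) (push c e) ↔ ∃ d, R d (e (n - 1 - tv t)) ∧ E c d := by
    rw [tv_eq t]
    have h1 : n + 1 - 1 - ((tv t).castSucc : ℕ) = (n - 1 - tv t) + 1 := by have := (tv t).2; simp; omega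
    have h2 : n + 1 - 1 - (Fin.last n : ℕ) = 0 := by simp
    change (∃ d, R d (push c e (n + 1 - 1 - ((tv t).castSucc : ℕ))) ∧ E (push c e (n + 1 - 1 - (Fin.last n : ℕ))) d) ↔ _
    rw [h1, h2]
    rfl
  have hq {n} {θ : LS.BoundedFormula Empty (n+1)} (t : LS.Term (Empty ⊕ Fin n)) (ih : ∀ (xs : Fin (n+1) → El M) (e : NE), (∀ i, (xs i).1 = col R (e (n + 1 - 1 - i))) →
      (rz M θ xs ↔ sat R E θ e)) (xs : Fin n → El M) (e : NE) (h : ∀ i, (xs i).1 = col R (e (n - 1 - i))) :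
      ((∀ x : El M, rz M (memF (Term.var (Sum.inr (Fin.last n))) (t.relabel (Sum.map id Fin.castSucc))) (Fin.snoc xs x) → rz M θ (Fin.snoc xs x)) ↔
       (∀ c, sat R E (memF (Term.var (Sum.inr (Fin.last n))) (t.relabel (Sum.map id Fin.castSucc))) (push c e) → sat R E θ (push c e))) ∧ 
      ((∃ x : El M, rz M (memF (Term.var (Sum.inr (Fin.last n))) (t.relabel (Sum.map id Fin.castSucc))) (Fin.snoc xs x) ∧ rz M θ (Fin.snoc xs x)) ↔
       (∃ c, sat R E (memF (Term.var (Sum.inr (Fin.last n))) (t.relabel (Sum.map id Fin.castSucc))) (push c e) ∧ sat R E θ (push c e))) := by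
    simp only [hball xs e h, hball2]
    have key (c d : ℕ) (h1 : R d (e (n - 1 - tv t))) (h2 : E c d) : ∃ x : El M, x.1 = col R c ∧ x.1 = col R d := by
      refine ⟨⟨col R c, ?_⟩, rfl, (hE _ _).1 h2⟩
      have := (xs (tv t)).2
      rw [h] at this
      exact hM _ this ((hmem _ _).2 ⟨d, h1, h2⟩)
    constructor
    · constructor
      · rintro h1 c ⟨d, h2, h3⟩
        obtain ⟨x, h4, h5⟩ := key c d h2 h3
        exact (ih _ _ (hsnoc xs e h x c h4)).1 (h1 x ⟨d, h2, h5⟩)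
      · rintro h1 x ⟨c, h2, h3⟩
        exact (ih _ _ (hsnoc xs e h x c h3)).2 (h1 c ⟨c, h2, (hE _ _).2 rfl⟩)
    · constructor
      · rintro ⟨x, ⟨c, h2, h3⟩, h1⟩
        exact ⟨c, ⟨c, h2, (hE _ _).2 rfl⟩, (ih _ _ (hsnoc xs e h x c h3)).1 h1⟩
      · rintro ⟨c, ⟨d, h2, h3⟩, h1⟩
        obtain ⟨x, h4, h5⟩ := key c d h2 h3
        exact ⟨x, ⟨d, h2, h5⟩, (ih _ _ (hsnoc xs e h x c h4)).2 h1⟩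
  induction hθ with
  | falsum => intro xs e h; rw [rz_bot]; rfl
  | equal t u =>
    intro xs e h
    rw [rz_eq, Subtype.ext_iff, h, h, ← hE]; rfl
  | mem t u => intro xs e h; rw [rz_mem, h, h, hmem]; rfl
  | imp _ _ ih1 ih2 => intro xs e h; rw [rz_imp, ih1 xs e h, ih2 xs e h]; rfl
  | ball t _ ih =>
    intro xs e h
    rw [rz_all]
    simp only [rz_imp]
    rw [(hq t ih xs e h).1]; rfl
  | bex t _ ih =>
    intro xs e h
    rw [rz_ex]
    simp only [rz_inf]
    rw [(hq t ih xs e h).2]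
    refine Iff.trans ?_ (Iff.rfl : (((∀ c, ((sat R E _ (push c e) → sat R E _ (push c e) → False) → False) → False) → False)) ↔ _)
    constructor
    · rintro ⟨c, h1, h2⟩ h3; exact h3 c fun h4 => h4 h1 h2
    · intro h1
      by_contra h2
      exact h1 fun c hc => hc fun h3 h4 => h2 ⟨c, h3, h4⟩
end
def isBis (R : ℕ → ℕ → Prop) (ρ : ℕ → ℕ) : Prop := ∀ a b, ρ (Nat.pair a b) = 0 ↔
  (∀ c, R c a → ∃ d, R d b ∧ ρ (Nat.pair c d) = 0) ∧ (∀ d, R d b → ∃ c, R c a ∧ ρ (Nat.pair c d) = 0)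
theorem col_eq_iff {R : ℕ → ℕ → Prop} (hR : WellFounded R) (a b) : col R a = col R b ↔
    (∀ c, R c a → ∃ d, R d b ∧ col R c = col R d) ∧ (∀ d, R d b → ∃ c, R c a ∧ col R c = col R d) := by
  constructor
  · intro h
    constructor
    · intro c hc
      have : col R c ∈ col R b := by rw [← h]; exact (mem_col hR).2 ⟨c, hc, rfl⟩
      exact (mem_col hR).1 this
    · intro c hc
      have : col R c ∈ col R a := by rw [h]; exact (mem_col hR).2 ⟨c, hc, rfl⟩
      obtain ⟨d, h1, h2⟩ := (mem_col hR).1 this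
      exact ⟨d, h1, h2.symm⟩
  · rintro ⟨h1, h2⟩
    ext x
    rw [mem_col hR, mem_col hR]
    constructor
    · rintro ⟨j, hj, rfl⟩; exact h1 j hj
    · rintro ⟨j, hj, rfl⟩
      obtain ⟨c, h3, h4⟩ := h2 j hj
      exact ⟨c, h3, h4.symm⟩
theorem bis_ex {R : ℕ → ℕ → Prop} (hR : WellFounded R) : ∃ ρ, isBis R ρ := by
  refine ⟨fun p => if col R p.unpair.1 = col R p.unpair.2 then 0 else 1, fun a b => ?_⟩
  have := col_eq_iff hR a b
  simpa using this
theorem bis_eq {R : ℕ → ℕ → Prop} (hR : WellFounded R) {ρ} (h : isBis R ρ) (a b) : ρ (Nat.pair a b) = 0 ↔ col R a = col R b := by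
  induction a using hR.induction generalizing b with
  | _ a ih =>
    rw [h, col_eq_iff hR]
    constructor
    · rintro ⟨h1, h2⟩
      exact ⟨fun c hc => (h1 c hc).imp fun d hd => ⟨hd.1, (ih c hc d).1 hd.2⟩, fun d hd => (h2 d hd).imp fun c hc => ⟨hc.1, (ih c hc.1 d).1 hc.2⟩⟩
    · rintro ⟨h1, h2⟩
      exact ⟨fun c hc => (h1 c hc).imp fun d hd => ⟨hd.1, (ih c hc d).2 hd.2⟩, fun d hd => (h2 d hd).imp fun c hc => ⟨hc.1, (ih c hc.1 d).2 hc.2⟩⟩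
theorem isBis_df {K} [ArLike K] {R : FE → ℕ → ℕ → Prop} (hR : Df K fun F e => R F (e 0) (e 1)) (i : ℕ) : Df K fun F e => isBis (R F) (F i) := by
  have h1 {t s} [ht : AF K t] [hs : AF K s] : Df K fun F e => R F (t F e) (s F e) := Df.sub2 (P := R) hR ht hs
  exact (inferInstance : Df K fun F e => ∀ a b, F i (Nat.pair a b) = 0 ↔
  (∀ c, R F c a → ∃ d, R F d b ∧ F i (Nat.pair c d) = 0) ∧ (∀ d, R F d b → ∃ c, R F c a ∧ F i (Nat.pair c d) = 0))
def appn : ∀ n, (Fin n → ℕ) → NE → NE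
  | 0, _, e => e
  | n+1, ks, e => push (ks (Fin.last n)) (appn n (fun i => ks i.castSucc) e)
theorem appn_lt : ∀ n (ks : Fin n → ℕ) e (i : Fin n), appn n ks e (n - 1 - i) = ks i
  | 0, ks, e, i => i.elim0
  | n+1, ks, e, i => by
    rcases Fin.eq_castSucc_or_eq_last i with ⟨j, rfl⟩ | rfl
    · have : n + 1 - 1 - (j.castSucc : ℕ) = (n - 1 - j) + 1 := by have := j.2; simp; omega
      rw [this]; exact appn_lt n _ e j
    · simp [appn]
theorem appn_ge : ∀ n (ks : Fin n → ℕ) e i, appn n ks e (n + i) = e i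
  | 0, ks, e, i => by simp [appn]
  | n+1, ks, e, i => by
    have : n + 1 + i = (n + i) + 1 := by omega
    rw [this]; exact appn_ge n _ e i
theorem Df.consts {K} [ArLike K] : ∀ (n) (ks : Fin n → ℕ) {P} (h : Df K P), Df K fun F e => P F (appn n ks e)
  | 0, ks, P, h => h
  | n+1, ks, P, h => by
    have h1 : Df K fun F e => P F (push (ks (Fin.last n)) e) :=
      Df.sub (P := fun F e x => P F (push x e)) (h.congr fun F e => by
        have : push (e 0) (fun i => e (i+1)) = e := by funext i; cases i <;> rfl
        rw [this]) (AF.const' _)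
    exact Df.consts n (fun i => ks i.castSucc) h1
theorem hw_eq {A : Set ℕ} {W} (hW : HW A W) : Df (Dl A) fun _ e => col W (e 0) = col W (e 1) := by
  have h2 : Df (Dl A) fun F e => isBis W (F 0) := isBis_df (R := fun _ => W) hW.2 0
  obtain ⟨ρ, hρ⟩ := bis_ex hW.1
  apply Df.mkDl
  · refine (@Sgi.exf A (fun F e g => isBis W g ∧ g (Nat.pair (e 0) (e 1)) = 0) inferInstance).scongr fun F e => ?_
    constructor
    · intro h; exact ⟨ρ, hρ, (bis_eq hW.1 hρ _ _).2 h⟩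
    · rintro ⟨ρ, hρ, h⟩; exact (bis_eq hW.1 hρ _ _).1 h
  · refine (@Sgi.exf A (fun F e g => isBis W g ∧ ¬ g (Nat.pair (e 0) (e 1)) = 0) inferInstance).scongr fun F e => ?_
    constructor
    · intro h; exact ⟨ρ, hρ, fun h' => h ((bis_eq hW.1 hρ _ _).1 h')⟩
    · rintro ⟨ρ, hρ, h⟩ h'; exact h ((bis_eq hW.1 hρ _ _).2 h')
theorem env_snoc {M : ZFSet.{0}} {R : ℕ → ℕ → Prop} {n} (xs : Fin n → El M) (e : NE) (h : ∀ i, (xs i).1 = col R (e (n - 1 - i))) (x : El M) (c : ℕ) (hx : x.1 = col R c) :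
     ∀ i, ((Fin.snoc xs x : Fin (n+1) → El M) i).1 = col R (push c e (n + 1 - 1 - i)) := by
    intro i
    rcases Fin.eq_castSucc_or_eq_last i with ⟨j, rfl⟩ | rfl
    · rw [Fin.snoc_castSucc, h]
      have : n + 1 - 1 - (j.castSucc : ℕ) = (n - 1 - j) + 1 := by have := j.2; simp; omega
      rw [this]
    · rw [Fin.snoc_last]; simp [hx]
theorem MA_sep {A : Set ℕ} {n} {θ : LS.BoundedFormula Empty (n+2)} (hθ : IsDelta0S θ) (xs : Fin (n+1) → El (MA A)) : ∃ b : El (MA A), ∀ x : El (MA A),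
    x.1 ∈ b.1 ↔ x.1 ∈ (xs (Fin.last n)).1 ∧ rz (MA A) θ (Fin.snoc xs x) := by
  obtain ⟨W, hW, ks, hk⟩ := join_fin xs
  let E a b := col W a = col W b
  have hE : Df (Dl A) fun _ e => E (e 0) (e 1) := hw_eq hW
  have h1 := sat_df (R := fun _ => W) (E := fun _ => E) hW.2 hE θ
  have h2 := Df.consts (n+1) ks (h1.ren (push (n+1) id) id)
  have h4 {t s} [ht : AF (Dl A) t] [hs : AF (Dl A) s] : Df (Dl A) fun F e => W (t F e) (s F e) := Df.sub2 (P := fun _ => W) hW.2 ht hs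
  have h2' : Df (Dl A) fun F e => sat W E θ (push (e 0) (appn (n+1) ks fun _ => e 0)) := by
    have := h2.ren (fun _ => 0) id
    refine this.congr fun F e => ?_
    have : (fun i => appn (n+1) ks (fun _ => e 0) (push (n+1) id i)) = push (e 0) (appn (n+1) ks fun _ => e 0) := by
      funext i; cases i
      · exact appn_ge (n+1) ks _ 0
      · rfl
    rw [← this]
  obtain ⟨b, hb⟩ := setform hW (Z := {j | W j (ks (Fin.last n)) ∧ sat W E θ (push j (appn (n+1) ks fun _ => j))})
    (inferInstance : Df (Dl A) fun F e => W (e 0) (ks (Fin.last n)) ∧ sat W E θ (push (e 0) (appn (n+1) ks fun _ => e 0)))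
  have h3 (x : El (MA A)) (j) (hx : x.1 = col W j) : rz (MA A) θ (Fin.snoc xs x) ↔ sat W E θ (push j (appn (n+1) ks fun _ => j)) := by
    refine sat_ok MA_trans hW.1 (fun a b => Iff.rfl) hθ _ _ (env_snoc xs _ (fun i => ?_) x j hx)
    rw [appn_lt, hk]
  refine ⟨b, fun x => ?_⟩
  rw [hb, hk, mem_col hW.1]
  constructor
  · rintro ⟨j, ⟨h5, h6⟩, hx⟩
    exact ⟨⟨j, h5, hx⟩, (h3 x j hx).2 h6⟩
  · rintro ⟨⟨j, h5, hx⟩, h⟩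
    exact ⟨j, ⟨h5, (h3 x j hx).1 h⟩, hx⟩
theorem MA_coll {A : Set ℕ} {n} {θ : LS.BoundedFormula Empty (n+3)} (hθ : IsDelta0S θ) (xs : Fin (n+1) → El (MA A)) 
    (h : ∀ x : El (MA A), x.1 ∈ (xs (Fin.last n)).1 → ∃ y, rz (MA A) θ (Fin.snoc (Fin.snoc xs x : Fin (n+2) → El (MA A)) y)) :
     ∃ b : El (MA A), ∀ x : El (MA A), x.1 ∈ (xs (Fin.last n)).1 → ∃ y : El (MA A), y.1 ∈ b.1 ∧ rz (MA A) θ (Fin.snoc (Fin.snoc xs x : Fin (n+2) → El (MA A)) y) := by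
  obtain ⟨W, hW, ks, hk⟩ := join_fin xs
  let k0 := ks (Fin.last n)
  have hWi {t s} [ht : AF (Dl A) t] [hs : AF (Dl A) s] : Df (Dl A) fun F e => W (t F e) (s F e) := Df.sub2 (P := fun _ => W) hW.2 ht hs
  let V (y : ℕ → ℕ) (a b : ℕ) : Prop := y (Nat.pair a b + 1) = 0
  let J (y : ℕ → ℕ) : ℕ → ℕ → Prop := jn (j2 W (V y))
  let env (y : ℕ → ℕ) (j : ℕ) : NE := push (Nat.pair 1 (y 0)) (push (Nat.pair 0 j) (appn (n+1) (fun i => Nat.pair 0 (ks i)) (push (Nat.pair 0 j) fun _ => Nat.pair 1 (y 0))))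
  let P (y : ℕ → ℕ) (j : ℕ) : Prop := WellFounded (V y) ∧ (W j k0 → sat (J y) (fun a b => col (J y) a = col (J y) b) θ (env y j))
  have hJ (i : ℕ) : Df (Dl A) fun F e => J (F i) (e 0) (e 1) := (inferInstance : Df (Dl A) fun F e => (e 0).unpair.1 = (e 1).unpair.1 ∧
    (((e 0).unpair.1 = 0 ∧ W (e 0).unpair.2 (e 1).unpair.2) ∨ ((e 0).unpair.1 ≠ 0 ∧ F i (Nat.pair (e 0).unpair.2 (e 1).unpair.2 + 1) = 0)))
  have hsat : Df (Dl A) fun F e => sat (J (F 1)) (fun a b => F 0 (Nat.pair a b) = 0) θ (env (F 1) (e 0)) := by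
    have h1 := sat_df (R := fun F => J (F 1)) (E := fun F a b => F 0 (Nat.pair a b) = 0) (hJ 1) (inferInstance : Df (Dl A) fun F e => F 0 (Nat.pair (e 0) (e 1)) = 0) θ
    have h2 := Df.consts (n+1) (fun i => Nat.pair 0 (ks i)) (h1.ren (push (n+2) (push (n+1) id)) id)
    have h3 := h2.ren (push 0 fun _ => 1) id
    have h4 := Df.sub2 (P := fun F a b => sat (J (F 1)) (fun a b => F 0 (Nat.pair a b) = 0) θ (push b (push a (appn (n+1) (fun i => Nat.pair 0 (ks i)) (push a fun _ => b)))))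
      (h3.congr fun F e => ?_) (inferInstance : AF (Dl A) fun F e => Nat.pair 0 (e 0)) (inferInstance : AF (Dl A) fun F e => Nat.pair 1 (F 1 0))
    · exact h4
    · have e1 : (fun i => e (push 0 (fun _ => 1) i)) = push (e 0) fun _ => e 1 := by funext i; cases i <;> rfl
      have e2 : (fun i => appn (n+1) (fun i => Nat.pair 0 (ks i)) (push (e 0) fun _ => e 1) (push (n+2) (push (n+1) id) i)) =
         (push (e 1) (push (e 0) (appn (n+1) (fun i => Nat.pair 0 (ks i)) (push (e 0) fun _ => e 1)))) := by
        funext i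
        rcases i with _ | _ | i
        · exact appn_ge (n+1) _ _ 1
        · exact appn_ge (n+1) _ _ 0
        · rfl
      rw [← e2, ← e1]
      rfl
  have hnP : Df (Sg A) fun F e => ¬ P (F 0) (e 0) := by
    have h1 : Df (Dl A) fun F e => isBis (J (F 1)) (F 0) := isBis_df (R := fun F => J (F 1)) (hJ 1) 0
    have h2 : Df (Sg A) fun F e => ∃ ρ, isBis (J (F 0)) ρ ∧ ¬ sat (J (F 0)) (fun a b => ρ (Nat.pair a b) = 0) θ (env (F 0) (e 0)) :=
      @Sgi.exf A (fun F e ρ => isBis (J (F 0)) ρ ∧ ¬ sat (J (F 0)) (fun a b => ρ (Nat.pair a b) = 0) θ (env (F 0) (e 0))) inferInstance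
    have h3 : Df (Sg A) fun F e => ∃ f : ℕ → ℕ, ∀ n, V (F 0) (f (n+1)) (f n) :=
      @Sgi.exf A (fun F e f => ∀ n, V (F 0) (f (n+1)) (f n)) (inferInstance : Df (Sg A) fun F e => ∀ n, F 1 (Nat.pair (F 0 (n+1)) (F 0 n) + 1) = 0)
    refine (inferInstance : Df (Sg A) fun F e => (∃ f : ℕ → ℕ, ∀ n, V (F 0) (f (n+1)) (f n)) ∨ (W (e 0) k0 ∧ ∃ ρ, isBis (J (F 0)) ρ ∧ ¬ sat (J (F 0)) (fun a b => ρ (Nat.pair a b) = 0) θ (env (F 0) (e 0)))).scongr fun F e => ?_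
    have hwf : WellFounded (V (F 0)) ↔ ¬ ∃ f : ℕ → ℕ, ∀ n, V (F 0) (f (n+1)) (f n) := by
      constructor
      · rintro hw ⟨f, hf⟩
        exact not_acc_iff_exists_descending_chain.2 ⟨f, rfl, hf⟩ (hw.apply (f 0))
      · intro hn
        refine ⟨fun a => ?_⟩
        by_contra hc
        obtain ⟨f, _, hf⟩ := not_acc_iff_exists_descending_chain.1 hc
        exact hn ⟨f, hf⟩
    by_cases hw : WellFounded (V (F 0))
    · have hJw : WellFounded (J (F 0)) := jn_wf (j2_wf hW.1 hw)
      have e1 : (∃ f : ℕ → ℕ, ∀ n, V (F 0) (f (n+1)) (f n)) ↔ False := iff_false_intro (hwf.1 hw)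
      rw [e1, false_or]
      have e2 : P (F 0) (e 0) ↔ (W (e 0) k0 → sat (J (F 0)) (fun a b => col (J (F 0)) a = col (J (F 0)) b) θ (env (F 0) (e 0))) := and_iff_right hw
      rw [e2, Classical.not_imp]
      refine and_congr_right fun _ => ?_
      have e3 {ρ} (hρ : isBis (J (F 0)) ρ) : (fun a b => ρ (Nat.pair a b) = 0) = fun a b => col (J (F 0)) a = col (J (F 0)) b := by
        funext a b; exact propext (bis_eq hJw hρ a b)
      constructor
      · intro hs
        obtain ⟨ρ, hρ⟩ := bis_ex hJw
        exact ⟨ρ, hρ, by rw [e3 hρ]; exact hs⟩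
      · rintro ⟨ρ, hρ, hs⟩
        rwa [e3 hρ] at hs
    · have e1 : ∃ f : ℕ → ℕ, ∀ n, V (F 0) (f (n+1)) (f n) := by
        by_contra hc; exact hw (hwf.2 hc)
      exact iff_of_true (fun hp => hw hp.1) (Or.inl e1)
  have ok (y : ℕ → ℕ) (hy : WellFounded (V y)) (j) (x b : El (MA A)) (hx : x.1 = col W j) (hb : b.1 = col (V y) (y 0)) :
      rz (MA A) θ (Fin.snoc (Fin.snoc xs x : Fin (n+2) → El (MA A)) b) ↔ sat (J y) (fun a b => col (J y) a = col (J y) b) θ (env y j) := by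
    have hw := j2_wf hW.1 hy
    have hJw : WellFounded (J y) := jn_wf hw
    have c0 k : col (J y) (Nat.pair 0 k) = col W k := by
      have := jn_col hw 0 k
      rwa [j2_0] at this
    have c1 k : col (J y) (Nat.pair 1 k) = col (V y) k := by
      have := jn_col hw 1 k
      rwa [j2_1] at this
    refine sat_ok MA_trans hJw (fun a b => Iff.rfl) hθ _ _ (env_snoc _ _ (env_snoc xs _ (fun i => ?_) x _ ?_) b _ ?_)
    · rw [appn_lt, hk, c0]
    · rw [hx, c0]
    · rw [hb, c1]
  have hall (j) : ∃ y, HF A y ∧ P y j := by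
    by_cases hj : W j k0
    · have hx : col W j ∈ MA A := mem_MA.2 ⟨W, j, hW, rfl⟩
      obtain ⟨b, hb⟩ := h ⟨_, hx⟩ (by rw [hk]; exact (mem_col hW.1).2 ⟨j, hj, rfl⟩)
      obtain ⟨U, l, hU, hl⟩ := mem_MA.1 b.2
      have hUi {t s} [ht : AF (Dl A) t] [hs : AF (Dl A) s] : Df (Dl A) fun F e => U (t F e) (s F e) := Df.sub2 (P := fun _ => U) hU.2 ht hs
      have hpi {t} [ht : AF (Dl A) t] : AF (Dl A) fun F e => Nat.pred (t F e) := AF.prim Primrec.pred ht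
      let y (p : ℕ) : ℕ := if p = 0 then l else if U (Nat.pred p).unpair.1 (Nat.pred p).unpair.2 then 0 else 1
      have hVU : V y = U := by
        funext a b; simp [V, y]
      refine ⟨y, (inferInstance : AF (Dl A) fun F e => if e 0 = 0 then l else if U (Nat.pred (e 0)).unpair.1 (Nat.pred (e 0)).unpair.2 then 0 else 1), hVU ▸ hU.1, fun _ => ?_⟩
      exact (ok y (hVU ▸ hU.1) j ⟨_, hx⟩ b rfl (by rw [hVU, hl]; rfl)).1 hb
    · exact ⟨fun _ => 1, (inferInstance : AF (Dl A) fun F e => 1), ⟨fun a => ⟨_, fun b hb => by simp [V] at hb⟩⟩, fun h => absurd h hj⟩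
  obtain ⟨Y, hY, hYP⟩ := kreisel hnP hall
  have hYi {t s} [ht : AF (Dl A) t] [hs : AF (Dl A) s] : AF (Dl A) fun F e => Y (t F e) (s F e) :=
    AF.mk2 (f := fun _ => Y) (hY.h.ren (push 2 (push 0 (push 1 fun _ => 0))) id) ht hs
  have hUw : HW A (jn fun j => V (Y j)) := jn_hw (fun j => (hYP j).1) (inferInstance : Df (Dl A) fun F e => Y (e 0) (Nat.pair (e 1) (e 2) + 1) = 0)
  obtain ⟨b, hb⟩ := setform hUw (Z := {z | z = Nat.pair z.unpair.1 (Y z.unpair.1 0)}) (inferInstance : Df (Dl A) fun F e => e 0 = Nat.pair (e 0).unpair.1 (Y (e 0).unpair.1 0))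
  refine ⟨b, fun x hx => ?_⟩
  rw [hk] at hx
  obtain ⟨j, hj, hxj⟩ := (mem_col hW.1).1 hx
  refine ⟨⟨col (V (Y j)) (Y j 0), ?_⟩, ?_, (ok (Y j) (hYP j).1 j x _ hxj rfl).2 ((hYP j).2 hj)⟩
  · exact mem_MA.2 ⟨_, Nat.pair j (Y j 0), hUw, (jn_col (fun j => (hYP j).1) j _).symm⟩
  · exact (hb _).2 ⟨Nat.pair j (Y j 0), by simp, (jn_col (fun j => (hYP j).1) j _).symm⟩
theorem MA_kp (A : Set ℕ) : KPs (MA A) where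
  ext x y h := by
    apply Subtype.ext
    ext z
    constructor
    · intro hz; exact (h ⟨z, MA_trans _ x.2 hz⟩).1 hz
    · intro hz; exact (h ⟨z, MA_trans _ y.2 hz⟩).2 hz
  emp := by
    obtain ⟨W, hW, ks, hk⟩ := join_fin (A := A) (n := 0) (fun i => i.elim0)
    obtain ⟨b, hb⟩ := setform hW (Z := ∅) (inferInstance : Df (Dl A) fun _ _ => False)
    exact ⟨b, fun y hy => by simpa using (hb _).1 hy⟩
  pair x y := by
    obtain ⟨W, hW, ks, hk⟩ := join_fin (A := A) ![x, y]
    obtain ⟨b, hb⟩ := setform hW (Z := Set.univ) (inferInstance : Df (Dl A) fun _ _ => True)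
    exact ⟨b, (hb _).2 ⟨ks 0, trivial, hk 0⟩, (hb _).2 ⟨ks 1, trivial, hk 1⟩⟩
  union x := by
    obtain ⟨W, hW, ks, hk⟩ := join_fin (A := A) ![x]
    obtain ⟨b, hb⟩ := setform hW (Z := Set.univ) (inferInstance : Df (Dl A) fun _ _ => True)
    refine ⟨b, fun z w hz hw => (hb _).2 ?_⟩
    have : x.1 = col W (ks 0) := hk 0
    rw [this] at hw
    obtain ⟨j, _, hj⟩ := (mem_col hW.1).1 hw
    rw [hj] at hz
    obtain ⟨i, _, hi⟩ := (mem_col hW.1).1 hz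
    exact ⟨i, trivial, hi⟩
  sep n θ hθ xs := MA_sep hθ xs
  coll n θ hθ xs h := MA_coll hθ xs h
theorem adm_iff (o : Ordinal.{0}) : Admissible o ↔ ∃ x : ZFSet.{0}, x.IsTransitive ∧ KPs x ∧ x.rank = o := by
  unfold Admissible
  refine exists_congr fun x => and_congr_right fun _ => and_congr (kp_iff x) ?_
  have : height x = Ordinal.lift.{1, 0} x.rank := by
    rw [ZFSet.rank_eq_wfRank]; rfl
  rw [this, Ordinal.lift_inj]
theorem adm_omega1 (A : Set ℕ) : Admissible (omega1 A) := by
  rw [adm_iff, omega1_eq]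
  exact ⟨MA A, MA_trans, MA_kp A, MA_rank⟩
class KM (M : ZFSet.{0}) : Prop where
  tr : M.IsTransitive
  kp : KPs M
abbrev EV (M : ZFSet.{0}) := ℕ → El M
section
variable {M : ZFSet.{0}}
inductive D0 : (EV M → Prop) → Prop
  | mem i j : D0 fun v => (v i).1 ∈ (v j).1
  | eq i j : D0 fun v => v i = v j
  | fls : D0 fun _ => False
  | imp {P Q} : D0 P → D0 Q → D0 fun v => P v → Q v
  | ball i {P} : D0 P → D0 fun v => ∀ x : El M, x.1 ∈ (v i).1 → P (push x v)
theorem D0.ren {P : EV M → Prop} (h : D0 P) : ∀ r : ℕ → ℕ, D0 fun v => P (fun i => v (r i)) := by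
  induction h with
  | mem i j => exact fun r => D0.mem _ _
  | eq i j => exact fun r => D0.eq _ _
  | fls => exact fun r => D0.fls
  | imp _ _ h1 h2 => exact fun r => D0.imp (h1 r) (h2 r)
  | @ball i P _ ih =>
    intro r
    have := D0.ball (r i) (ih (push 0 fun i => r i + 1))
    have e (v : EV M) (x) : (fun i => push x v (push 0 (fun i => r i + 1) i)) = push x fun i => v (r i) := by funext i; cases i <;> rfl
    simpa only [e] using this
theorem D0.form {P : EV M → Prop} (h : D0 P) : ∃ N, ∀ n, N ≤ n → ∃ θ : LS.BoundedFormula Empty n, IsDelta0S θ ∧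
    ∀ (xs : Fin n → El M) (v : EV M), (∀ i : Fin n, xs i = v (n - 1 - i)) → (rz M θ xs ↔ P v) := by
  have key {n} (xs : Fin n → El M) (v : EV M) (h : ∀ i : Fin n, xs i = v (n - 1 - i)) (i) (hi : i < n) : xs (tv (v' (n-1-i) (by omega) : LS.Term (Empty ⊕ Fin n))) = v i := by
    rw [h]; congr 1; simp only [v', tv]; omega
  induction h with
  | mem i j => exact ⟨i+j+1, fun n hn => ⟨_, IsDelta0S.mem (v' (n-1-i) (by omega)) (v' (n-1-j) (by omega)), fun xs v h => by
      rw [rz_mem, key xs v h i (by omega), key xs v h j (by omega)]⟩⟩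
  | eq i j => exact ⟨i+j+1, fun n hn => ⟨_, IsDelta0S.equal (v' (n-1-i) (by omega)) (v' (n-1-j) (by omega)), fun xs v h => by
      rw [rz_eq, key xs v h i (by omega), key xs v h j (by omega)]⟩⟩
  | fls => exact ⟨0, fun n hn => ⟨_, IsDelta0S.falsum, fun xs v h => rz_bot⟩⟩
  | imp _ _ h1 h2 =>
    obtain ⟨N1, h1⟩ := h1
    obtain ⟨N2, h2⟩ := h2
    refine ⟨N1+N2, fun n hn => ?_⟩
    obtain ⟨θ1, d1, h1⟩ := h1 n (by omega)
    obtain ⟨θ2, d2, h2⟩ := h2 n (by omega)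
    exact ⟨_, d1.imp d2, fun xs v h => by rw [rz_imp, h1 xs v h, h2 xs v h]⟩
  | ball i _ ih =>
    obtain ⟨N, ih⟩ := ih
    refine ⟨N+i+1, fun n hn => ?_⟩
    obtain ⟨θ, d, h1⟩ := ih (n+1) (by omega)
    refine ⟨_, IsDelta0S.ball (v' (n-1-i) (by omega)) d, fun xs v h => ?_⟩
    rw [rz_all]
    refine forall_congr' fun x => ?_
    rw [rz_imp, rz_mem]
    refine imp_congr ?_ (h1 _ _ fun k => ?_)
    · have := key xs v h i (by omega)
      rw [← this]
      simp only [v', Term.relabel, Sum.map, Sum.elim_inr, tv, Function.comp, Fin.snoc_castSucc, Fin.snoc_last]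
    · rcases Fin.eq_castSucc_or_eq_last k with ⟨j, rfl⟩ | rfl
      · rw [Fin.snoc_castSucc, h]
        have : n + 1 - 1 - (j.castSucc : ℕ) = (n - 1 - j) + 1 := by have := j.2; simp; omega
        rw [this]
      · rw [Fin.snoc_last]; simp
abbrev gt (v : EV M) (s : ℕ ⊕ El M) : El M := Sum.elim v id s
class D1 (P : EV M → Prop) : Prop where
  h : ∃ Q, D0 Q ∧ ∃ f : ℕ → ℕ ⊕ El M, ∀ v, P v ↔ Q fun n => gt v (f n)
class Tm (t : EV M → El M) : Prop where
  h : ∃ s, ∀ v, t v = gt v s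
instance Tm.var (i : ℕ) : Tm fun v : EV M => v i := ⟨⟨Sum.inl i, fun _ => rfl⟩⟩
theorem Tm.tail {t : EV M → El M} (h : Tm t) : Tm fun v => t fun i => v (i+1) := by
  obtain ⟨s, h⟩ := h.h
  exact ⟨s.map (· + 1) id, fun v => by rw [h]; cases s <;> rfl⟩
instance (priority := 500) Tm.const (c : El M) : Tm fun _ : EV M => c := ⟨⟨Sum.inr c, fun _ => rfl⟩⟩
theorem D1.congr {P Q : EV M → Prop} (h : D1 P) (h' : ∀ v, Q v ↔ P v) : D1 Q := by
  have : Q = P := by funext v; exact propext (h' v)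
  rw [this]; exact h
def sb (g : ℕ → ℕ ⊕ El M) : ℕ ⊕ El M → ℕ ⊕ El M := Sum.elim g Sum.inr
theorem gt_sb (v : EV M) (g s) : gt v (sb g s) = gt (fun i => gt v (g i)) s := by cases s <;> rfl
theorem D1.gsub {P : EV M → Prop} (h : D1 P) (g : ℕ → ℕ ⊕ El M) : D1 fun v => P fun i => gt v (g i) := by
  obtain ⟨Q, hQ, f, hf⟩ := h.h
  exact ⟨Q, hQ, fun n => sb g (f n), fun v => by rw [hf]; simp only [gt_sb]⟩
theorem D1.ren {P : EV M → Prop} (h : D1 P) (r : ℕ → ℕ) : D1 fun v => P fun i => v (r i) := h.gsub fun i => Sum.inl (r i)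
theorem push_eta {α : Type*} (v : ℕ → α) : push (v 0) (fun i => v (i+1)) = v := by funext i; cases i <;> rfl
theorem D1.sub {P : EV M → El M → Prop} {t} (h : D1 fun v => P (fun i => v (i+1)) (v 0)) (ht : Tm t) : D1 fun v => P v (t v) := by
  obtain ⟨s, hs⟩ := ht.h
  exact (h.gsub (push s Sum.inl)).congr fun v => by rw [hs]; rfl
theorem D1.sub2 {P : El M → El M → Prop} {t s} (h : D1 fun v => P (v 0) (v 1)) (ht : Tm t) (hs : Tm s) : D1 fun v => P (t v) (s v) := by
  obtain ⟨t', h1⟩ := ht.h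
  obtain ⟨s', h2⟩ := hs.h
  exact (h.gsub (push t' (push s' Sum.inl))).congr fun v => by rw [h1, h2]; rfl
theorem D1.sub3 {P : El M → El M → El M → Prop} {t s u} (h : D1 fun v => P (v 0) (v 1) (v 2)) (ht : Tm t) (hs : Tm s) (hu : Tm u) : D1 fun v => P (t v) (s v) (u v) := by
  obtain ⟨t', h1⟩ := ht.h
  obtain ⟨s', h2⟩ := hs.h
  obtain ⟨u', h3⟩ := hu.h
  exact (h.gsub (push t' (push s' (push u' Sum.inl)))).congr fun v => by rw [h1, h2, h3]; rfl
theorem D0.d1 {P : EV M → Prop} (h : D0 P) : D1 P := ⟨P, h, Sum.inl, fun _ => Iff.rfl⟩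
instance (priority := 2000) D1.fls : D1 fun _ : EV M => False := D0.fls.d1
instance (priority := 2000) D1.mem {t s : EV M → El M} [ht : Tm t] [hs : Tm s] : D1 fun v => (t v).1 ∈ (s v).1 :=
  D1.sub2 (P := fun x y => x.1 ∈ y.1) (D0.mem 0 1).d1 ht hs
instance (priority := 2000) D1.eq {t s : EV M → El M} [ht : Tm t] [hs : Tm s] : D1 fun v => t v = s v :=
  D1.sub2 (P := fun x y => x = y) (D0.eq 0 1).d1 ht hs
instance (priority := 2000) D1.imp {P Q : EV M → Prop} [h1 : D1 P] [h2 : D1 Q] : D1 fun v => P v → Q v := by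
  obtain ⟨P', d1, f, h1⟩ := h1.h
  obtain ⟨Q', d2, g, h2⟩ := h2.h
  refine ⟨_, (d1.ren fun n => 2 * n).imp (d2.ren fun n => 2 * n + 1), fun n => if n % 2 = 0 then f (n/2) else g (n/2), fun v => ?_⟩
  rw [h1, h2]
  have e1 n : (2 * n) / 2 = n := by omega
  have e2 n : (2 * n + 1) / 2 = n := by omega
  have e3 n : ¬ ((2 * n + 1) % 2 = 0) := by omega
  have e4 n : ((2 * n) % 2 = 0) := by omega
  simp only [e1, e2, e3, e4, if_true, if_false]
theorem D1.ball0 {P : EV M → Prop} (h : D1 P) (i : ℕ) : D1 fun v => ∀ x : El M, x.1 ∈ (v i).1 → P (push x v) := by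
  obtain ⟨Q, d, f, h⟩ := h.h
  refine ⟨_, D0.ball 0 (d.ren fun n => if f n = Sum.inl 0 then 0 else n + 2), push (Sum.inl i) fun n => sb (fun k => Sum.inl (k-1)) (f n), fun v => ?_⟩
  refine forall_congr' fun x => imp_congr Iff.rfl ?_
  rw [h]
  refine iff_of_eq (congrArg Q ?_)
  funext n
  rcases hf : f n with (_ | k) | c
  · simp
  · rw [if_neg (by simp)]; change _ = gt v (sb _ (f n)); rw [hf]; rfl
  · rw [if_neg (by simp)]; change _ = gt v (sb _ (f n)); rw [hf]; rfl
instance (priority := 2000) D1.ball {t : EV M → El M} [ht : Tm t] {P : EV M → El M → Prop} [h : D1 fun v => P (fun i => v (i+1)) (v 0)] :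
    D1 fun v => ∀ x : El M, x.1 ∈ (t v).1 → P v x := by
  obtain ⟨s, hs⟩ := ht.h
  have h2 := (D1.ball0 (h.ren (push 0 fun i => i+2)) 0).gsub (push s Sum.inl)
  refine h2.congr fun v => ?_
  rw [hs]; rfl
instance (priority := 2000) D1.not {P : EV M → Prop} [D1 P] : D1 fun v => ¬ P v := (inferInstance : D1 fun v => P v → False)
instance (priority := 2000) D1.and {P Q : EV M → Prop} [D1 P] [D1 Q] : D1 fun v => P v ∧ Q v :=
  (inferInstance : D1 fun v => ¬ (P v → ¬ Q v)).congr fun _ => by tauto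
instance (priority := 2000) D1.or {P Q : EV M → Prop} [D1 P] [D1 Q] : D1 fun v => P v ∨ Q v :=
  (inferInstance : D1 fun v => (¬ P v → Q v)).congr fun _ => by tauto
instance (priority := 2000) D1.iff {P Q : EV M → Prop} [D1 P] [D1 Q] : D1 fun v => P v ↔ Q v :=
  (inferInstance : D1 fun v => (P v → Q v) ∧ (Q v → P v)).congr fun _ => by tauto
instance (priority := 2000) D1.bex {t : EV M → El M} [ht : Tm t] {P : EV M → El M → Prop} [h : D1 fun v => P (fun i => v (i+1)) (v 0)] :
    D1 fun v => ∃ x : El M, x.1 ∈ (t v).1 ∧ P v x :=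
  (inferInstance : D1 fun v => ¬ ∀ x : El M, x.1 ∈ (t v).1 → ¬ P v x).congr fun _ => by simp
section
variable [hM : KM M]
theorem sep1 {P : EV M → Prop} (h : D1 P) (v : EV M) (a : El M) : ∃ b : El M, ∀ x : El M, x.1 ∈ b.1 ↔ x.1 ∈ a.1 ∧ P (push x v) := by
  obtain ⟨Q, d, f, h⟩ := h.h
  obtain ⟨N, hN⟩ := (d.ren fun n => if f n = Sum.inl 0 then 0 else n + 2).form
  obtain ⟨θ, dθ, hθ⟩ := hN (N+2) (by omega)
  let u : EV M := push a fun n => gt (push a v) (f n)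
  obtain ⟨b, hb⟩ := hM.kp.sep N θ dθ fun i => u (N - i)
  refine ⟨b, fun x => ?_⟩
  rw [hb x, hθ _ (push x u)]
  · simp only [Fin.val_last, Nat.sub_self]
    refine and_congr Iff.rfl ?_
    rw [h]
    refine iff_of_eq (congrArg Q ?_)
    funext n
    rcases hf : f n with (_ | k) | c
    · simp
    · rw [if_neg (by simp)]; change gt (push a v) (f n) = _; rw [hf]; rfl
    · rw [if_neg (by simp)]; change gt (push a v) (f n) = _; rw [hf]; rfl
  · intro k
    rcases Fin.eq_castSucc_or_eq_last k with ⟨j, rfl⟩ | rfl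
    · rw [Fin.snoc_castSucc]
      have : N + 2 - 1 - (j.castSucc : ℕ) = (N - j) + 1 := by have := j.2; simp; omega
      rw [this]
    · rw [Fin.snoc_last]; simp
theorem coll1 {P : EV M → Prop} (h : D1 P) (v : EV M) (a : El M) (H : ∀ x : El M, x.1 ∈ a.1 → ∃ y, P (push y (push x v))) :
    ∃ b : El M, ∀ x : El M, x.1 ∈ a.1 → ∃ y : El M, y.1 ∈ b.1 ∧ P (push y (push x v)) := by
  obtain ⟨Q, d, f, h⟩ := h.h
  obtain ⟨N, hN⟩ := (d.ren fun n => if f n = Sum.inl 0 then 0 else if f n = Sum.inl 1 then 1 else n + 3).form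
  obtain ⟨θ, dθ, hθ⟩ := hN (N+3) (by omega)
  let u : EV M := push a fun n => gt (push a (push a v)) (f n)
  have key (x y : El M) : rz M θ (Fin.snoc (Fin.snoc (fun i : Fin (N+1) => u (N - i)) x : Fin (N+2) → El M) y) ↔ P (push y (push x v)) := by
    rw [hθ _ (push y (push x u)), h]
    · refine iff_of_eq (congrArg Q ?_)
      funext n
      rcases hf : f n with (_ | _ | k) | c
      · simp
      · simp
      · rw [if_neg (by simp), if_neg (by simp)]; change gt (push a (push a v)) (f n) = _; rw [hf]; rfl
      · rw [if_neg (by simp), if_neg (by simp)]; change gt (push a (push a v)) (f n) = _; rw [hf]; rfl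
    · intro k
      rcases Fin.eq_castSucc_or_eq_last k with ⟨j, rfl⟩ | rfl
      · rw [Fin.snoc_castSucc]
        rcases Fin.eq_castSucc_or_eq_last j with ⟨l, rfl⟩ | rfl
        · rw [Fin.snoc_castSucc]
          have : N + 3 - 1 - (l.castSucc.castSucc : ℕ) = (N - l) + 2 := by have := l.2; simp; omega
          rw [this]
        · rw [Fin.snoc_last]
          have : N + 3 - 1 - ((Fin.last (N+1)).castSucc : ℕ) = 1 := by simp
          rw [this]; rfl
      · rw [Fin.snoc_last]; simp
  have := hM.kp.coll N θ dθ fun i => u (N - i)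
  simp only [key, Fin.val_last, Nat.sub_self] at this
  exact this H
theorem El.tr {x : ZFSet} {a : El M} (h : x ∈ a.1) : x ∈ M := hM.tr _ a.2 h
theorem El.ext' {a b : El M} (h : ∀ x : El M, x.1 ∈ a.1 ↔ x.1 ∈ b.1) : a = b := hM.kp.ext a b h
theorem ex_pair (a b : El M) : ∃ c : El M, c.1 = {a.1, b.1} := by
  obtain ⟨z, h1, h2⟩ := hM.kp.pair a b
  obtain ⟨c, hc⟩ := sep1 (P := fun v => v 0 = a ∨ v 0 = b) inferInstance (fun _ => a) z
  refine ⟨c, ZFSet.ext fun x => ?_⟩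
  rw [ZFSet.mem_pair]
  constructor
  · intro h
    have := ((hc ⟨x, El.tr h⟩).1 h).2
    simpa [Subtype.ext_iff] using this
  · rintro (rfl | rfl)
    · exact (hc a).2 ⟨h1, Or.inl rfl⟩
    · exact (hc b).2 ⟨h2, Or.inr rfl⟩
theorem ex_un (a : El M) : ∃ c : El M, c.1 = ZFSet.sUnion a.1 := by
  obtain ⟨z, h1⟩ := hM.kp.union a
  obtain ⟨c, hc⟩ := sep1 (P := fun v => ∃ y : El M, y.1 ∈ a.1 ∧ (v 0).1 ∈ y.1) inferInstance (fun _ => a) z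
  refine ⟨c, ZFSet.ext fun x => ?_⟩
  rw [ZFSet.mem_sUnion]
  constructor
  · intro h
    obtain ⟨y, h1, h2⟩ := ((hc ⟨x, El.tr h⟩).1 h).2
    exact ⟨y, h1, h2⟩
  · rintro ⟨y, h2, h3⟩
    have hy := El.tr h2
    have hx := El.tr (a := ⟨y, hy⟩) h3
    exact (hc ⟨x, hx⟩).2 ⟨h1 ⟨x, hx⟩ ⟨y, hy⟩ h3 h2, ⟨y, hy⟩, h2, h3⟩
noncomputable def up (a b : El M) : El M := (ex_pair a b).choose
noncomputable def un (a : El M) : El M := (ex_un a).choose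
theorem up_1 (a b : El M) : (up a b).1 = {a.1, b.1} := (ex_pair a b).choose_spec
theorem un_1 (a : El M) : (un a).1 = ZFSet.sUnion a.1 := (ex_un a).choose_spec
noncomputable def pr (a b : El M) : El M := up (up a a) (up a b)
theorem pr_1 (a b : El M) : (pr a b).1 = ZFSet.pair a.1 b.1 := by simp [pr, up_1, ZFSet.pair]
theorem pr_inj {a b c d : El M} : pr a b = pr c d ↔ a = c ∧ b = d := by
  rw [Subtype.ext_iff, pr_1, pr_1, ZFSet.pair_inj, Subtype.ext_iff, Subtype.ext_iff]
theorem up_iff {a b c : El M} : c = up a b ↔ a.1 ∈ c.1 ∧ b.1 ∈ c.1 ∧ ∀ x : El M, x.1 ∈ c.1 → x = a ∨ x = b := by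
  constructor
  · rintro rfl; simp [up_1, Subtype.val_inj]
  · rintro ⟨h1, h2, h3⟩
    refine El.ext' fun x => ⟨fun h => ?_, fun h => ?_⟩
    · have := h3 x h; simpa [up_1, Subtype.val_inj] using this
    · simp only [up_1, ZFSet.mem_pair, ← Subtype.ext_iff] at h
      rcases h with rfl | rfl <;> assumption
instance (priority := 2100) D1.upi {t s u : EV M → El M} [ht : Tm t] [hs : Tm s] [hu : Tm u] : D1 fun v => t v = up (s v) (u v) :=
  D1.sub3 (P := fun c a b => c = up a b) ((inferInstance : D1 fun v : EV M => (v 1).1 ∈ (v 0).1 ∧ (v 2).1 ∈ (v 0).1 ∧ ∀ x : El M, x.1 ∈ (v 0).1 → x = v 1 ∨ x = v 2).congr fun v => up_iff) ht hs hu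
instance (priority := 2100) D1.pri {t s u : EV M → El M} [ht : Tm t] [hs : Tm s] [hu : Tm u] : D1 fun v => t v = pr (s v) (u v) := by
  refine D1.sub3 (P := fun c a b => c = pr a b) ((inferInstance : D1 fun v : EV M => ∃ x : El M, x.1 ∈ (v 0).1 ∧ (∃ y : El M, y.1 ∈ (v 0).1 ∧ (x = up (v 1) (v 1) ∧ y = up (v 1) (v 2) ∧ v 0 = up x y))).congr fun v => ?_) ht hs hu
  constructor
  · intro h; exact ⟨up (v 1) (v 1), by rw [h]; simp [SpectorRankFormalization.pr, up_1], up (v 1) (v 2), by rw [h]; simp [SpectorRankFormalization.pr, up_1], rfl, rfl, h⟩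
  · rintro ⟨x, _, y, _, rfl, rfl, h⟩; exact h
instance (priority := 2100) D1.prm {t s u : EV M → El M} [ht : Tm t] [hs : Tm s] [hu : Tm u] : D1 fun v => (pr (s v) (u v)).1 ∈ (t v).1 :=
  D1.sub3 (P := fun c a b => (pr a b).1 ∈ c.1) ((inferInstance : D1 fun v : EV M => ∃ x : El M, x.1 ∈ (v 0).1 ∧ x = pr (v 1) (v 2)).congr fun v => by simp) ht hs hu
class Si (P : EV M → Prop) : Prop where
  h : ∃ Q, D1 Q ∧ ∀ v, P v ↔ ∃ x, Q (push x v)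
theorem Si.congr {P Q : EV M → Prop} (h : Si P) (h' : ∀ v, Q v ↔ P v) : Si Q := by
  have : Q = P := by funext v; exact propext (h' v)
  rw [this]; exact h
instance (priority := 100) Si.d1 {P : EV M → Prop} [h : D1 P] : Si P := ⟨_, h.ren fun i => i+1, fun v => ⟨fun h => ⟨v 0, h⟩, fun ⟨_, h⟩ => h⟩⟩
theorem Si.gsub {P : EV M → Prop} (h : Si P) (g : ℕ → ℕ ⊕ El M) : Si fun v => P fun i => gt v (g i) := by
  obtain ⟨Q, hQ, h⟩ := h.h
  refine ⟨_, hQ.gsub (push (Sum.inl 0) fun i => (g i).map (· + 1) id), fun v => ?_⟩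
  rw [h]
  refine exists_congr fun x => iff_of_eq (congrArg Q ?_)
  funext i
  cases i with
  | zero => rfl
  | succ i =>
    change gt v (g i) = gt (push x v) ((g i).map (· + 1) id)
    rcases g i with k | c <;> rfl
theorem Si.ren {P : EV M → Prop} (h : Si P) (r : ℕ → ℕ) : Si fun v => P fun i => v (r i) := h.gsub fun i => Sum.inl (r i)
theorem Si.sub {P : El M → Prop} {t} (h : Si fun v => P (v 0)) (ht : Tm t) : Si fun v => P (t v) := by
  obtain ⟨s, hs⟩ := ht.h
  exact (h.gsub (push s Sum.inl)).congr fun v => by rw [hs]; rfl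
theorem Si.sub2 {P : El M → El M → Prop} {t s} (h : Si fun v => P (v 0) (v 1)) (ht : Tm t) (hs : Tm s) : Si fun v => P (t v) (s v) := by
  obtain ⟨t', h1⟩ := ht.h
  obtain ⟨s', h2⟩ := hs.h
  exact (h.gsub (push t' (push s' Sum.inl))).congr fun v => by rw [h1, h2]; rfl
theorem Si.ex2 {Q : EV M → Prop} (h : D1 Q) : Si fun v => ∃ x y, Q (push y (push x v)) := by
  have h' : D1 fun v => Q (push (v 0) (push (v 1) fun i => v (i + 3))) := (h.ren (push 0 (push 1 fun i => i + 3))).congr fun v => iff_of_eq (congrArg Q (by funext i; rcases i with _ | _ | i <;> rfl))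
  refine ⟨fun v => ∃ x : El M, x.1 ∈ (v 0).1 ∧ ∃ y : El M, y.1 ∈ (v 0).1 ∧ Q (push y (push x fun i => v (i+1))), inferInstance, fun v => ⟨?_, ?_⟩⟩
  · rintro ⟨x, y, h⟩; exact ⟨up x y, x, by simp [up_1], y, by simp [up_1], h⟩
  · rintro ⟨w, x, _, y, _, h⟩; exact ⟨x, y, h⟩
instance (priority := 1000) Si.ex {P : EV M → El M → Prop} [h : Si fun v => P (fun i => v (i+1)) (v 0)] : Si fun v => ∃ x, P v x := by
  obtain ⟨Q, hQ, h⟩ := h.h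
  exact (Si.ex2 hQ).congr fun v => exists_congr fun x => h (push x v)
instance (priority := 1000) Si.and {P Q : EV M → Prop} [h1 : Si P] [h2 : Si Q] : Si fun v => P v ∧ Q v := by
  obtain ⟨P', hP, h1⟩ := h1.h
  obtain ⟨Q', hQ, h2⟩ := h2.h
  have a := hP.ren (push 0 fun i => i + 2)
  have b := hQ.ren (fun i => i + 1)
  refine (Si.ex2 (Q := fun v => P' (fun i => v (push 0 (fun i => i + 2) i)) ∧ Q' fun i => v (i + 1)) inferInstance).congr fun v => ?_
  rw [h1, h2]
  have e (x y : El M) : (fun i => push y (push x v) (push 0 (fun i => i + 2) i)) = push y v := by funext i; cases i <;> rfl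
  simp only [e]
  constructor
  · rintro ⟨⟨y, hy⟩, x, hx⟩; exact ⟨x, y, hy, hx⟩
  · rintro ⟨x, y, hy, hx⟩; exact ⟨⟨y, hy⟩, x, hx⟩
instance (priority := 1000) Si.or {P Q : EV M → Prop} [h1 : Si P] [h2 : Si Q] : Si fun v => P v ∨ Q v := by
  obtain ⟨P', hP, h1⟩ := h1.h
  obtain ⟨Q', hQ, h2⟩ := h2.h
  exact ⟨_, (inferInstance : D1 fun v => P' v ∨ Q' v), fun v => by rw [h1, h2, exists_or]⟩
instance (priority := 1000) Si.imp {P Q : EV M → Prop} [h1 : D1 P] [h2 : Si Q] : Si fun v => P v → Q v :=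
  (inferInstance : Si fun v => ¬ P v ∨ Q v).congr fun _ => imp_iff_not_or
instance (priority := 1000) Si.ball {t : EV M → El M} [ht : Tm t] {P : EV M → El M → Prop} [h : Si fun v => P (fun i => v (i+1)) (v 0)] :
    Si fun v => ∀ x : El M, x.1 ∈ (t v).1 → P v x := by
  obtain ⟨Q, hQ, h⟩ := h.h
  obtain ⟨s, hs⟩ := ht.h
  have h' : D1 fun v => Q (push (v 0) (push (v 1) fun i => v (i + 4))) := (hQ.ren (push 0 (push 1 fun i => i + 4))).congr fun v => iff_of_eq (congrArg Q (by funext i; rcases i with _ | _ | i <;> rfl))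
  have h2 : Si fun v => ∃ b : El M, ∀ x : El M, x.1 ∈ (v 0).1 → ∃ y : El M, y.1 ∈ b.1 ∧ Q (push y (push x fun i => v (i+1))) := inferInstance
  refine (h2.gsub (push s Sum.inl)).congr fun v => ?_
  have e := fun x => h (push x v)
  change (∀ x, P v x ↔ _) at e
  simp only [e, hs]
  exact ⟨fun h => coll1 hQ v _ h, fun ⟨b, h⟩ x hx => let ⟨y, _, h⟩ := h x hx; ⟨y, h⟩⟩
instance (priority := 1000) Si.bex {t : EV M → El M} [ht : Tm t] {P : EV M → El M → Prop} [h : Si fun v => P (fun i => v (i+1)) (v 0)] :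
    Si fun v => ∃ x : El M, x.1 ∈ (t v).1 ∧ P v x :=
  Si.ex (P := fun v x => x.1 ∈ (t v).1 ∧ P v x) (h := Si.and (h1 := Si.d1 (h := D1.mem (ht := Tm.var 0) (hs := ht.tail))))
theorem coll2 {P : El M → El M → Prop} (h : Si fun v => P (v 0) (v 1)) (a : El M) (H : ∀ x : El M, x.1 ∈ a.1 → ∃ y, P x y) :
    ∃ b : El M, (∀ x : El M, x.1 ∈ a.1 → ∃ y : El M, y.1 ∈ b.1 ∧ P x y) ∧ ∀ y : El M, y.1 ∈ b.1 → ∃ x : El M, x.1 ∈ a.1 ∧ P x y := by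
  obtain ⟨Q, hQ, h⟩ := h.h
  have e x y : P x y ↔ ∃ z, Q (push z (push x (push y fun _ => a))) := h (push x (push y fun _ => a))
  have hq : D1 fun v => Q (push (v 0) (push (v 1) (push (v 2) fun _ => a))) := (hQ.gsub (push (Sum.inl 0) (push (Sum.inl 1) (push (Sum.inl 2) fun _ => Sum.inr a)))).congr fun v => iff_of_eq (congrArg Q (by funext i; rcases i with _ | _ | _ | i <;> rfl))
  have hq' {t s u : EV M → El M} [ht : Tm t] [hs : Tm s] [hu : Tm u] : D1 fun v => Q (push (t v) (push (s v) (push (u v) fun _ => a))) := D1.sub3 (P := fun x y z => Q (push x (push y (push z fun _ => a)))) hq ht hs hu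
  obtain ⟨c, hc⟩ := coll1 (P := fun v => ∃ y : El M, y.1 ∈ (v 0).1 ∧ ∃ z : El M, z.1 ∈ (v 0).1 ∧ Q (push z (push (v 1) (push y fun _ => a)))) inferInstance (fun _ => a) a fun x hx => by
    obtain ⟨y, hy⟩ := H x hx
    obtain ⟨z, hz⟩ := (e x y).1 hy
    exact ⟨up y z, y, by simp [up_1], z, by simp [up_1], hz⟩
  obtain ⟨b, hb⟩ := sep1 (P := fun v => ∃ x : El M, x.1 ∈ a.1 ∧ ∃ w : El M, w.1 ∈ c.1 ∧ ∃ z : El M, z.1 ∈ w.1 ∧ Q (push z (push x (push (v 0) fun _ => a)))) inferInstance (fun _ => a) (un c)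
  refine ⟨b, fun x hx => ?_, fun y hy => ?_⟩
  · obtain ⟨w, hw, y, hy, z, hz, hQ⟩ := hc x hx
    exact ⟨y, (hb y).2 ⟨by rw [un_1, ZFSet.mem_sUnion]; exact ⟨_, hw, hy⟩, x, hx, w, hw, z, hz, hQ⟩, (e x y).2 ⟨z, hQ⟩⟩
  · obtain ⟨-, x, hx, w, hw, z, hz, hQ⟩ := (hb y).1 hy
    exact ⟨x, hx, (e x y).2 ⟨z, hQ⟩⟩
end
end
section
variable {M : ZFSet.{0}}
inductive Ind (R : El M → El M → Prop) : El M → Prop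
  | mk (p s : El M) : R p s → (∀ q : El M, q.1 ∈ s.1 → Ind R q) → Ind R p
variable [hM : KM M]
theorem mem_un {x a : El M} : x.1 ∈ (un a).1 ↔ ∃ y : El M, y.1 ∈ a.1 ∧ x.1 ∈ y.1 := by
  rw [un_1, ZFSet.mem_sUnion]
  exact ⟨fun ⟨y, h1, h2⟩ => ⟨⟨y, El.tr h1⟩, h1, h2⟩, fun ⟨y, h1, h2⟩ => ⟨y.1, h1, h2⟩⟩
theorem mem_up {x a b : El M} : x.1 ∈ (up a b).1 ↔ x = a ∨ x = b := by simp [up_1, Subtype.val_inj]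
noncomputable def ins (x y : El M) : El M := un (up (up x x) y)
theorem mem_ins {z x y : El M} : z.1 ∈ (ins x y).1 ↔ z = x ∨ z.1 ∈ y.1 := by
  rw [ins, mem_un]
  constructor
  · rintro ⟨w, h1, h2⟩
    rcases mem_up.1 h1 with rfl | rfl
    · left; simpa [mem_up] using h2
    · exact Or.inr h2
  · rintro (rfl | h)
    · exact ⟨_, mem_up.2 (Or.inl rfl), mem_up.2 (Or.inl rfl)⟩
    · exact ⟨_, mem_up.2 (Or.inr rfl), h⟩
instance (priority := 2100) D1.insi {t s u : EV M → El M} [ht : Tm t] [hs : Tm s] [hu : Tm u] : D1 fun v => t v = ins (s v) (u v) := by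
  refine D1.sub3 (P := fun c a b => c = ins a b) ((inferInstance : D1 fun v : EV M => (v 1).1 ∈ (v 0).1 ∧ (∀ x : El M, x.1 ∈ (v 2).1 → x.1 ∈ (v 0).1) ∧ ∀ x : El M, x.1 ∈ (v 0).1 → x = v 1 ∨ x.1 ∈ (v 2).1).congr fun v => ?_) ht hs hu
  constructor
  · intro h; rw [h]; simp only [mem_ins]; tauto
  · rintro ⟨h1, h2, h3⟩
    refine El.ext' fun x => ?_
    rw [mem_ins]
    exact ⟨h3 x, by rintro (rfl | h); exacts [h1, h2 x h]⟩
theorem El.ind {P : El M → Prop} (h : ∀ x : El M, (∀ y : El M, y.1 ∈ x.1 → P y) → P x) (x : El M) : P x := by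
  obtain ⟨x, hx⟩ := x
  induction x using ZFSet.inductionOn with
  | _ x ih => exact h _ fun y hy => ih y.1 hy y.2
def Vd (R : El M → El M → Prop) (d : El M) : Prop := ∀ z : El M, z.1 ∈ d.1 → ∃ x y, z = pr x y ∧ ∃ s, R x s ∧ ∀ q : El M, q.1 ∈ s.1 → ∃ y' : El M, y'.1 ∈ y.1 ∧ (pr q y').1 ∈ d.1
theorem Vd.ok {R : El M → El M → Prop} {d : El M} (h : Vd R d) {x y : El M} (hxy : (pr x y).1 ∈ d.1) : ∃ s, R x s ∧ ∀ q : El M, q.1 ∈ s.1 → ∃ y' : El M, y'.1 ∈ y.1 ∧ (pr q y').1 ∈ d.1 := by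
  obtain ⟨x', y', e, h⟩ := h _ hxy
  obtain ⟨rfl, rfl⟩ := pr_inj.1 e
  exact h
theorem Vd.ind {R : El M → El M → Prop} {d : El M} (h : Vd R d) : ∀ y x : El M, (pr x y).1 ∈ d.1 → Ind R x := by
  refine El.ind fun y ih x hx => ?_
  obtain ⟨s, h1, h2⟩ := h.ok hx
  refine ⟨_, s, h1, fun q hq => ?_⟩
  obtain ⟨y', h3, h4⟩ := h2 q hq
  exact ih y' h3 q h4
theorem Vd.si {R : El M → El M → Prop} (h : Si fun v => R (v 0) (v 1)) : Si fun v => Vd R (v 0) := by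
  have h' {t s : EV M → El M} [ht : Tm t] [hs : Tm s] : Si fun v => R (t v) (s v) := Si.sub2 h ht hs
  unfold Vd; infer_instance
theorem ind_iff {R : El M → El M → Prop} (h : Si fun v => R (v 0) (v 1)) (x : El M) : Ind R x ↔ ∃ d y, Vd R d ∧ (pr x y).1 ∈ d.1 := by
  refine ⟨fun hx => ?_, fun ⟨d, y, h1, h2⟩ => h1.ind y x h2⟩
  have h' {t : EV M → El M} [ht : Tm t] : Si fun v => Vd R (t v) := Si.sub (Vd.si h) ht
  induction hx with
  | mk p s hps _ ih =>
    obtain ⟨D, h1, h2⟩ := coll2 (P := fun x d => Vd R d ∧ ∃ y, (pr x y).1 ∈ d.1) inferInstance s fun q hq => let ⟨d, y, a, b⟩ := ih q hq; ⟨d, a, y, b⟩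
    let U := un D
    let Y := un (un U)
    have hY q y (hq : (pr q y).1 ∈ U.1) : y.1 ∈ Y.1 := mem_un.2 ⟨up q y, mem_un.2 ⟨pr q y, hq, mem_up.2 (Or.inr rfl)⟩, mem_up.2 (Or.inr rfl)⟩
    refine ⟨ins (pr p Y) U, Y, fun z hz => ?_, mem_ins.2 (Or.inl rfl)⟩
    rcases mem_ins.1 hz with rfl | hz
    · refine ⟨p, Y, rfl, s, hps, fun q hq => ?_⟩
      obtain ⟨d, hd, -, y, hy⟩ := h1 q hq
      have := mem_un.2 ⟨d, hd, hy⟩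
      exact ⟨y, hY q y this, mem_ins.2 (Or.inr this)⟩
    · obtain ⟨d, hd, hz⟩ := mem_un.1 hz
      obtain ⟨-, -, v, -⟩ := h2 d hd
      obtain ⟨x, y, e, s', h3, h4⟩ := v z hz
      refine ⟨x, y, e, s', h3, fun q hq => ?_⟩
      obtain ⟨y', h5, h6⟩ := h4 q hq
      exact ⟨y', h5, mem_ins.2 (Or.inr (mem_un.2 ⟨d, hd, h6⟩))⟩
theorem ind_si {R : El M → El M → Prop} (h : Si fun v => R (v 0) (v 1)) {t : EV M → El M} [ht : Tm t] : Si fun v => Ind R (t v) := by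
  have h' {t : EV M → El M} [ht : Tm t] : Si fun v => Vd R (t v) := Si.sub (Vd.si h) ht
  exact Si.sub (P := Ind R) ((inferInstance : Si fun v => ∃ d y, Vd R d ∧ (pr (v 0) y).1 ∈ d.1).congr fun v => ind_iff h _) ht
-- ordinals
instance (priority := 2100) D1.ordi {t : EV M → El M} [ht : Tm t] : D1 fun v => (t v).1.IsOrdinal := by
  refine D1.sub (P := fun _ x => x.1.IsOrdinal) ((inferInstance : D1 fun v => (∀ x : El M, x.1 ∈ (v 0).1 → ∀ y : El M, y.1 ∈ x.1 → y.1 ∈ (v 0).1) ∧ ∀ x : El M, x.1 ∈ (v 0).1 → ∀ y : El M, y.1 ∈ x.1 → ∀ z : El M, z.1 ∈ y.1 → z.1 ∈ x.1).congr fun v => ?_) ht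
  constructor
  · intro h
    exact ⟨fun x hx y hy => h.isTransitive _ hx hy, fun x hx y hy z hz => h.mem_trans' hz hy hx⟩
  · rintro ⟨h1, h2⟩
    refine ⟨fun x hx y hy => ?_, fun {y z w} hy hz hw => ?_⟩
    · have a := El.tr hx
      exact h1 ⟨x, a⟩ hx ⟨y, El.tr (a := ⟨x, a⟩) hy⟩ hy
    · have a := El.tr hw
      have b := El.tr (a := ⟨w, a⟩) hz
      exact h2 ⟨w, a⟩ hw ⟨z, b⟩ hz ⟨y, El.tr (a := ⟨z, b⟩) hy⟩ hy
def rkR (w s : El M) : Prop := ∃ z y, w = pr z y ∧ y.1.IsOrdinal ∧ ∀ z' : El M, z'.1 ∈ z.1 → ∃ y' : El M, y'.1 ∈ y.1 ∧ (pr z' y').1 ∈ s.1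
theorem rkR_si : Si fun v : EV M => rkR (v 0) (v 1) := by unfold rkR; infer_instance
theorem rkR_ok {w : El M} (h : Ind rkR w) : ∀ z y, w = pr z y → y.1.IsOrdinal ∧ z.1.rank ≤ y.1.rank := by
  induction h with
  | mk p s hp _ ih =>
    rintro z y rfl
    obtain ⟨z', y', e, h1, h2⟩ := hp
    obtain ⟨rfl, rfl⟩ := pr_inj.1 e
    refine ⟨h1, ZFSet.rank_le_iff.2 fun x hx => ?_⟩
    obtain ⟨y', h3, h4⟩ := h2 ⟨x, El.tr hx⟩ hx
    exact (ih _ h4 _ _ rfl).2.trans_lt (ZFSet.rank_lt_of_mem h3)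
theorem rk_ex : ∀ z : El M, ∃ y, Ind rkR (pr z y) := by
  have hs := @ind_si M _ _ rkR_si
  have h1 {t s : EV M → El M} [ht : Tm t] [hs' : Tm s] : Si fun v => Ind rkR (pr (t v) (s v)) :=
    Si.sub2 (P := fun x y => Ind rkR (pr x y)) ((inferInstance : Si fun v => ∃ w, w = pr (v 0) (v 1) ∧ Ind rkR w).congr fun v => by simp) ht hs'
  refine El.ind fun z ih => ?_
  obtain ⟨b, hb, hb'⟩ := coll2 (P := fun z y => Ind rkR (pr z y)) inferInstance z ih
  obtain ⟨s, h3, h4⟩ := coll2 (P := fun z' q => ∃ y' : El M, y'.1 ∈ b.1 ∧ q = pr z' y' ∧ Ind rkR q) inferInstance z fun x hx => let ⟨y, h1, h2⟩ := hb x hx; ⟨_, y, h1, rfl, h2⟩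
  have ho (y : El M) (hy : y.1 ∈ b.1) : y.1.IsOrdinal := let ⟨x, _, h⟩ := hb' y hy; (rkR_ok h _ _ rfl).1
  let Y := un (up b (un b))
  have mY {x} : x ∈ Y.1 ↔ x ∈ b.1 ∨ ∃ y ∈ b.1, x ∈ y := by
    rw [un_1, up_1, un_1]; simp [ZFSet.mem_sUnion]
  have hY : Y.1.IsOrdinal := by
    refine ⟨fun x hx y hy => mY.2 ?_, fun {y z w} hy hz hw => ?_⟩
    · rcases mY.1 hx with h | ⟨u, h1, h2⟩
      · exact Or.inr ⟨x, h, hy⟩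
      · exact Or.inr ⟨u, h1, (ho ⟨u, El.tr h1⟩ h1).isTransitive _ h2 hy⟩
    · rcases mY.1 hw with h | ⟨u, h1, h2⟩
      · exact (ho ⟨w, El.tr h⟩ h).isTransitive _ hz hy
      · exact (ho ⟨u, El.tr h1⟩ h1).mem_trans' hy hz h2
  refine ⟨Y, .mk _ s ⟨z, Y, rfl, hY, fun z' hz' => ?_⟩ fun q hq => ?_⟩
  · obtain ⟨q, hq, y', h5, rfl, h6⟩ := h3 z' hz'
    exact ⟨y', mY.2 (Or.inl h5), hq⟩
  · obtain ⟨_, _, _, _, _, h⟩ := h4 q hq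
    exact h
theorem ord_mem {o : Ordinal} (h : o < M.rank) : o.toZFSet ∈ M := by
  obtain ⟨z, hz, h⟩ := ZFSet.lt_rank_iff.1 h
  obtain ⟨y, hy⟩ := rk_ex ⟨z, hz⟩
  obtain ⟨h1, h2⟩ := rkR_ok hy _ _ rfl
  have e := h1.toZFSet_rank_eq
  rcases (h.trans h2).lt_or_eq with h3 | h3
  · exact El.tr (a := y) (by rw [← e]; exact Ordinal.toZFSet_mem_toZFSet_iff.2 h3)
  · rw [h3, e]; exact y.2
theorem M_emp : (∅ : ZFSet) ∈ M := by
  obtain ⟨x, hx⟩ := hM.kp.emp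
  have : x.1 = ∅ := (ZFSet.eq_empty _).2 fun y hy => hx ⟨y, El.tr hy⟩ hy
  rw [← this]; exact x.2
noncomputable def on (M : ZFSet.{0}) [hM : KM M] (o : Ordinal.{0}) : El M := if h : o.toZFSet ∈ M then ⟨_, h⟩ else ⟨∅, M_emp⟩
theorem on_1 {o : Ordinal} (h : o < M.rank) : (on M o).1 = o.toZFSet := by rw [on, dif_pos (ord_mem h)]
theorem mem_on {o : Ordinal} (h : o < M.rank) {x : El M} : x.1 ∈ (on M o).1 ↔ ∃ o' < o, x = on M o' := by
  rw [on_1 h, Ordinal.mem_toZFSet_iff]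
  refine exists_congr fun o' => and_congr_right fun h' => ?_
  rw [Subtype.ext_iff, on_1 (h'.trans h), eq_comm]
theorem on_inj {o p : Ordinal} (h : o < M.rank) (h' : p < M.rank) : on M o = on M p ↔ o = p := by
  rw [Subtype.ext_iff, on_1 h, on_1 h', Ordinal.toZFSet_injective.eq_iff]
theorem ord_on {x : El M} (h : x.1.IsOrdinal) : ∃ o < M.rank, x = on M o := by
  have := ZFSet.rank_lt_of_mem x.2
  exact ⟨x.1.rank, this, Subtype.ext (by rw [on_1 this, h.toZFSet_rank_eq])⟩
theorem M_lim {o : Ordinal} (h : o < M.rank) : o + 1 < M.rank := by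
  have := ZFSet.rank_lt_of_mem (up (on M o) (on M o)).2
  rwa [up_1, ZFSet.rank_pair, on_1 h, Ordinal.rank_toZFSet, max_self] at this
end
class KO (M : ZFSet.{0}) : Prop extends KM M where
  om : Ordinal.omega0 < M.rank
abbrev Pos := List (ℕ × Ordinal.{0})
def Inst (R : ℕ → ℕ → ℕ → Prop) (β : Ordinal.{0}) (p : Pos) (i : ℕ) (γ : Ordinal.{0}) (T : Set Ordinal.{0}) : Prop :=
  γ < β ∧ (R 3 i 0 ∨ ∃ a, R 0 i a ∧ (a, γ) ∈ p) ∧ (R 4 i 0 ∨ ∃ a o, R 1 i a ∧ (a, o) ∈ p) ∧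
  (R 5 i 0 ∧ T = {γ} ∨ (R 6 i 0 ∧ ∃ δ < γ, T = {δ}) ∨ R 7 i 0 ∧ T = Set.Iio γ)
inductive W (R : ℕ → ℕ → ℕ → Prop) (β : Ordinal.{0}) : Ordinal.{0} → Pos → Prop
  | mk (ξ : Ordinal.{0}) (p i γ T) (f : ℕ → Ordinal.{0} → Ordinal.{0}) : Inst R β p i γ T → (∀ j ε, R 2 i j → ε ∈ T → f j ε < ξ) →
    (∀ j ε, R 2 i j → ε ∈ T → W R β (f j ε) ((j, ε) :: p)) → W R β ξ p
theorem W.mk' {R β ξ p i γ T} (h : Inst R β p i γ T) (h' : ∀ j ε, R 2 i j → ε ∈ T → ∃ ξ' < ξ, W R β ξ' ((j, ε) :: p)) : W R β ξ p := by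
  refine .mk ξ p i γ T (fun j ε => if h : ∃ ξ' < ξ, W R β ξ' ((j, ε) :: p) then h.choose else 0) h (fun j ε h1 h2 => ?_) fun j ε h1 h2 => ?_
  · simp only [dif_pos (h' j ε h1 h2)]; exact (h' j ε h1 h2).choose_spec.1
  · simp only [dif_pos (h' j ε h1 h2)]; exact (h' j ε h1 h2).choose_spec.2
theorem Inst.lt {R β p i γ T} (h : Inst R β p i γ T) {ε} (he : ε ∈ T) : ε < β := by
  obtain ⟨h0, -, -, ⟨-, rfl⟩ | ⟨-, δ, h, rfl⟩ | ⟨-, rfl⟩⟩ := h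
  · rw [Set.mem_singleton_iff.1 he]; exact h0
  · rw [Set.mem_singleton_iff.1 he]; exact h.trans h0
  · exact lt_trans he h0
section
variable {M : ZFSet.{0}} [hM : KO M]
theorem n_lt (n : ℕ) : (n : Ordinal.{0}) < M.rank := (Ordinal.natCast_lt_omega0 n).trans hM.om
variable (M) in
noncomputable abbrev nt (n : ℕ) : El M := on M n
variable (M) in
noncomputable abbrev Om : El M := on M Ordinal.omega0
theorem nt_inj {n m : ℕ} : nt M n = nt M m ↔ n = m := by rw [on_inj (n_lt n) (n_lt m)]; exact_mod_cast Iff.rfl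
theorem mem_Om {x : El M} : x.1 ∈ (Om M).1 ↔ ∃ n : ℕ, x = nt M n := by
  rw [mem_on hM.om]
  constructor
  · rintro ⟨o, h, rfl⟩
    obtain ⟨n, rfl⟩ := Ordinal.lt_omega0.1 h
    exact ⟨n, rfl⟩
  · rintro ⟨n, rfl⟩; exact ⟨n, Ordinal.natCast_lt_omega0 n, rfl⟩
theorem nt_succ (n : ℕ) : nt M (n+1) = ins (nt M n) (nt M n) := by
  refine El.ext' fun x => ?_
  rw [mem_ins, mem_on (n_lt _), mem_on (n_lt _)]
  simp only [Nat.cast_succ, Order.lt_add_one_iff, le_iff_lt_or_eq]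
  constructor
  · rintro ⟨o, h | rfl, rfl⟩
    · exact Or.inr ⟨o, h, rfl⟩
    · exact Or.inl rfl
  · rintro (rfl | ⟨o, h, rfl⟩)
    · exact ⟨_, Or.inr rfl, rfl⟩
    · exact ⟨o, Or.inl h, rfl⟩
theorem rec_set (G : ℕ → ℕ → ℕ) (I : El M → El M → Prop) (S : El M → El M → El M → Prop) (hI : Si fun v => I (v 0) (v 1)) (hS : Si fun v => S (v 0) (v 1) (v 2))
    (hI' : ∀ a c, I (nt M a) c ↔ c = nt M (G a 0)) (hS' : ∀ a b c, S (nt M a) (nt M (G a b)) c ↔ c = nt M (G a (b+1))) :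
    ∃ g : El M, ∀ a b c, (pr (nt M a) (pr (nt M b) (nt M c))).1 ∈ g.1 ↔ G a b = c := by
  have hi {t s : EV M → El M} [ht : Tm t] [hs : Tm s] : Si fun v => I (t v) (s v) := Si.sub2 hI ht hs
  let R : El M → El M → Prop := fun w s => ∃ a b c u, u = pr b c ∧ w = pr a u ∧ a.1 ∈ (Om M).1 ∧ ((b = nt M 0 ∧ I a c) ∨ ∃ b' c' u', b = ins b' b' ∧ b'.1 ∈ (Om M).1 ∧ u' = pr b' c' ∧ (pr a u').1 ∈ s.1 ∧ S a c' c)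
  have hR : Si fun v => R (v 0) (v 1) := by
    have hS2 : Si fun v => S (v 6) (v 1) (v 4) := hS.ren (push 6 (push 1 fun _ => 4))
    infer_instance
  have h1 w (h : Ind R w) : ∃ a b, w = pr (nt M a) (pr (nt M b) (nt M (G a b))) := by
    induction h with
    | mk w s h _ ih =>
      obtain ⟨a, b, c, u, rfl, rfl, ha, ⟨rfl, h⟩ | ⟨b', c', u', rfl, hb, rfl, h3, h4⟩⟩ := h
      · obtain ⟨a, rfl⟩ := mem_Om.1 ha
        exact ⟨a, 0, by rw [(hI' _ _).1 h]⟩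
      · obtain ⟨a', b, e⟩ := ih _ h3
        obtain ⟨rfl, e2⟩ := pr_inj.1 e
        obtain ⟨rfl, rfl⟩ := pr_inj.1 e2
        exact ⟨a', b+1, by rw [(hS' _ _ _).1 h4, nt_succ]⟩
  have h2 a b : Ind R (pr (nt M a) (pr (nt M b) (nt M (G a b)))) := by
    induction b with
    | zero => exact .mk _ ⟨∅, M_emp⟩ ⟨_, _, _, _, rfl, rfl, mem_Om.2 ⟨a, rfl⟩, Or.inl ⟨rfl, (hI' _ _).2 rfl⟩⟩ fun q hq => absurd hq (ZFSet.notMem_empty _)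
    | succ b ih =>
      refine .mk _ (up (pr (nt M a) (pr (nt M b) (nt M (G a b)))) (pr (nt M a) (pr (nt M b) (nt M (G a b))))) ⟨_, _, _, _, rfl, rfl, mem_Om.2 ⟨a, rfl⟩, Or.inr ⟨_, _, _, nt_succ b, mem_Om.2 ⟨b, rfl⟩, rfl, mem_up.2 (Or.inl rfl), (hS' _ _ _).2 rfl⟩⟩ fun q hq => ?_
      rcases mem_up.1 hq with rfl | rfl <;> exact ih
  have hJ {t : EV M → El M} [ht : Tm t] := ind_si hR (t := t)
  let Q : El M → El M → El M → Prop := fun a b w => Ind R w ∧ ∃ c u, u = pr b c ∧ w = pr a u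
  obtain ⟨D, hD, hD'⟩ := coll2 (P := fun a g => (∀ b : El M, b.1 ∈ (Om M).1 → ∃ w : El M, w.1 ∈ g.1 ∧ Q a b w) ∧ ∀ w : El M, w.1 ∈ g.1 → ∃ b : El M, b.1 ∈ (Om M).1 ∧ Q a b w) inferInstance (Om M) fun a ha => by
    obtain ⟨a, rfl⟩ := mem_Om.1 ha
    refine coll2 (P := fun b w => Q (nt M a) b w) inferInstance (Om M) fun b hb => ?_
    obtain ⟨b, rfl⟩ := mem_Om.1 hb
    exact ⟨_, h2 a b, _, _, rfl, rfl⟩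
  refine ⟨un D, fun a b c => ⟨fun h => ?_, ?_⟩⟩
  · obtain ⟨g, hg, h⟩ := mem_un.1 h
    obtain ⟨_, _, _, h3⟩ := hD' g hg
    obtain ⟨_, _, h4, -⟩ := h3 _ h
    obtain ⟨a', b', e⟩ := h1 _ h4
    obtain ⟨e1, e⟩ := pr_inj.1 e
    obtain ⟨e2, e3⟩ := pr_inj.1 e
    rw [nt_inj] at e1 e2 e3
    subst e1 e2 e3; rfl
  · rintro rfl
    obtain ⟨g, hg, h3, -⟩ := hD (nt M a) (mem_Om.2 ⟨a, rfl⟩)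
    obtain ⟨w, hw, h4, c, _, rfl, rfl⟩ := h3 (nt M b) (mem_Om.2 ⟨b, rfl⟩)
    obtain ⟨a', b', e⟩ := h1 _ h4
    obtain ⟨e1, e⟩ := pr_inj.1 e
    obtain ⟨e2, e3⟩ := pr_inj.1 e
    rw [nt_inj] at e1 e2
    subst e1 e2 e3
    exact mem_un.2 ⟨g, hg, hw⟩
theorem D1.tri (g : El M) (i j k : ℕ) : D1 fun v : EV M => (pr (v i) (pr (v j) (v k))).1 ∈ g.1 := by
  refine (inferInstance : D1 fun v => ∃ z : El M, z.1 ∈ g.1 ∧ ∃ u : El M, u.1 ∈ z.1 ∧ ∃ w : El M, w.1 ∈ u.1 ∧ (w = pr (v j) (v k) ∧ z = pr (v i) w)).congr fun v => ?_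
  constructor
  · intro h
    exact ⟨_, h, up (v i) (pr (v j) (v k)), mem_up.2 (Or.inr rfl), _, mem_up.2 (Or.inr rfl), rfl, rfl⟩
  · rintro ⟨_, h, _, _, _, _, rfl, rfl⟩; exact h
variable (M) in
theorem ex_add : ∃ g : El M, ∀ a b c, (pr (nt M a) (pr (nt M b) (nt M c))).1 ∈ g.1 ↔ a + b = c :=
  rec_set (fun a b => a + b) (fun a c => c = a) (fun a c c' => c' = ins c c) inferInstance inferInstance (fun a c => Iff.rfl) fun a b c => by rw [← nt_succ]; rfl
variable (M) in
theorem ex_mul : ∃ g : El M, ∀ a b c, (pr (nt M a) (pr (nt M b) (nt M c))).1 ∈ g.1 ↔ a * b = c := by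
  obtain ⟨g, hg⟩ := ex_add M
  have := D1.tri g 1 0 2
  refine rec_set (fun a b => a * b) (fun a c => c = nt M 0) (fun a c c' => (pr c (pr a c')).1 ∈ g.1 ∧ c'.1 ∈ (Om M).1) inferInstance inferInstance (fun a c => Iff.rfl) fun a b c => ?_
  constructor
  · rintro ⟨h, h'⟩
    obtain ⟨c, rfl⟩ := mem_Om.1 h'
    rw [hg] at h; rw [← h]; rfl
  · rintro rfl
    exact ⟨(hg _ _ _).2 rfl, mem_Om.2 ⟨_, rfl⟩⟩
variable (M) in
theorem ar_d1 {P : FE → NE → Prop} (h : Ar P) : ∃ Q : EV M → Prop, D1 Q ∧ ∀ e v, (∀ i, v i = nt M (e i)) → (Q v ↔ P (fun _ _ => 0) e) := by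
  induction h with
  | add i j k =>
    obtain ⟨g, hg⟩ := ex_add M
    exact ⟨_, D1.tri g i j k, fun e v h => by rw [h, h, h, hg]⟩
  | mul i j k =>
    obtain ⟨g, hg⟩ := ex_mul M
    exact ⟨_, D1.tri g i j k, fun e v h => by rw [h, h, h, hg]⟩
  | eq i j => exact ⟨_, (inferInstance : D1 fun v => v i = v j), fun e v h => by rw [h, h, nt_inj]⟩
  | app i j k => exact ⟨_, (inferInstance : D1 fun v => nt M 0 = v k), fun e v h => by rw [h, nt_inj]⟩
  | fls => exact ⟨_, D1.fls, fun e v h => Iff.rfl⟩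
  | imp _ _ h1 h2 =>
    obtain ⟨Q1, d1, h1⟩ := h1
    obtain ⟨Q2, d2, h2⟩ := h2
    exact ⟨_, (inferInstance : D1 fun v => Q1 v → Q2 v), fun e v h => by rw [h1 e v h, h2 e v h]⟩
  | all _ ih =>
    obtain ⟨Q, d, ih⟩ := ih
    have := (D1.ball0 (d.ren (push 0 fun i => i + 2)) 0).gsub (push (Sum.inr (Om M)) Sum.inl)
    have e' (v : EV M) (x : El M) : (fun i => push x (fun i => gt v (push (Sum.inr (Om M)) Sum.inl i)) (push 0 (fun i => i + 2) i)) = push x v := by funext i; cases i <;> rfl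
    simp only [e'] at this
    refine ⟨_, this, fun e v h => ?_⟩
    constructor
    · intro H x
      exact (ih (push x e) (push (nt M x) v) fun i => by cases i; rfl; exact h _).1 (H _ (mem_Om.2 ⟨x, rfl⟩))
    · intro H x hx
      obtain ⟨x, rfl⟩ := mem_Om.1 hx
      exact (ih (push x e) (push (nt M x) v) fun i => by cases i; rfl; exact h _).2 (H x)
variable (M) in
noncomputable def ph : Pos → El M
  | [] => nt M 0
  | x :: p => ins (pr (nt M x.1) (on M x.2)) (ph p)
def bd (β : Ordinal.{0}) (p : Pos) : Prop := ∀ x ∈ p, x.2 < β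
theorem bd.cons {β a o p} (h : bd β p) (ho : o < β) : bd β ((a, o) :: p) := by
  intro x hx
  rcases List.mem_cons.1 hx with rfl | hx
  exacts [ho, h x hx]
theorem mem_ph {z : El M} : ∀ p : Pos, z.1 ∈ (ph M p).1 ↔ ∃ x ∈ p, z = pr (nt M x.1) (on M x.2)
  | [] => by simp [ph, on_1 (n_lt 0)]
  | x :: p => by rw [ph, mem_ins, mem_ph p]; simp
theorem mem_ph' {p : Pos} (h : bd M.rank p) {a o} (ho : o < M.rank) : (pr (nt M a) (on M o)).1 ∈ (ph M p).1 ↔ (a, o) ∈ p := by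
  rw [mem_ph]
  constructor
  · rintro ⟨⟨b, o'⟩, h1, h2⟩
    obtain ⟨e1, e2⟩ := pr_inj.1 h2
    rw [nt_inj] at e1
    rw [on_inj ho (h _ h1)] at e2
    simp_all
  · intro h; exact ⟨_, h, rfl⟩
variable {R : ℕ → ℕ → ℕ → Prop} {RM : El M → El M → El M → Prop}
variable (R RM) in
structure Rep : Prop where
  d : D1 fun v => RM (v 0) (v 1) (v 2)
  h : ∀ a b c, RM (nt M a) (nt M b) (nt M c) ↔ R a b c
theorem ex_rep (h : Df Ar fun F e => R (e 0) (e 1) (e 2)) : ∃ RM : El M → El M → El M → Prop, Rep R RM := by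
  obtain ⟨Q, d, hQ⟩ := ar_d1 M h.h
  refine ⟨fun x y z => Q (push x (push y (push z fun _ => nt M 0))), (d.gsub (push (Sum.inl 0) (push (Sum.inl 1) (push (Sum.inl 2) fun _ => Sum.inr (nt M 0))))).congr fun v => iff_of_eq (congrArg Q ?_), fun a b c => hQ (push a (push b (push c fun _ => 0))) _ ?_⟩
  · funext i; rcases i with _ | _ | _ | i <;> rfl
  · intro i; rcases i with _ | _ | _ | i <;> rfl
variable (RM) in
def RC (x i y t : El M) : Prop := i.1 ∈ (Om M).1 ∧ y.1.IsOrdinal ∧ (RM (nt M 3) i (nt M 0) ∨ ∃ a : El M, a.1 ∈ (Om M).1 ∧ RM (nt M 0) i a ∧ (pr a y).1 ∈ x.1) ∧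
  (RM (nt M 4) i (nt M 0) ∨ ∃ a : El M, a.1 ∈ (Om M).1 ∧ ∃ y' : El M, RM (nt M 1) i a ∧ (pr a y').1 ∈ x.1) ∧
  (RM (nt M 5) i (nt M 0) ∧ t = up y y ∨ (RM (nt M 6) i (nt M 0) ∧ ∃ z : El M, z.1 ∈ y.1 ∧ t = up z z) ∨ RM (nt M 7) i (nt M 0) ∧ t = y)
variable (RM) in
def RP (x i t s : El M) : Prop := ∀ j : El M, j.1 ∈ (Om M).1 → RM (nt M 2) i j → ∀ ε : El M, ε.1 ∈ t.1 → ∃ q : El M, q.1 ∈ s.1 ∧ ∃ c, c = pr j ε ∧ q = ins c x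
variable (RM) in
def RR (x s : El M) : Prop := ∃ i y t, RC RM x i y t ∧ RP RM x i t s
theorem RR_si (h : Rep R RM) : Si fun v => RR RM (v 0) (v 1) := by
  have hr {t s u : EV M → El M} [ht : Tm t] [hs : Tm s] [hu : Tm u] : D1 fun v => RM (t v) (s v) (u v) := D1.sub3 h.d ht hs hu
  have a1 : D1 fun v : EV M => (v 1).1 ∈ (Om M).1 := inferInstance
  have a2 : D1 fun v : EV M => (v 1).1.IsOrdinal := inferInstance
  have a3 : Si fun v => RM (nt M 3) (v 1) (nt M 0) ∨ ∃ a : El M, a.1 ∈ (Om M).1 ∧ RM (nt M 0) (v 1) a ∧ (pr a (v 2)).1 ∈ (v 0).1 := inferInstance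
  have a4 : Si fun v => RM (nt M 4) (v 1) (nt M 0) ∨ ∃ a : El M, a.1 ∈ (Om M).1 ∧ ∃ y' : El M, RM (nt M 1) (v 1) a ∧ (pr a y').1 ∈ (v 0).1 := inferInstance
  have a5 : Si fun v => RM (nt M 5) (v 1) (nt M 0) ∧ (v 3) = up (v 2) (v 2) ∨ (RM (nt M 6) (v 1) (nt M 0) ∧ ∃ z : El M, z.1 ∈ (v 2).1 ∧ (v 3) = up z z) ∨ RM (nt M 7) (v 1) (nt M 0) ∧ (v 3) = (v 2) := inferInstance
  have a6 : Si fun v => RP RM (v 0) (v 1) (v 2) (v 3) := by unfold RP; infer_instance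
  have a7 : Si fun v => RC RM (v 0) (v 1) (v 2) (v 3) := by unfold RC; infer_instance
  have a8 : Si fun v => RC RM (v 3) (v 2) (v 1) (v 0) := a7.ren (push 3 (push 2 (push 1 fun _ => 0)))
  have a9 : Si fun v => RP RM (v 3) (v 2) (v 0) (v 4) := a6.ren (push 3 (push 2 (push 0 fun _ => 4)))
  unfold RR; infer_instance
theorem RC_1 (h : Rep R RM) {p : Pos} (hp : bd M.rank p) {x i y t} (hx : x = ph M p) (H : RC RM x i y t) : ∃ i' γ T, i = nt M i' ∧ Inst R M.rank p i' γ T ∧ ∀ o ∈ T, (on M o).1 ∈ t.1 := by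
  obtain ⟨hi, hy, h1, h2, h3⟩ := H
  obtain ⟨i, rfl⟩ := mem_Om.1 hi
  obtain ⟨γ, hγ, rfl⟩ := ord_on hy
  simp only [h.h] at h1 h2 h3
  subst hx
  have hT : ∃ T : Set Ordinal.{0}, (R 5 i 0 ∧ T = {γ} ∨ (R 6 i 0 ∧ ∃ δ < γ, T = {δ}) ∨ R 7 i 0 ∧ T = Set.Iio γ) ∧ ∀ o ∈ T, (on M o).1 ∈ t.1 := by
    obtain ⟨h, rfl⟩ | ⟨h, z, hz, rfl⟩ | ⟨h, rfl⟩ := h3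
    · exact ⟨_, Or.inl ⟨h, rfl⟩, by rintro _ rfl; exact mem_up.2 (Or.inl rfl)⟩
    · obtain ⟨δ, hδ, rfl⟩ := (mem_on hγ).1 hz
      exact ⟨_, Or.inr (Or.inl ⟨h, δ, hδ, rfl⟩), by rintro _ rfl; exact mem_up.2 (Or.inl rfl)⟩
    · exact ⟨_, Or.inr (Or.inr ⟨h, rfl⟩), fun o ho => (mem_on hγ).2 ⟨o, ho, rfl⟩⟩
  obtain ⟨T, h4, h5⟩ := hT
  refine ⟨i, γ, T, rfl, ⟨hγ, h1.imp_right ?_, h2.imp_right ?_, h4⟩, h5⟩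
  · rintro ⟨a, ha, h6, h7⟩
    obtain ⟨a, rfl⟩ := mem_Om.1 ha
    exact ⟨a, (h.h _ _ _).1 h6, (mem_ph' hp hγ).1 h7⟩
  · rintro ⟨a, ha, y', h6, h7⟩
    obtain ⟨a, rfl⟩ := mem_Om.1 ha
    obtain ⟨⟨b, o⟩, h8, h9⟩ := (mem_ph p).1 h7
    obtain ⟨e, -⟩ := pr_inj.1 h9
    rw [nt_inj] at e
    subst e
    exact ⟨_, o, (h.h _ _ _).1 h6, h8⟩
theorem RC_2 (h : Rep R RM) {p : Pos} (hp : bd M.rank p) {i γ T} (H : Inst R M.rank p i γ T) : ∃ t, RC RM (ph M p) (nt M i) (on M γ) t ∧ ∀ x : El M, x.1 ∈ t.1 → ∃ o ∈ T, x = on M o := by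
  obtain ⟨hγ, h1, h2, h3⟩ := H
  have ht : ∃ t : El M, (R 5 i 0 ∧ t = up (on M γ) (on M γ) ∨ (R 6 i 0 ∧ ∃ z : El M, z.1 ∈ (on M γ).1 ∧ t = up z z) ∨ R 7 i 0 ∧ t = on M γ) ∧ ∀ x : El M, x.1 ∈ t.1 → ∃ o ∈ T, x = on M o := by
    obtain ⟨h, rfl⟩ | ⟨h, δ, hδ, rfl⟩ | ⟨h, rfl⟩ := h3
    · exact ⟨_, Or.inl ⟨h, rfl⟩, fun x hx => by simpa [mem_up] using hx⟩
    · exact ⟨_, Or.inr (Or.inl ⟨h, _, (mem_on hγ).2 ⟨δ, hδ, rfl⟩, rfl⟩), fun x hx => by simpa [mem_up] using hx⟩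
    · exact ⟨_, Or.inr (Or.inr ⟨h, rfl⟩), fun x hx => (mem_on hγ).1 hx⟩
  obtain ⟨t, h4, h5⟩ := ht
  have ho : (on M γ).1.IsOrdinal := by rw [on_1 hγ]; exact ZFSet.isOrdinal_toZFSet γ
  refine ⟨t, ⟨mem_Om.2 ⟨i, rfl⟩, ho, ?_, ?_, by simpa only [h.h] using h4⟩, h5⟩
  · simp only [h.h]
    exact h1.imp_right fun ⟨a, h6, h7⟩ => ⟨_, mem_Om.2 ⟨a, rfl⟩, (h.h _ _ _).2 h6, (mem_ph' hp hγ).2 h7⟩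
  · simp only [h.h]
    exact h2.imp_right fun ⟨a, o, h6, h7⟩ => ⟨_, mem_Om.2 ⟨a, rfl⟩, on M o, (h.h _ _ _).2 h6, (mem_ph p).2 ⟨_, h7, rfl⟩⟩
theorem RR_close (h : Rep R RM) {p : Pos} (hp : bd M.rank p) {i γ T} (H : Inst R M.rank p i γ T) (hj : ∀ j ε, R 2 i j → ε ∈ T → Ind (RR RM) (ph M ((j, ε) :: p))) : Ind (RR RM) (ph M p) := by
  obtain ⟨t, h1, h2⟩ := RC_2 h hp H
  have hr {t s u : EV M → El M} [ht : Tm t] [hs : Tm s] [hu : Tm u] : D1 fun v => RM (t v) (s v) (u v) := D1.sub3 h.d ht hs hu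
  have hJ {t : EV M → El M} [ht : Tm t] := ind_si (RR_si h) (t := t)
  obtain ⟨b, hb, hb'⟩ := coll2 (P := fun j w => (RM (nt M 2) (nt M i) j → ∀ ε : El M, ε.1 ∈ t.1 → ∃ q : El M, q.1 ∈ w.1 ∧ ∃ c, c = pr j ε ∧ q = ins c (ph M p)) ∧ ∀ q : El M, q.1 ∈ w.1 → Ind (RR RM) q) inferInstance (Om M) fun j hj' => by
    by_cases hR : RM (nt M 2) (nt M i) j
    · obtain ⟨w, h3, h4⟩ := coll2 (P := fun ε q => (∃ c, c = pr j ε ∧ q = ins c (ph M p)) ∧ Ind (RR RM) q) inferInstance t fun ε he => by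
        obtain ⟨j, rfl⟩ := mem_Om.1 hj'
        obtain ⟨o, ho, rfl⟩ := h2 _ he
        exact ⟨_, ⟨_, rfl, rfl⟩, hj j o ((h.h _ _ _).1 hR) ho⟩
      exact ⟨w, fun _ ε he => let ⟨q, a, b, c⟩ := h3 ε he; ⟨q, a, b⟩, fun q hq => let ⟨ε, a, b, c⟩ := h4 q hq; c⟩
    · exact ⟨⟨∅, M_emp⟩, fun h => absurd h hR, fun q hq => absurd hq (ZFSet.notMem_empty _)⟩
  refine .mk _ (un b) ⟨_, _, t, h1, fun j hj' hR ε he => ?_⟩ fun q hq => ?_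
  · obtain ⟨w, hw, h3, -⟩ := hb j hj'
    obtain ⟨q, hq, h4⟩ := h3 hR ε he
    exact ⟨q, mem_un.2 ⟨w, hw, hq⟩, h4⟩
  · obtain ⟨w, hw, hq⟩ := mem_un.1 hq
    obtain ⟨_, _, _, h3⟩ := hb' w hw
    exact h3 q hq
theorem W_ind (h : Rep R RM) {ξ p} (H : W R M.rank ξ p) : bd M.rank p → Ind (RR RM) (ph M p) := by
  induction H with
  | mk ξ p i γ T f h1 h2 h3 ih => exact fun hp => RR_close h hp h1 fun j ε hj he => ih j ε hj he (hp.cons (h1.lt he))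
theorem ind_W (h : Rep R RM) {p} (hp : bd M.rank p) (H : Ind (RR RM) (ph M p)) : ∃ ξ < M.rank, W R M.rank ξ p := by
  obtain ⟨d, y, hd, hy⟩ := (ind_iff (RR_si h) _).1 H
  have key : ∀ y : El M, ∀ p, bd M.rank p → (pr (ph M p) y).1 ∈ d.1 → W R M.rank y.1.rank p := by
    refine El.ind fun y ih p hp hy => ?_
    obtain ⟨s, ⟨i, x, t, h1, h2⟩, h3⟩ := hd.ok hy
    obtain ⟨i, γ, T, rfl, h4, h5⟩ := RC_1 h hp rfl h1
    refine W.mk' h4 fun j ε hj he => ?_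
    obtain ⟨q, hq, _, rfl, rfl⟩ := h2 _ (mem_Om.2 ⟨j, rfl⟩) ((h.h _ _ _).2 hj) _ (h5 ε he)
    obtain ⟨y', h6, h7⟩ := h3 _ hq
    exact ⟨_, ZFSet.rank_lt_of_mem h6, ih y' h6 ((j, ε) :: p) (hp.cons (h4.lt he)) h7⟩
  exact ⟨_, ZFSet.rank_lt_of_mem y.2, key y p hp hy⟩
end
/-- closure -/
theorem adm_close {β : Ordinal.{0}} (hβ : Admissible β) (ho : Ordinal.omega0 < β) {R : ℕ → ℕ → ℕ → Prop} (hR : Df Ar fun F e => R (e 0) (e 1) (e 2)) :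
    (∀ o < β, o + 1 < β) ∧ ∀ {p i γ T}, bd β p → Inst R β p i γ T → (∀ j ε, R 2 i j → ε ∈ T → ∃ ξ < β, W R β ξ ((j, ε) :: p)) → ∃ ξ < β, W R β ξ p := by
  obtain ⟨M, h1, h2, rfl⟩ := (adm_iff β).1 hβ
  haveI : KO M := { tr := h1, kp := h2, om := ho }
  obtain ⟨RM, h⟩ := ex_rep (M := M) hR
  refine ⟨fun o => M_lim, fun {p i γ T} hp hI hj => ?_⟩
  exact ind_W h hp (RR_close h hp hI fun j ε h3 h4 => let ⟨ξ, _, h5⟩ := hj j ε h3 h4; W_ind h h5 (hp.cons (hI.lt h4)))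
-- the rules
def cl (n g l i : ℕ) : ℕ := Nat.pair (Nat.pair n g) (Nat.pair l i)
abbrev cS (a : ℕ) : ℕ := a.unpair.1.unpair.1
abbrev cG (a : ℕ) : ℕ := a.unpair.1.unpair.2
abbrev cL (a : ℕ) : ℕ := a.unpair.2.unpair.1
abbrev cI (a : ℕ) : ℕ := a.unpair.2.unpair.2
def lst (n : ℕ) : List ℕ := Denumerable.ofNat (List ℕ) n
theorem lst_enc (l : List ℕ) : lst (Encodable.encode l) = l := Denumerable.ofNat_encode l
theorem enc_lst (n : ℕ) : Encodable.encode (lst n) = n := Denumerable.encode_ofNat n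
theorem lst_inj {n m : ℕ} (h : lst n = lst m) : n = m := by rw [← enc_lst n, h, enc_lst]
theorem lst_prim : Primrec lst := Primrec.ofNat _
def Inc (n m : ℕ) : Prop := (lst n).length ≤ (lst m).length ∧ (lst m).drop ((lst m).length - (lst n).length) ≠ lst n
def Eg (n m u : ℕ) : Prop := edge n m u ∧ (lst n).length = (nd m).2.2.length
section
variable {K : (FE → NE → Prop) → Prop} [ArLike K] {t s u : FE → NE → ℕ} [ht : AF K t] [hs : AF K s] [hu : AF K u]
instance (priority := 2500) len_af : AF K fun F e => (lst (t F e)).length := AF.prim (f := fun n => (lst n).length) (Primrec.list_length.comp lst_prim) ht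
instance (priority := 2500) inc_df : Df K fun F e => Inc (t F e) (s F e) := by
  have h2 : Primrec fun p : ℕ × ℕ => lst p.1 := lst_prim.comp Primrec.fst
  have h3 : Primrec fun p : ℕ × ℕ => lst p.2 := lst_prim.comp Primrec.snd
  have h1 : PrimrecRel Inc := PrimrecPred.and (Primrec.nat_le.comp (Primrec.list_length.comp h2) (Primrec.list_length.comp h3))
    (PrimrecPred.not (Primrec.eq.comp (Primrec.list_drop.comp (Primrec.nat_sub.comp (Primrec.list_length.comp h3) (Primrec.list_length.comp h2)) h3) h2))
  exact Df.prim2 h1 ht hs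
instance (priority := 2500) mem_df : Df K fun F e => t F e ∈ lst (s F e) := by
  have h1 : PrimrecRel fun a n : ℕ => a ∈ lst n := by
    have := (PrimrecRel.exists_mem_list (R := fun a b : ℕ => a = b) Primrec.eq).comp (lst_prim.comp Primrec.snd) (Primrec.fst (α := ℕ) (β := ℕ))
    exact this.of_eq fun p => by simp
  exact Df.prim2 h1 ht hs
instance (priority := 2500) eg_df : Df K fun F e => Eg (t F e) (s F e) (u F e) := by
  have h : Primrec fun m => (nd m).2.2.length := Primrec.list_length.comp (Primrec.snd.comp (Primrec.snd.comp nd_prim))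
  have h1 : AF K fun F e => (nd (s F e)).2.2.length := AF.prim (f := fun m => (nd m).2.2.length) h hs
  unfold Eg; infer_instance
end
def RI (t i a : ℕ) : Prop :=
  let k := i.unpair.1
  let d := i.unpair.2
  t = 0 ∧ (k = 0 ∧ cS a = d.unpair.1 ∨ k = 3 ∧ cG a = d + 1 ∨ k = 4 ∧ cL a = d.unpair.1 + 1 ∨ k = 6 ∧ cI a = d + 1) ∨
  t = 1 ∧ (k = 0 ∧ cS a = d.unpair.2 ∧ Inc d.unpair.1 d.unpair.2 ∨ k = 4 ∧ cS a = d.unpair.2.unpair.1 ∧ Eg d.unpair.2.unpair.1 d.unpair.2.unpair.2 d.unpair.1) ∨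
  t = 2 ∧ (k = 1 ∧ (∃ n, ((lst n).length = d ∧ ∀ x, x ∈ lst n → x ≤ 1) ∧ a = cl n 0 0 0) ∨ k = 2 ∧ (∃ u, a = cl 0 (u+1) (u+1) 0) ∨
    k = 3 ∧ (∃ n m, Eg n m d ∧ a = cl n (m+1) 0 0) ∨ k = 4 ∧ a = cl 0 0 (d.unpair.2.unpair.2+1) 0 ∨ k = 5 ∧ (a = cl 0 (d+1) 0 0 ∨ a = cl 0 0 (d+1) 0) ∨
    k = 6 ∧ (∃ n m, Eg n m d ∧ a = cl n 0 0 (m+1))) ∨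
  t = 3 ∧ (k = 1 ∨ k = 2 ∨ k = 5) ∨ t = 4 ∧ (k = 1 ∨ k = 2 ∨ k = 3 ∨ k = 5 ∨ k = 6) ∨ t = 5 ∧ (k = 0 ∨ k = 1 ∨ k = 2 ∨ k = 5 ∨ k = 6) ∨ t = 6 ∧ k = 3 ∨ t = 7 ∧ k = 4
set_option synthInstance.maxHeartbeats 400000 in
set_option synthInstance.maxSize 4000 in
theorem RI_df {K} [ArLike K] : Df K fun F e => RI (e 0) (e 1) (e 2) := by unfold RI cl; dsimp only; infer_instance
section
variable {β γ : Ordinal.{0}} {p : Pos} {d j : ℕ} {T : Set Ordinal.{0}}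
theorem I0 : Inst RI β p (Nat.pair 0 d) γ T ↔ γ < β ∧ (∃ a, cS a = d.unpair.1 ∧ (a, γ) ∈ p) ∧ (∃ a o, (cS a = d.unpair.2 ∧ Inc d.unpair.1 d.unpair.2) ∧ (a, o) ∈ p) ∧ T = {γ} := by
  simp [Inst, RI]
theorem I1 : Inst RI β p (Nat.pair 1 d) γ T ↔ γ < β ∧ T = {γ} := by simp [Inst, RI]
theorem I2 : Inst RI β p (Nat.pair 2 d) γ T ↔ γ < β ∧ T = {γ} := by simp [Inst, RI]
theorem I3 : Inst RI β p (Nat.pair 3 d) γ T ↔ γ < β ∧ (∃ a, cG a = d + 1 ∧ (a, γ) ∈ p) ∧ ∃ δ < γ, T = {δ} := by simp [Inst, RI]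
theorem I4 : Inst RI β p (Nat.pair 4 d) γ T ↔ γ < β ∧ (∃ a, cL a = d.unpair.1 + 1 ∧ (a, γ) ∈ p) ∧
    (∃ a o, (cS a = d.unpair.2.unpair.1 ∧ Eg d.unpair.2.unpair.1 d.unpair.2.unpair.2 d.unpair.1) ∧ (a, o) ∈ p) ∧ T = Set.Iio γ := by simp [Inst, RI]
theorem I5 : Inst RI β p (Nat.pair 5 d) γ T ↔ γ < β ∧ T = {γ} := by simp [Inst, RI]
theorem I6 : Inst RI β p (Nat.pair 6 d) γ T ↔ γ < β ∧ (∃ a, cI a = d + 1 ∧ (a, γ) ∈ p) ∧ T = {γ} := by simp [Inst, RI]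
theorem C0 : ¬ RI 2 (Nat.pair 0 d) j := by simp [RI]
theorem C1 : RI 2 (Nat.pair 1 d) j ↔ ∃ n, ((lst n).length = d ∧ ∀ x, x ∈ lst n → x ≤ 1) ∧ j = cl n 0 0 0 := by simp [RI]
theorem C2 : RI 2 (Nat.pair 2 d) j ↔ ∃ u, j = cl 0 (u+1) (u+1) 0 := by simp [RI]
theorem C3 : RI 2 (Nat.pair 3 d) j ↔ ∃ n m, Eg n m d ∧ j = cl n (m+1) 0 0 := by simp [RI]
theorem C4 : RI 2 (Nat.pair 4 d) j ↔ j = cl 0 0 (d.unpair.2.unpair.2+1) 0 := by simp [RI]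
theorem C5 : RI 2 (Nat.pair 5 d) j ↔ j = cl 0 (d+1) 0 0 ∨ j = cl 0 0 (d+1) 0 := by simp [RI]
theorem C6 : RI 2 (Nat.pair 6 d) j ↔ ∃ n m, Eg n m d ∧ j = cl n 0 0 (m+1) := by simp [RI]
theorem inst_k {i} (h : Inst RI β p i γ T) : ∃ d, i = Nat.pair 0 d ∨ i = Nat.pair 1 d ∨ i = Nat.pair 2 d ∨ i = Nat.pair 3 d ∨ i = Nat.pair 4 d ∨ i = Nat.pair 5 d ∨ i = Nat.pair 6 d := by
  refine ⟨i.unpair.2, ?_⟩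
  have h1 : i.unpair.1 ∈ [0,1,2,3,4,5,6] := by
    obtain ⟨-, -, -, ⟨h, -⟩ | ⟨h, -⟩ | ⟨h, -⟩⟩ := h <;> simp [RI] at h <;> simp <;> omega
  have h2 := Nat.pair_unpair i
  generalize i.unpair.1 = k at *
  generalize i.unpair.2 = d at *
  subst h2
  fin_cases h1 <;> simp
end
@[simp] theorem clS {n g l i} : cS (cl n g l i) = n := by simp [cS, cl]
@[simp] theorem clG {n g l i} : cG (cl n g l i) = g := by simp [cG, cl]
@[simp] theorem clL {n g l i} : cL (cl n g l i) = l := by simp [cL, cl]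
@[simp] theorem clI {n g l i} : cI (cl n g l i) = i := by simp [cI, cl]
section
variable {β γ ξ ξ' : Ordinal.{0}} {p p' : Pos}
def Sb (β ξ : Ordinal.{0}) (p p' : Pos) : Prop := ∀ a γ, (a, γ) ∈ p → (a, γ) ∈ p' ∨ ∃ n u γ', a = cl n 0 0 (u+1) ∧ ξ < γ' ∧ γ' < β ∧ (cl n (u+1) 0 0, γ') ∈ p'
theorem Sb.ext (h : Sb β ξ p p') (h' : ξ' < ξ) (x) : Sb β ξ' (x :: p) (x :: p') := by
  intro a γ ha
  rcases List.mem_cons.1 ha with rfl | ha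
  · exact Or.inl List.mem_cons_self
  · rcases h a γ ha with h1 | ⟨n, u, γ', h1, h2, h3, h4⟩
    · exact Or.inl (List.mem_cons_of_mem _ h1)
    · exact Or.inr ⟨n, u, γ', h1, h'.trans h2, h3, List.mem_cons_of_mem _ h4⟩
theorem W_sub (H : W RI β ξ p) : ∀ p', Sb β ξ p p' → W RI β ξ p' := by
  induction H with
  | mk ξ p i γ T f h1 h2 h3 ih =>
    intro p' hs
    have go (h : Inst RI β p' i γ T) : W RI β ξ p' := W.mk' h fun j ε hj he => ⟨_, h2 j ε hj he, ih j ε hj he _ (hs.ext (h2 j ε hj he) _)⟩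
    have hS a o (h : (a, o) ∈ p) (ho : o < β) : ∃ a' o', cS a' = cS a ∧ (a', o') ∈ p' ∧ o' < β := by
      rcases hs a o h with h | ⟨n, u, γ', rfl, -, h5, h⟩
      · exact ⟨_, _, rfl, h, ho⟩
      · exact ⟨_, _, by simp, h, h5⟩
    have hS' a o (h : (a, o) ∈ p) : ∃ a' o', cS a' = cS a ∧ (a', o') ∈ p' := by
      rcases hs a o h with h | ⟨n, u, γ', rfl, -, h5, h⟩
      · exact ⟨_, _, rfl, h⟩
      · exact ⟨_, _, by simp, h⟩
    obtain ⟨d, rfl | rfl | rfl | rfl | rfl | rfl | rfl⟩ := inst_k h1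
    · obtain ⟨h4, ⟨a, e, h5⟩, ⟨b, o, ⟨e2, h6⟩, h7⟩, rfl⟩ := I0.1 h1
      obtain ⟨a', γ', e3, h8, h9⟩ := hS _ _ h5 h4
      obtain ⟨b', o', e4, h10⟩ := hS' _ _ h7
      exact W.mk' (i := Nat.pair 0 d) (I0.2 ⟨h9, ⟨a', e3.trans e, h8⟩, ⟨b', o', ⟨e4.trans e2, h6⟩, h10⟩, rfl⟩) fun j ε hj => absurd hj C0
    · exact go (I1.2 (I1.1 h1))
    · exact go (I2.2 (I2.1 h1))
    · obtain ⟨h4, ⟨a, e, h5⟩, h6⟩ := I3.1 h1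
      refine go (I3.2 ⟨h4, ⟨a, e, (hs _ _ h5).resolve_right ?_⟩, h6⟩)
      rintro ⟨n, u, γ', rfl, -⟩
      simp at e
    · obtain ⟨h4, ⟨a, e, h5⟩, ⟨b, o, ⟨e2, h6⟩, h7⟩, h8⟩ := I4.1 h1
      obtain ⟨b', o', e4, h10⟩ := hS' _ _ h7
      refine go (I4.2 ⟨h4, ⟨a, e, (hs _ _ h5).resolve_right ?_⟩, ⟨b', o', ⟨e4.trans e2, h6⟩, h10⟩, h8⟩)
      rintro ⟨n, u, γ', rfl, -⟩
      simp at e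
    · exact go (I5.2 (I5.1 h1))
    · obtain ⟨h4, ⟨a, e, h5⟩, rfl⟩ := I6.1 h1
      rcases hs _ _ h5 with h | ⟨n, u, γ', rfl, h6, h7, h8⟩
      · exact go (I6.2 ⟨h4, ⟨a, e, h⟩, rfl⟩)
      · obtain rfl : u = d := by simpa using e
        refine W.mk' (i := Nat.pair 3 u) (I3.2 ⟨h7, ⟨_, by simp, h8⟩, ξ, h6, rfl⟩) fun j ε hj he => ?_
        obtain rfl := Set.mem_singleton_iff.1 he
        obtain ⟨n', m, hE, rfl⟩ := C3.1 hj
        have hc := C6.2 ⟨n', m, hE, rfl⟩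
        refine ⟨_, h2 _ _ hc rfl, ih _ _ hc rfl _ ?_⟩
        intro a o ha
        rcases List.mem_cons.1 ha with e | ha
        · cases e
          exact Or.inr ⟨_, _, _, rfl, h2 _ _ hc rfl, h6.trans h7, List.mem_cons_self⟩
        · rcases hs a o ha with h1 | ⟨n, u, γ', h1, h9, h3, h4⟩
          · exact Or.inl (List.mem_cons_of_mem _ h1)
          · exact Or.inr ⟨n, u, γ', h1, (h2 _ _ hc rfl).trans h9, h3, List.mem_cons_of_mem _ h4⟩
def Wn (β : Ordinal.{0}) (p : Pos) : Prop := ∃ ξ < β, W RI β ξ p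
theorem decide_u (hβ : Admissible β) (ho : Ordinal.omega0 < β) (hp : bd β p) (h : ¬ Wn β p) (u : ℕ) :
    ¬ Wn β ((cl 0 0 0 (u+1), 0) :: p) ∨ ∃ γ < β, ¬ Wn β ((cl 0 0 (u+1) 0, γ) :: p) := by
  by_contra hc
  push Not at hc
  obtain ⟨⟨ξ, h1, h2⟩, h3⟩ := hc
  obtain ⟨hl, hc⟩ := adm_close hβ ho RI_df
  have h4 := hl ξ h1
  refine h (hc (i := Nat.pair 5 u) hp (I5.2 ⟨h4, rfl⟩) fun j ε hj he => ?_)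
  obtain rfl := Set.mem_singleton_iff.1 he
  rcases C5.1 hj with rfl | rfl
  · refine ⟨ξ, h1, W_sub h2 _ fun a o ha => ?_⟩
    rcases List.mem_cons.1 ha with e | ha
    · cases e
      exact Or.inr ⟨_, _, _, rfl, lt_add_one ξ, h4, List.mem_cons_self⟩
    · exact Or.inl (List.mem_cons_of_mem _ ha)
  · exact h3 _ h4
-- soundness
def Tr (A : Set ℕ) (x : ℕ × Ordinal.{0}) : Prop := lst (cS x.1) = rs (charFun A) (lst (cS x.1)).length ∧
  (∀ u, cG x.1 = u + 1 → Acc (tr A) u → x.2 ≤ rk (tr A) u) ∧ (∀ u, cL x.1 = u + 1 → Acc (tr A) u ∧ rk (tr A) u ≤ x.2) ∧ ∀ u, cI x.1 = u + 1 → ¬ Acc (tr A) u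
theorem eg_tr {A n m u} : Eg n m u ∧ lst n = rs (charFun A) (lst n).length ↔ tr A m u ∧ n = Encodable.encode (rs (charFun A) (nd m).2.2.length) := by
  unfold Eg tr
  constructor
  · rintro ⟨⟨h1, h2⟩, h3⟩
    rw [h2] at h3
    rw [← h3, enc_lst]; exact ⟨h1, rfl⟩
  · rintro ⟨h1, rfl⟩
    rw [lst_enc, rs_len]; exact ⟨⟨h1, rfl⟩, rfl⟩
theorem lst_0 : lst 0 = [] := Denumerable.list_ofNat_zero
theorem sound {A} (hβ : β < w1 A) (H : W RI β ξ p) : ¬ ∀ x ∈ p, Tr A x := by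
  induction H with
  | mk ξ p i γ T f h1 h2 h3 ih =>
    intro hp
    have go j ε (hj : RI 2 i j) (he : ε ∈ T) (h : Tr A (j, ε)) : False := ih j ε hj he fun x hx => (List.mem_cons.1 hx).elim (fun e => e ▸ h) (hp x)
    have hn : ∀ u, ¬ Acc (tr A) u → ∃ m, tr A m u ∧ ¬ Acc (tr A) m := fun u hu => by
      by_contra hc; push Not at hc; exact hu ⟨_, hc⟩
    obtain ⟨d, rfl | rfl | rfl | rfl | rfl | rfl | rfl⟩ := inst_k h1
    · obtain ⟨h4, ⟨a, e, h5⟩, ⟨b, o, ⟨e2, h6, h8⟩, h7⟩, rfl⟩ := I0.1 h1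
      have e3 := (hp _ h5).1
      have e4 := (hp _ h7).1
      simp only [e, e2] at e3 e4
      apply h8
      rw [e3, e4]
      simp only [rs_len]
      rw [rs_drop _ _ _ (Nat.sub_le _ _)]
      congr 1; omega
    · obtain ⟨h4, rfl⟩ := I1.1 h1
      refine go _ γ (C1.2 ⟨Encodable.encode (rs (charFun A) d), ⟨by rw [lst_enc, rs_len], fun x hx => ?_⟩, rfl⟩) rfl ?_
      · rw [lst_enc] at hx
        obtain ⟨k, hk⟩ := List.mem_iff_getElem?.1 (List.mem_reverse.2 hx)
        rw [rs_get] at hk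
        split_ifs at hk
        simp only [Option.some.injEq] at hk
        rw [← hk]; unfold charFun; split_ifs <;> omega
      · simp [Tr, lst_enc, rs_len]
    · obtain ⟨h4, rfl⟩ := I2.1 h1
      obtain ⟨u, hu, e⟩ := lt_w1.1 (h4.trans hβ)
      refine go _ γ (C2.2 ⟨u, rfl⟩) rfl ?_
      simp [Tr, lst_0, rs, hu, e]
    · obtain ⟨h4, ⟨a, e, h5⟩, δ, hδ, rfl⟩ := I3.1 h1
      have h6 := (hp _ h5).2.1 d e
      have h7 : ∃ m, tr A m d ∧ (Acc (tr A) m → δ ≤ rk (tr A) m) := by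
        by_cases ha : Acc (tr A) d
        · obtain ⟨m, h8, h9⟩ := (lt_rk ha).1 (hδ.trans_le (h6 ha))
          exact ⟨m, h8, fun _ => h9⟩
        · obtain ⟨m, h8, h9⟩ := hn d ha
          exact ⟨m, h8, fun h => absurd h h9⟩
      obtain ⟨m, h8, h9⟩ := h7
      obtain ⟨h10, h11⟩ := eg_tr.2 ⟨h8, rfl⟩
      refine go _ δ (C3.2 ⟨_, m, h10, rfl⟩) rfl ?_
      simp only [Tr, clS, clG, clL, clI]
      exact ⟨h11, by simpa using h9, by simp, by simp⟩
    · obtain ⟨h4, ⟨a, e, h5⟩, ⟨b, o, ⟨e2, h6⟩, h7⟩, rfl⟩ := I4.1 h1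
      obtain ⟨h8, h9⟩ := (hp _ h5).2.2.1 _ e
      have e4 := (hp _ h7).1
      simp only [e2] at e4
      obtain ⟨h10, -⟩ := eg_tr.1 ⟨h6, e4⟩
      refine go _ (rk (tr A) d.unpair.2.unpair.2) (C4.2 rfl) ((rk_lt h8 h10).trans_le h9) ?_
      simp [Tr, lst_0, rs, h8.inv h10]
    · obtain ⟨h4, rfl⟩ := I5.1 h1
      by_cases ha : Acc (tr A) d ∧ rk (tr A) d ≤ γ
      · refine go _ γ (C5.2 (Or.inr rfl)) rfl ?_
        simp [Tr, lst_0, rs, ha]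
      · refine go _ γ (C5.2 (Or.inl rfl)) rfl ?_
        simp only [not_and, not_le] at ha
        simp [Tr, lst_0, rs]
        exact fun h => (ha h).le
    · obtain ⟨h4, ⟨a, e, h5⟩, rfl⟩ := I6.1 h1
      obtain ⟨m, h8, h9⟩ := hn d ((hp _ h5).2.2.2 d e)
      obtain ⟨h10, h11⟩ := eg_tr.2 ⟨h8, rfl⟩
      refine go _ γ (C6.2 ⟨_, m, h10, rfl⟩) rfl ?_
      simp only [Tr, clS, clG, clL, clI]
      exact ⟨h11, by simp, by simp, by simpa using h9⟩
end
structure Nota (A : Set ℕ) (β : Ordinal.{0}) (V : ℕ → Prop) (s : ℕ → ℕ → Prop) (o : ℕ → Ordinal.{0}) : Prop where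
  V_df : Df (Dl A) fun _ e => V (e 0)
  s_df : Df (Dl A) fun _ e => s (e 0) (e 1)
  lt : ∀ {c}, V c → o c < β
  sur : ∀ {γ}, γ < β → ∃ c, V c ∧ o c = γ
  s_iff : ∀ {c d}, s c d ↔ V c ∧ V d ∧ o c < o d
theorem ex_nota {A β} (h : β < w1 A) : ∃ V s o, Nota A β V s o := by
  obtain ⟨r, hr, hwo, ht⟩ := w1_pres h
  have hr2 := relRec_dl hr
  have h1 {t u} [ht : AF (Dl A) t] [hu : AF (Dl A) u] : Df (Dl A) fun F e => r (t F e) (u F e) := Df.sub2 (P := fun _ => r) hr2 ht hu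
  refine ⟨fun n => r n n, fun c d => r c c ∧ r d d ∧ r c d ∧ ¬ r d c, fun c => if h : r c c then @Ordinal.typein _ (fun a b : {n // r n n} => r a.val b.val ∧ ¬ r b.val a.val) hwo ⟨c, h⟩ else 0, inferInstance, inferInstance, fun {c} hc => ?_, fun {γ} hγ => ?_, fun {c d} => ?_⟩
  · rw [dif_pos hc, ← ht]; exact Ordinal.typein_lt_type _ _
  · rw [← ht] at hγ
    obtain ⟨⟨c, hc⟩, e⟩ := Ordinal.typein_surj _ hγ
    exact ⟨c, hc, by rw [dif_pos hc, e]⟩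
  · by_cases hc : r c c
    · by_cases hd : r d d
      · simp only [hc, hd, true_and, dif_pos]
        rw [Ordinal.typein_lt_typein]
      · simp [hd]
    · simp [hc]
section
variable {A : Set ℕ} {β : Ordinal.{0}} {V : ℕ → Prop} {s : ℕ → ℕ → Prop} {o : ℕ → Ordinal.{0}}
theorem lst_cons (x q : ℕ) : lst (Nat.pair x q + 1) = x :: lst q := by
  apply Encodable.encode_injective
  rw [enc_lst, Encodable.encode_list_cons, enc_lst]; rfl
variable (o) in
def PP (q : ℕ) : Pos := (lst q).map fun x => (x.unpair.1, o x.unpair.2)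
variable (V) in
def VQ (q : ℕ) : Prop := ∀ x, x ∈ lst q → V x.unpair.2
variable (V s) in
def IN (q i g d : ℕ) : Prop := V g ∧ (RI 3 i 0 ∨ ∃ a, RI 0 i a ∧ Nat.pair a g ∈ lst q) ∧ (RI 4 i 0 ∨ ∃ a c, RI 1 i a ∧ Nat.pair a c ∈ lst q) ∧ (RI 5 i 0 ∨ (RI 6 i 0 ∧ s d g) ∨ RI 7 i 0)
variable (s) in
def TN (i g d ε : ℕ) : Prop := RI 5 i 0 ∧ ε = g ∨ RI 6 i 0 ∧ ε = d ∨ RI 7 i 0 ∧ s ε g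
theorem PP_cons (j ε q : ℕ) : PP o (Nat.pair (Nat.pair j ε) q + 1) = (j, o ε) :: PP o q := by simp [PP, lst_cons]
theorem VQ_cons {j ε q : ℕ} (h : VQ V q) (he : V ε) : VQ V (Nat.pair (Nat.pair j ε) q + 1) := by
  intro x hx
  rw [lst_cons] at hx
  rcases List.mem_cons.1 hx with rfl | hx
  · simpa using he
  · exact h x hx
theorem mem_PP {q a γ} : (a, γ) ∈ PP o q ↔ ∃ c, Nat.pair a c ∈ lst q ∧ o c = γ := by
  simp only [PP, List.mem_map, Prod.mk.injEq]
  constructor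
  · rintro ⟨x, h, rfl, rfl⟩; exact ⟨_, by rwa [Nat.pair_unpair], rfl⟩
  · rintro ⟨c, h, rfl⟩; exact ⟨_, h, by simp⟩
theorem RI_m {i} : (RI 5 i 0 → ¬ RI 6 i 0 ∧ ¬ RI 7 i 0) ∧ (RI 6 i 0 → ¬ RI 7 i 0) := by
  simp [RI]; omega
theorem bd_PP (N : Nota A β V s o) {q} (h : VQ V q) : bd β (PP o q) := by
  intro x hx
  obtain ⟨y, hy, rfl⟩ := List.mem_map.1 hx
  exact N.lt (h y hy)
theorem in_inst (N : Nota A β V s o) {q i g d} (h : IN V s q i g d) : ∃ T, Inst RI β (PP o q) i (o g) T ∧ ∀ ε' ∈ T, ∃ ε, TN s i g d ε ∧ V ε ∧ o ε = ε' := by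
  obtain ⟨h1, h2, h3, h4⟩ := h
  have h5 : ∃ T, (RI 5 i 0 ∧ T = {o g} ∨ (RI 6 i 0 ∧ ∃ δ < o g, T = {δ}) ∨ RI 7 i 0 ∧ T = Set.Iio (o g)) ∧ ∀ ε' ∈ T, ∃ ε, TN s i g d ε ∧ V ε ∧ o ε = ε' := by
    rcases h4 with h | ⟨h, h5⟩ | h
    · exact ⟨_, Or.inl ⟨h, rfl⟩, by rintro _ rfl; exact ⟨g, Or.inl ⟨h, rfl⟩, h1, rfl⟩⟩
    · obtain ⟨h6, -, h7⟩ := N.s_iff.1 h5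
      exact ⟨_, Or.inr (Or.inl ⟨h, _, h7, rfl⟩), by rintro _ rfl; exact ⟨d, Or.inr (Or.inl ⟨h, rfl⟩), h6, rfl⟩⟩
    · refine ⟨_, Or.inr (Or.inr ⟨h, rfl⟩), fun ε he => ?_⟩
      obtain ⟨c, h6, rfl⟩ := N.sur (lt_trans he (N.lt h1))
      exact ⟨c, Or.inr (Or.inr ⟨h, N.s_iff.2 ⟨h6, h1, he⟩⟩), h6, rfl⟩
  obtain ⟨T, h6, h7⟩ := h5
  exact ⟨T, ⟨N.lt h1, h2.imp_right fun ⟨a, h8, h9⟩ => ⟨a, h8, mem_PP.2 ⟨g, h9, rfl⟩⟩, h3.imp_right fun ⟨a, c, h8, h9⟩ => ⟨a, _, h8, mem_PP.2 ⟨c, h9, rfl⟩⟩, h6⟩, h7⟩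
theorem inst_in (N : Nota A β V s o) {q i γ T} (hq : VQ V q) (h : Inst RI β (PP o q) i γ T) : ∃ g d, IN V s q i g d ∧ ∀ ε, TN s i g d ε → V ε ∧ o ε ∈ T := by
  obtain ⟨h1, h2, h3, h4⟩ := h
  have h5 : ∃ g, V g ∧ o g = γ ∧ (RI 3 i 0 ∨ ∃ a, RI 0 i a ∧ Nat.pair a g ∈ lst q) := by
    rcases h2 with h2 | ⟨a, h2, h5⟩
    · obtain ⟨g, h6, h7⟩ := N.sur h1
      exact ⟨g, h6, h7, Or.inl h2⟩
    · obtain ⟨c, h6, rfl⟩ := mem_PP.1 h5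
      exact ⟨c, by simpa using hq _ h6, rfl, Or.inr ⟨a, h2, h6⟩⟩
  obtain ⟨g, hg, rfl, h5⟩ := h5
  have h3' : RI 4 i 0 ∨ ∃ a c, RI 1 i a ∧ Nat.pair a c ∈ lst q := h3.imp_right fun ⟨a, c, h6, h7⟩ => let ⟨c', h8, _⟩ := mem_PP.1 h7; ⟨a, c', h6, h8⟩
  obtain ⟨m1, m2⟩ := RI_m (i := i)
  rcases h4 with ⟨h, rfl⟩ | ⟨h, δ, hδ, rfl⟩ | ⟨h, rfl⟩
  · refine ⟨g, 0, ⟨hg, h5, h3', Or.inl h⟩, fun ε he => ?_⟩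
    rcases he with ⟨-, rfl⟩ | ⟨h', -⟩ | ⟨h', -⟩
    · exact ⟨hg, rfl⟩
    · exact absurd h' (m1 h).1
    · exact absurd h' (m1 h).2
  · obtain ⟨d, hd, rfl⟩ := N.sur (hδ.trans h1)
    refine ⟨g, d, ⟨hg, h5, h3', Or.inr (Or.inl ⟨h, N.s_iff.2 ⟨hd, hg, hδ⟩⟩)⟩, fun ε he => ?_⟩
    rcases he with ⟨h', -⟩ | ⟨h', rfl⟩ | ⟨h', -⟩
    · exact absurd h (m1 h').1
    · exact ⟨hd, rfl⟩
    · exact absurd h' (m2 h)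
  · refine ⟨g, 0, ⟨hg, h5, h3', Or.inr (Or.inr h)⟩, fun ε he => ?_⟩
    rcases he with ⟨h', -⟩ | ⟨h', -⟩ | ⟨h', h6⟩
    · exact absurd h (m1 h').2
    · exact absurd h (m2 h')
    · obtain ⟨h7, -, h8⟩ := N.s_iff.1 h6
      exact ⟨h7, h8⟩
variable (β V o) in
def Gd (q : ℕ) : Prop := VQ V q ∧ ¬ Wn β (PP o q)
theorem nw_step (N : Nota A β V s o) (hβ : Admissible β) (ho : Ordinal.omega0 < β) {q} (hq : Gd β V o q) {i g d} (h : IN V s q i g d) :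
    ∃ j ε, RI 2 i j ∧ TN s i g d ε ∧ V ε ∧ Gd β V o (Nat.pair (Nat.pair j ε) q + 1) := by
  obtain ⟨T, h1, h2⟩ := in_inst N h
  by_contra hc
  push Not at hc
  refine hq.2 ((adm_close hβ ho RI_df).2 (bd_PP N hq.1) h1 fun j ε hj he => ?_)
  obtain ⟨ε, h3, h4, rfl⟩ := h2 ε he
  by_contra h5
  exact hc j ε hj h3 h4 ⟨VQ_cons hq.1 h4, by rw [PP_cons]; exact h5⟩
theorem gd_df (N : Nota A β V s o) (hβ : Admissible β) (ho : Ordinal.omega0 < β) : Df (Dl A) fun _ e => Gd β V o (e 0) := by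
  have hV {t} [ht : AF (Dl A) t] : Df (Dl A) fun F e => V (t F e) := Df.sub1 (P := fun _ => V) N.V_df ht
  have hs {t u} [ht : AF (Dl A) t] [hu : AF (Dl A) u] : Df (Dl A) fun F e => s (t F e) (u F e) := Df.sub2 (P := fun _ => s) N.s_df ht hu
  have hR {t u w} [ht : AF (Dl A) t] [hu : AF (Dl A) u] [hw : AF (Dl A) w] : Df (Dl A) fun F e => RI (t F e) (u F e) (w F e) := Df.sub3 (P := fun _ => RI) RI_df ht hu hw
  have hVQ : Df (Dl A) fun _ e => VQ V (e 0) := by unfold VQ; infer_instance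
  have hI : Df (Dl A) fun _ e => IN V s (e 3) (e 2) (e 1) (e 0) := by
    have h1 : Df (Dl A) fun _ e => RI 3 (e 2) 0 ∨ ∃ a, RI 0 (e 2) a ∧ Nat.pair a (e 1) ∈ lst (e 3) := inferInstance
    have h2 : Df (Dl A) fun _ e => RI 4 (e 2) 0 ∨ ∃ a c, RI 1 (e 2) a ∧ Nat.pair a c ∈ lst (e 3) := inferInstance
    unfold IN; infer_instance
  have hT : Df (Dl A) fun _ e => TN s (e 4) (e 3) (e 2) (e 0) := by unfold TN; infer_instance
  have hVQ1 {t} [ht : AF (Dl A) t] : Df (Dl A) fun F e => VQ V (t F e) := Df.sub1 (P := fun _ => VQ V) hVQ ht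
  refine Df.mkDl ?_ ?_
  · refine Df.scongr (P := fun _ e => VQ V (e 0) ∧ ∃ X : ℕ → ℕ, X (e 0) = 0 ∧ ∀ q, X q = 0 → VQ V q → ∀ i g d, IN V s q i g d → ∃ j ε, RI 2 i j ∧ TN s i g d ε ∧ X (Nat.pair (Nat.pair j ε) q + 1) = 0) ?_ fun F e => and_congr_right fun hq => ?_
    · have : Df (Dl A) fun F e => ∀ q, F 0 q = 0 → VQ V q → ∀ i g d, IN V s q i g d → ∃ j ε, RI 2 i j ∧ TN s i g d ε ∧ F 0 (Nat.pair (Nat.pair j ε) q + 1) = 0 := by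
        have hT' : Df (Dl A) fun _ e => TN s (e 4) (e 3) (e 2) (e 0) := hT
        infer_instance
      infer_instance
    · constructor
      · intro h
        refine ⟨fun q => if Gd β V o q then 0 else 1, if_pos ⟨hq, h⟩, fun q hX _ i g d hI => ?_⟩
        have hg : Gd β V o q := by by_contra h; simp [h] at hX
        obtain ⟨j, ε, h1, h2, -, h3⟩ := nw_step N hβ ho hg hI
        exact ⟨j, ε, h1, h2, if_pos h3⟩
      · rintro ⟨X, h1, h2⟩ ⟨ξ, -, h3⟩
        generalize e 0 = q at *
        generalize hp : PP o q = p at h3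
        induction h3 generalizing q with
        | mk ξ p i γ T f h4 _ _ ih =>
          subst hp
          obtain ⟨g, d, h5, h6⟩ := inst_in N hq h4
          obtain ⟨j, ε, h7, h8, h9⟩ := h2 q h1 hq i g d h5
          exact ih j (o ε) h7 (h6 ε h8).2 _ (VQ_cons hq (h6 ε h8).1) h9 (PP_cons _ _ _)
  · refine Df.scongr (P := fun _ e => ¬ VQ V (e 0) ∨ VQ V (e 0) ∧ ∃ f : ℕ → ℕ, ¬ f (e 0) = 0 ∧ ∀ q c, VQ V q → f q = c + 1 → V c ∧ ∃ i g d, IN V s q i g d ∧ ∀ j ε, RI 2 i j → TN s i g d ε → ∃ c', f (Nat.pair (Nat.pair j ε) q + 1) = c' + 1 ∧ s c' c) ?_ fun F e => ?_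
    · have hI' : Df (Dl A) fun _ e => IN V s (e 4) (e 2) (e 1) (e 0) := hI.ren (push 0 (push 1 (push 2 fun _ => 4))) id
      have : Df (Dl A) fun F e => ∀ q c, VQ V q → F 0 q = c + 1 → V c ∧ ∃ i g d, IN V s q i g d ∧ ∀ j ε, RI 2 i j → TN s i g d ε → ∃ c', F 0 (Nat.pair (Nat.pair j ε) q + 1) = c' + 1 ∧ s c' c := by
        infer_instance
      infer_instance
    · by_cases hq : VQ V (e 0)
      swap
      · simp [Gd, hq]
      simp only [Gd, hq, not_true_eq_false, true_and, not_not, false_or]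
      generalize e 0 = q at *
      constructor
      · intro hW
        choose nc n1 n2 using fun γ : Set.Iio β => N.sur γ.2
        obtain ⟨lab, l1, l2⟩ : ∃ lab : ℕ → Ordinal.{0}, (∀ q ξ, W RI β ξ (PP o q) → lab q ≤ ξ) ∧ ∀ q, Wn β (PP o q) → W RI β (lab q) (PP o q) :=
          ⟨fun q => sInf {ξ | W RI β ξ (PP o q)}, fun q ξ h => csInf_le' (Set.mem_setOf.2 h), fun q ⟨ξ, _, h⟩ => csInf_mem (s := {ξ | W RI β ξ (PP o q)}) ⟨ξ, h⟩⟩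
        have hm q (h : Wn β (PP o q)) : lab q < β := let ⟨ξ, h1, h2⟩ := h; (l1 _ _ h2).trans_lt h1
        refine ⟨fun q => if h : Wn β (PP o q) then nc ⟨_, hm q h⟩ + 1 else 0, by simp [hW], fun q c hq h => ?_⟩
        dsimp only at h
        split_ifs at h with hw
        obtain rfl : nc ⟨_, hm q hw⟩ = c := by omega
        refine ⟨n1 _, ?_⟩
        have h1 := l2 q hw
        have h0 : o (nc ⟨_, hm q hw⟩) = lab q := n2 ⟨_, hm q hw⟩
        have h00 := n1 ⟨_, hm q hw⟩
        have h000 := hm q hw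
        generalize nc ⟨_, hm q hw⟩ = c at *
        clear h
        generalize lab q = ξ at h1 h0 h000
        generalize hp : PP o q = p at h1
        obtain ⟨_, _, i, γ, T, f, h4, h5, h6⟩ := h1
        subst hp
        obtain ⟨g, d, h7, h8⟩ := inst_in N hq h4
        refine ⟨i, g, d, h7, fun j ε hj he => ?_⟩
        obtain ⟨h9, h10⟩ := h8 ε he
        have h11 := h6 j _ hj h10
        have h12 := h5 j _ hj h10
        rw [← PP_cons] at h11
        have h13 : Wn β (PP o (Nat.pair (Nat.pair j ε) q + 1)) := ⟨_, h12.trans h000, h11⟩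
        refine ⟨nc ⟨_, hm _ h13⟩, dif_pos h13, N.s_iff.2 ⟨n1 _, h00, ?_⟩⟩
        rw [n2, h0]
        exact (l1 _ _ h11).trans_lt h12
      · rintro ⟨f, h1, h2⟩
        have key : ∀ ξ q c, o c = ξ → VQ V q → f q = c + 1 → W RI β (o c) (PP o q) := by
          intro ξ
          induction ξ using WellFoundedLT.induction with
          | ind ξ ih =>
            rintro q c rfl hq hf
            obtain ⟨hc, i, g, d, h3, h4⟩ := h2 q c hq hf
            obtain ⟨T, h5, h6⟩ := in_inst N h3
            refine W.mk' h5 fun j ε hj he => ?_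
            obtain ⟨ε, h7, h8, rfl⟩ := h6 ε he
            obtain ⟨c', h9, h10⟩ := h4 j ε hj h7
            obtain ⟨-, -, h11⟩ := N.s_iff.1 h10
            have := ih _ h11 _ c' rfl (VQ_cons hq h8) h9
            rw [PP_cons] at this
            exact ⟨_, h11, this⟩
        obtain ⟨c, hc⟩ := Nat.exists_eq_succ_of_ne_zero h1
        exact ⟨_, N.lt (h2 q c hq hc).1, key _ q c rfl hq hc⟩
end
section
variable {A : Set ℕ} {β : Ordinal.{0}} {V : ℕ → Prop} {s : ℕ → ℕ → Prop} {o : ℕ → Ordinal.{0}}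
variable (β V s o) in
def Nx (t q q' : ℕ) : Prop := Gd β V o q' ∧ (∀ x, x ∈ lst q → x ∈ lst q') ∧
  (IN V s q t.unpair.1.unpair.1 t.unpair.1.unpair.2 t.unpair.2.unpair.1 → ∃ j ε, RI 2 t.unpair.1.unpair.1 j ∧ TN s t.unpair.1.unpair.1 t.unpair.1.unpair.2 t.unpair.2.unpair.1 ε ∧ Nat.pair j ε ∈ lst q') ∧
  ∃ c, Nat.pair (cl 0 0 0 (t.unpair.2.unpair.2+1)) c ∈ lst q' ∨ Nat.pair (cl 0 0 (t.unpair.2.unpair.2+1) 0) c ∈ lst q'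
theorem nx_ex (N : Nota A β V s o) (hβ : Admissible β) (ho : Ordinal.omega0 < β) (t : ℕ) {q} (hq : Gd β V o q) : ∃ q', Nx β V s o t q q' := by
  have h1 : ∃ q', Gd β V o q' ∧ (∀ x, x ∈ lst q → x ∈ lst q') ∧
    (IN V s q t.unpair.1.unpair.1 t.unpair.1.unpair.2 t.unpair.2.unpair.1 → ∃ j ε, RI 2 t.unpair.1.unpair.1 j ∧ TN s t.unpair.1.unpair.1 t.unpair.1.unpair.2 t.unpair.2.unpair.1 ε ∧ Nat.pair j ε ∈ lst q') := by
    by_cases h : IN V s q t.unpair.1.unpair.1 t.unpair.1.unpair.2 t.unpair.2.unpair.1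
    · obtain ⟨j, ε, h1, h2, -, h3⟩ := nw_step N hβ ho hq h
      exact ⟨_, h3, fun x hx => by rw [lst_cons]; exact List.mem_cons_of_mem _ hx, fun _ => ⟨j, ε, h1, h2, by rw [lst_cons]; exact List.mem_cons_self⟩⟩
    · exact ⟨q, hq, fun _ => id, fun h' => absurd h' h⟩
  obtain ⟨q1, h1, h2, h3⟩ := h1
  have h4 : ∃ j c, V c ∧ Gd β V o (Nat.pair (Nat.pair j c) q1 + 1) ∧ (j = cl 0 0 0 (t.unpair.2.unpair.2+1) ∨ j = cl 0 0 (t.unpair.2.unpair.2+1) 0) := by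
    rcases decide_u hβ ho (bd_PP N h1.1) h1.2 t.unpair.2.unpair.2 with h | ⟨γ, hγ, h⟩
    · obtain ⟨c, hc, e⟩ := N.sur (Ordinal.omega0_pos.trans ho)
      exact ⟨_, c, hc, ⟨VQ_cons h1.1 hc, by rwa [PP_cons, e]⟩, Or.inl rfl⟩
    · obtain ⟨c, hc, e⟩ := N.sur hγ
      exact ⟨_, c, hc, ⟨VQ_cons h1.1 hc, by rwa [PP_cons, e]⟩, Or.inr rfl⟩
  obtain ⟨j, c, -, h5, h6⟩ := h4
  have h7 : ∀ x, x ∈ lst q1 → x ∈ lst (Nat.pair (Nat.pair j c) q1 + 1) := fun x hx => by rw [lst_cons]; exact List.mem_cons_of_mem _ hx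
  refine ⟨_, h5, fun x hx => h7 x (h2 x hx), fun h => let ⟨j, ε, a, b, d⟩ := h3 h; ⟨j, ε, a, b, h7 _ d⟩, c, ?_⟩
  rcases h6 with rfl | rfl
  · left; rw [lst_cons]; exact List.mem_cons_self
  · right; rw [lst_cons]; exact List.mem_cons_self
theorem ex_seq (N : Nota A β V s o) (hβ : Admissible β) (ho : Ordinal.omega0 < β) (h : β < w1 A) :
    ∃ f : ℕ → ℕ, HF A f ∧ (∀ k, Gd β V o (f k)) ∧ ∀ k, Nx β V s o k.unpair.1 (f k) (f (k+1)) := by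
  have g0 : Gd β V o 0 := ⟨fun x hx => by simp [lst_0] at hx, fun ⟨ξ, _, hW⟩ => sound h hW (by simp [PP, lst_0])⟩
  let f : ℕ → ℕ := fun k => Nat.rec 0 (fun k q => if h : ∃ q', Nx β V s o k.unpair.1 q q' then Nat.find h else 0) k
  have fs (k) : f (k+1) = if h : ∃ q', Nx β V s o k.unpair.1 (f k) q' then Nat.find h else 0 := rfl
  have fg : ∀ k, Gd β V o (f k) := by
    intro k
    induction k with
    | zero => exact g0
    | succ k ih =>
      have h := nx_ex N hβ ho k.unpair.1 ih
      rw [fs, dif_pos h]; exact (Nat.find_spec h).1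
  have fn (k) : Nx β V s o k.unpair.1 (f k) (f (k+1)) ∧ ∀ y, y < f (k+1) → ¬ Nx β V s o k.unpair.1 (f k) y := by
    have h := nx_ex N hβ ho k.unpair.1 (fg k)
    rw [fs, dif_pos h]; exact ⟨Nat.find_spec h, fun y => Nat.find_min h⟩
  refine ⟨f, HF.sg ?_, fg, fun k => (fn k).1⟩
  have hV {t} [ht : AF (Dl A) t] : Df (Dl A) fun F e => V (t F e) := Df.sub1 (P := fun _ => V) N.V_df ht
  have hs {t u} [ht : AF (Dl A) t] [hu : AF (Dl A) u] : Df (Dl A) fun F e => s (t F e) (u F e) := Df.sub2 (P := fun _ => s) N.s_df ht hu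
  have hR {t u w} [ht : AF (Dl A) t] [hu : AF (Dl A) u] [hw : AF (Dl A) w] : Df (Dl A) fun F e => RI (t F e) (u F e) (w F e) := Df.sub3 (P := fun _ => RI) RI_df ht hu hw
  have hG {t} [ht : AF (Dl A) t] : Df (Dl A) fun F e => Gd β V o (t F e) := Df.sub1 (P := fun _ => Gd β V o) (gd_df N hβ ho) ht
  have hN : Df (Dl A) fun _ e => Nx β V s o (e 0) (e 1) (e 2) := by
    have h1 : Df (Dl A) fun _ e => IN V s (e 1) (e 0).unpair.1.unpair.1 (e 0).unpair.1.unpair.2 (e 0).unpair.2.unpair.1 := by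
      have h1 : Df (Dl A) fun _ e => RI 3 (e 0).unpair.1.unpair.1 0 ∨ ∃ a, RI 0 (e 0).unpair.1.unpair.1 a ∧ Nat.pair a (e 0).unpair.1.unpair.2 ∈ lst (e 1) := inferInstance
      have h2 : Df (Dl A) fun _ e => RI 4 (e 0).unpair.1.unpair.1 0 ∨ ∃ a c, RI 1 (e 0).unpair.1.unpair.1 a ∧ Nat.pair a c ∈ lst (e 1) := inferInstance
      unfold IN; infer_instance
    have h2 : Df (Dl A) fun _ e => ∃ j ε, RI 2 (e 0).unpair.1.unpair.1 j ∧ TN s (e 0).unpair.1.unpair.1 (e 0).unpair.1.unpair.2 (e 0).unpair.2.unpair.1 ε ∧ Nat.pair j ε ∈ lst (e 2) := by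
      have hT : Df (Dl A) fun _ e => TN s (e 2).unpair.1.unpair.1 (e 2).unpair.1.unpair.2 (e 2).unpair.2.unpair.1 (e 0) := by unfold TN; infer_instance
      infer_instance
    have h3 : Df (Dl A) fun _ e => ∃ c, Nat.pair (cl 0 0 0 ((e 0).unpair.2.unpair.2+1)) c ∈ lst (e 2) ∨ Nat.pair (cl 0 0 ((e 0).unpair.2.unpair.2+1) 0) c ∈ lst (e 2) := by
      unfold cl; infer_instance
    unfold Nx; infer_instance
  have hN' {t u w} [ht : AF (Dl A) t] [hu : AF (Dl A) u] [hw : AF (Dl A) w] : Df (Dl A) fun F e => Nx β V s o (t F e) (u F e) (w F e) := Df.sub3 (P := fun _ => Nx β V s o) hN ht hu hw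
  refine Df.scongr (P := fun _ e => ∃ h : ℕ → ℕ, h 0 = 0 ∧ (∀ j, Nx β V s o j.unpair.1 (h j) (h (j+1)) ∧ ∀ y, y < h (j+1) → ¬ Nx β V s o j.unpair.1 (h j) y) ∧ h (e 0) = e 1) ?_ fun F e => ?_
  · have : Df (Dl A) fun F e => F 0 0 = 0 ∧ (∀ j, Nx β V s o j.unpair.1 (F 0 j) (F 0 (j+1)) ∧ ∀ y, y < F 0 (j+1) → ¬ Nx β V s o j.unpair.1 (F 0 j) y) ∧ F 0 (e 0) = e 1 := inferInstance
    infer_instance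
  · constructor
    · intro h; exact ⟨f, rfl, fn, h⟩
    · rintro ⟨h, h0, h1, h2⟩
      have : ∀ k, h k = f k := by
        intro k
        induction k with
        | zero => exact h0
        | succ k ih =>
          have a := h1 k
          have b := fn k
          rw [ih] at a
          rcases lt_trichotomy (h (k+1)) (f (k+1)) with c | c | c
          · exact absurd a.1 (b.2 _ c)
          · exact c
          · exact absurd b.1 (a.2 _ c)
      rw [← this, h2]
structure Gen (A : Set ℕ) (V : ℕ → Prop) (s : ℕ → ℕ → Prop) (G : ℕ → ℕ → Prop) : Prop where
  df : Df (Dl A) fun _ e => G (e 0) (e 1)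
  v : ∀ {a c}, G a c → V c
  st : ∀ i g d, V g → (RI 3 i 0 ∨ ∃ a, RI 0 i a ∧ G a g) → (RI 4 i 0 ∨ ∃ a c, RI 1 i a ∧ G a c) → (RI 5 i 0 ∨ (RI 6 i 0 ∧ s d g) ∨ RI 7 i 0) → ∃ j ε, RI 2 i j ∧ TN s i g d ε ∧ G j ε
  de : ∀ u, ∃ c, G (cl 0 0 0 (u+1)) c ∨ G (cl 0 0 (u+1) 0) c
theorem ex_gen (N : Nota A β V s o) (hβ : Admissible β) (ho : Ordinal.omega0 < β) (h : β < w1 A) : ∃ G, Gen A V s G := by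
  obtain ⟨f, hf, fg, fn⟩ := ex_seq N hβ ho h
  have mono : ∀ {k l}, k ≤ l → ∀ x, x ∈ lst (f k) → x ∈ lst (f l) := by
    intro k l hkl
    induction hkl with
    | refl => exact fun _ => id
    | step _ ih => exact fun x hx => (fn _).2.1 x (ih x hx)
  refine ⟨fun a c => ∃ t, Nat.pair a c ∈ lst (f t), ?_, fun {a c} ⟨t, h⟩ => by simpa using (fg t).1 _ h, fun i g d h1 h2 h3 h4 => ?_, fun u => ?_⟩
  · have : AF (Dl A) fun _ e => f (e 0) := hf
    infer_instance
  · have h2' : ∃ t, RI 3 i 0 ∨ ∃ a, RI 0 i a ∧ Nat.pair a g ∈ lst (f t) := by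
      rcases h2 with h | ⟨a, h, t, h'⟩
      exacts [⟨0, Or.inl h⟩, ⟨t, Or.inr ⟨a, h, h'⟩⟩]
    have h3' : ∃ t, RI 4 i 0 ∨ ∃ a c, RI 1 i a ∧ Nat.pair a c ∈ lst (f t) := by
      rcases h3 with h | ⟨a, c, h, t, h'⟩
      exacts [⟨0, Or.inl h⟩, ⟨t, Or.inr ⟨a, c, h, h'⟩⟩]
    obtain ⟨t, h2⟩ := h2'
    obtain ⟨t', h3⟩ := h3'
    have l1 := Nat.right_le_pair (Nat.pair (Nat.pair i g) (Nat.pair d 0)) (t + t')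
    have h5 := (fn (Nat.pair (Nat.pair (Nat.pair i g) (Nat.pair d 0)) (t + t'))).2.2.1
    simp only [Nat.unpair_pair] at h5
    obtain ⟨j, ε, a, b, c⟩ := h5 ⟨h1, h2.imp_right fun ⟨a, b, c⟩ => ⟨a, b, mono (by omega) _ c⟩, h3.imp_right fun ⟨a, c, b, d⟩ => ⟨a, c, b, mono (by omega) _ d⟩, h4⟩
    exact ⟨j, ε, a, b, _, c⟩
  · obtain ⟨c, h5⟩ := (fn (Nat.pair (Nat.pair 0 (Nat.pair 0 u)) 0)).2.2.2
    simp only [Nat.unpair_pair] at h5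
    exact ⟨c, h5.imp (fun h => ⟨_, h⟩) fun h => ⟨_, h⟩⟩
end
theorem gen {A : Set ℕ} {β : Ordinal.{0}} (hβ : Admissible β) (ho : Ordinal.omega0 < β) (h : β < w1 A) : ∃ B, SpectorRel B A ∧ w1 B = β := by
  obtain ⟨V, s, o, N⟩ := ex_nota h
  obtain ⟨G, hG⟩ := ex_gen N hβ ho h
  obtain ⟨c0, hc0, -⟩ := N.sur (Ordinal.omega0_pos.trans ho)
  have hI {n m} (hn : ∃ a c, G a c ∧ cS a = n) (hm : ∃ a c, G a c ∧ cS a = m) : ¬ Inc n m := by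
    intro hi
    obtain ⟨a, c, h1, h2⟩ := hn
    obtain ⟨a', c', h3, h4⟩ := hm
    obtain ⟨j, ε, h5, -⟩ := hG.st (Nat.pair 0 (Nat.pair n m)) c 0 (hG.v h1) (Or.inr ⟨a, by simp [RI, h2], h1⟩) (Or.inr ⟨a', c', by simp [RI, h4, hi], h3⟩) (by simp [RI])
    exact C0 h5
  have hS (k) : ∃ n, (∃ a c, G a c ∧ cS a = n) ∧ (lst n).length = k ∧ ∀ x, x ∈ lst n → x ≤ 1 := by
    obtain ⟨j, ε, h5, -, h6⟩ := hG.st (Nat.pair 1 k) c0 0 hc0 (by simp [RI]) (by simp [RI]) (by simp [RI])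
    obtain ⟨n, h7, rfl⟩ := C1.1 h5
    exact ⟨n, ⟨_, _, h6, clS⟩, h7⟩
  let B : Set ℕ := {k | ∃ q a c, G a c ∧ cS a = Nat.pair 1 q + 1 ∧ (lst q).length = k}
  have hB : Df (Dl A) fun _ e => e 0 ∈ B := by
    have hg {t u} [ht : AF (Dl A) t] [hu : AF (Dl A) u] : Df (Dl A) fun F e => G (t F e) (u F e) := Df.sub2 (P := fun _ => G) hG.df ht hu
    show Df (Dl A) fun _ e => ∃ q a c, G a c ∧ a.unpair.1.unpair.1 = Nat.pair 1 q + 1 ∧ (lst q).length = e 0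
    infer_instance
  have eqn {n m} (hn : ∃ a c, G a c ∧ cS a = n) (hm : ∃ a c, G a c ∧ cS a = m) (hl : (lst n).length ≤ (lst m).length) : (lst m).drop ((lst m).length - (lst n).length) = lst n := by
    by_contra hc; exact hI hn hm ⟨hl, hc⟩
  have hR : ∀ k n, (∃ a c, G a c ∧ cS a = n) → (lst n).length = k → lst n = rs (charFun B) k := by
    intro k
    induction k with
    | zero => intro n _ h; rw [List.length_eq_zero_iff.1 h]; rfl
    | succ k ih =>
      intro n hn hl
      obtain ⟨n1, h1, h2, h3⟩ := hS (k+1)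
      have e1 : lst n1 = lst n := by simpa [hl, h2] using eqn hn h1 (by rw [hl, h2])
      rw [e1] at h3
      obtain ⟨n2, h4, h5, -⟩ := hS k
      have e2 := eqn h4 hn (by rw [hl, h5]; omega)
      rw [hl, h5, ih n2 h4 h5] at e2
      obtain ⟨x, l, h6⟩ := List.exists_cons_of_length_eq_add_one hl
      rw [h6] at e2 h3 hl
      simp at e2 hl
      have hq : n = Nat.pair x (Encodable.encode l) + 1 := lst_inj (by rw [lst_cons, lst_enc, h6])
      have hx : charFun B k = x := by
        by_cases hk : k ∈ B
        · obtain ⟨q, a, c, h7, h8, h9⟩ := hk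
          have e3 := eqn ⟨a, c, h7, h8⟩ hn (by rw [lst_cons, h6]; simp [h9, hl])
          rw [lst_cons, h6] at e3
          simp [h9, hl] at e3
          rw [charFun, if_pos ⟨q, a, c, h7, h8, h9⟩, e3.1]
        · have : x ≠ 1 := by
            rintro rfl
            obtain ⟨a, c, h7, h8⟩ := hn
            exact hk ⟨_, a, c, h7, h8.trans hq, by rw [lst_enc, hl]⟩
          have := h3 x (by simp)
          rw [charFun, if_neg hk]; omega
      rw [h6, rs, hx, e2]
  have tr1 {n m u} (hn : ∃ a c, G a c ∧ cS a = n) (hE : Eg n m u) : tr B m u := (eg_tr.1 ⟨hE, hR _ n hn rfl⟩).1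
  have tr2 {m u} (ht : tr B m u) : ∃ n, (∃ a c, G a c ∧ cS a = n) ∧ Eg n m u := by
    obtain ⟨h1, h2⟩ := eg_tr.2 ⟨ht, rfl⟩
    obtain ⟨n, h3, h4, -⟩ := hS (nd m).2.2.length
    refine ⟨n, h3, ?_⟩
    have : n = Encodable.encode (rs (charFun B) (nd m).2.2.length) := lst_inj (by rw [lst_enc, hR _ n h3 h4])
    rw [this]; exact h1
  have hL : ∀ γ : Ordinal.{0}, ∀ a c u, G a c → o c = γ → cL a = u + 1 → Acc (tr B) u ∧ rk (tr B) u ≤ γ := by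
    intro γ
    induction γ using WellFoundedLT.induction with
    | _ γ ih =>
      intro a c u h1 h2 h3
      have h4 : ∀ m, tr B m u → Acc (tr B) m ∧ rk (tr B) m < γ := by
        intro m hm
        obtain ⟨n, ⟨a', c', h5, h6⟩, h7⟩ := tr2 hm
        obtain ⟨j, ε, h8, h9, h10⟩ := hG.st (Nat.pair 4 (Nat.pair u (Nat.pair n m))) c 0 (hG.v h1) (Or.inr ⟨a, by simp [RI, h3], h1⟩) (Or.inr ⟨a', c', by simp [RI, h6, h7], h5⟩) (by simp [RI])
        rw [C4] at h8
        have h11 : o ε < γ := by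
          simp [TN, RI] at h9
          rw [← h2]; exact (N.s_iff.1 h9).2.2
        obtain ⟨h12, h13⟩ := ih _ h11 j ε m h10 rfl (by rw [h8]; simp)
        exact ⟨h12, h13.trans_lt h11⟩
      have h5 : Acc (tr B) u := ⟨_, fun m hm => (h4 m hm).1⟩
      exact ⟨h5, (rk_le h5).2 fun m hm => (h4 m hm).2⟩
  have hGe : ∀ γ : Ordinal.{0}, ∀ a c u, G a c → o c = γ → cG a = u + 1 → Acc (tr B) u → γ ≤ rk (tr B) u := by
    intro γ
    induction γ using WellFoundedLT.induction with
    | _ γ ih =>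
      intro a c u h1 h2 h3 h4
      refine le_of_forall_lt fun δ hδ => ?_
      have h5 := N.lt (hG.v h1)
      rw [h2] at h5
      obtain ⟨d, h6, rfl⟩ := N.sur (hδ.trans h5)
      obtain ⟨j, ε, h8, h9, h10⟩ := hG.st (Nat.pair 3 u) c d (hG.v h1) (Or.inr ⟨a, by simp [RI, h3], h1⟩) (by simp [RI]) (by simp [RI, N.s_iff, h6, hG.v h1, h2, hδ])
      obtain ⟨n, m, h11, rfl⟩ := C3.1 h8
      have h12 : ε = d := by simpa [TN, RI] using h9
      subst h12
      have h13 := tr1 ⟨_, _, h10, clS⟩ h11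
      exact (ih _ hδ _ ε m h10 rfl (by simp) (h4.inv h13)).trans_lt (rk_lt h4 h13)
  have hIl : ∀ u, Acc (tr B) u → ∀ a c, G a c → cI a ≠ u + 1 := by
    intro u hu
    induction hu with
    | intro u _ ih =>
      intro a c h1 h2
      obtain ⟨j, ε, h8, -, h10⟩ := hG.st (Nat.pair 6 u) c 0 (hG.v h1) (Or.inr ⟨a, by simp [RI, h2], h1⟩) (by simp [RI]) (by simp [RI])
      obtain ⟨n, m, h11, rfl⟩ := C6.1 h8
      exact ih m (tr1 ⟨_, _, h10, clS⟩ h11) _ ε h10 (by simp)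
  have hw : w1 B = β := by
    apply le_antisymm
    · refine le_of_forall_lt fun δ hδ => ?_
      obtain ⟨u, h1, rfl⟩ := lt_w1.1 hδ
      obtain ⟨c, h2 | h2⟩ := hG.de u
      · exact absurd clI (hIl u h1 _ c h2)
      · exact (hL _ _ c u h2 rfl clL).2.trans_lt (N.lt (hG.v h2))
    · refine le_of_forall_lt fun δ hδ => ?_
      obtain ⟨g, h1, rfl⟩ := N.sur hδ
      obtain ⟨j, ε, h8, h9, h10⟩ := hG.st (Nat.pair 2 0) g 0 h1 (by simp [RI]) (by simp [RI]) (by simp [RI])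
      obtain ⟨u, rfl⟩ := C2.1 h8
      have h12 : ε = g := by simpa [TN, RI] using h9
      subst h12
      obtain ⟨h13, -⟩ := hL _ _ ε u h10 rfl (by simp)
      exact (hGe _ _ ε u h10 rfl (by simp) h13).trans_lt (rk_lt_w1 h13)
  exact ⟨B, F7b hB (hw ▸ h), hw⟩
theorem fin_V (n : ℕ) : {x : ZFSet.{0} | x.rank < n}.Finite := by
  induction n with
  | zero => simp
  | succ n ih =>
    have h := ih.finite_subsets
    refine Set.Finite.of_finite_image (f := fun x : ZFSet.{0} => {y | y ∈ x}) (h.subset ?_) ?_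
    · rintro _ ⟨x, hx, rfl⟩ y hy
      have h1 := ZFSet.rank_lt_of_mem hy
      have h2 : x.rank < (n : Ordinal) + 1 := by simpa using hx
      exact h1.trans_le (Order.lt_add_one_iff.1 h2)
    · intro x _ y _ hxy
      exact ZFSet.ext fun z => Set.ext_iff.1 hxy z
theorem adm_omega : Admissible Ordinal.omega0 := by
  rw [adm_iff]
  have hm {x : ZFSet.{0}} : x ∈ ZFSet.vonNeumann Ordinal.omega0 ↔ x.rank < Ordinal.omega0 := ZFSet.mem_vonNeumann
  have ht : (ZFSet.vonNeumann Ordinal.omega0).IsTransitive := ZFSet.isTransitive_vonNeumann _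
  have hs {k : Ordinal.{0}} (h : k < Ordinal.omega0) : k + 1 < Ordinal.omega0 := Ordinal.isSuccLimit_omega0.succ_lt h
  refine ⟨_, ht, ⟨fun x y h => ?_, ?_, fun x y => ?_, fun x => ?_, fun n θ _ xs => ?_, fun n θ _ xs h => ?_⟩, ZFSet.rank_vonNeumann _⟩
  · refine Subtype.ext (ZFSet.ext fun z => ⟨fun hz => (h ⟨z, ht.mem_trans hz x.2⟩).1 hz, fun hz => (h ⟨z, ht.mem_trans hz y.2⟩).2 hz⟩)
  · exact ⟨⟨∅, hm.2 (by simp [Ordinal.omega0_pos])⟩, fun y => ZFSet.notMem_empty _⟩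
  · refine ⟨⟨{x.1, y.1}, hm.2 ?_⟩, by simp, by simp⟩
    rw [ZFSet.rank_pair]
    exact max_lt (hs (hm.1 x.2)) (hs (hm.1 y.2))
  · exact ⟨⟨x.1.sUnion, hm.2 ((ZFSet.rank_sUnion_le _).trans_lt (hm.1 x.2))⟩, fun z w h1 h2 => ZFSet.mem_sUnion.2 ⟨w.1, h2, h1⟩⟩
  · refine ⟨⟨ZFSet.sep (fun z => ∃ h : z ∈ ZFSet.vonNeumann Ordinal.omega0, rz _ θ (Fin.snoc xs ⟨z, h⟩)) (xs (Fin.last n)).1, hm.2 ((ZFSet.rank_mono ?_).trans_lt (hm.1 (xs (Fin.last n)).2))⟩, fun x => ?_⟩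
    · intro z hz; exact (ZFSet.mem_sep.1 hz).1
    · rw [ZFSet.mem_sep]
      exact and_congr_right fun _ => ⟨fun ⟨_, h⟩ => h, fun h => ⟨x.2, h⟩⟩
  · obtain ⟨N, hN⟩ := Ordinal.lt_omega0.1 (hm.1 (xs (Fin.last n)).2)
    have h1 : ∀ x : ZFSet.{0}, ∃ k : ℕ, ∀ h' : x ∈ ZFSet.vonNeumann Ordinal.omega0, x ∈ (xs (Fin.last n)).1 → ∃ y : El (ZFSet.vonNeumann Ordinal.omega0), y.1.rank = k ∧ rz _ θ (Fin.snoc (Fin.snoc xs ⟨x, h'⟩ : Fin (n+2) → El _) y) := by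
      intro x
      by_cases hx : x ∈ ZFSet.vonNeumann Ordinal.omega0 ∧ x ∈ (xs (Fin.last n)).1
      · obtain ⟨y, hy⟩ := h ⟨x, hx.1⟩ hx.2
        obtain ⟨k, hk⟩ := Ordinal.lt_omega0.1 (hm.1 y.2)
        exact ⟨k, fun _ _ => ⟨y, hk, hy⟩⟩
      · exact ⟨0, fun h1 h2 => absurd ⟨h1, h2⟩ hx⟩
    choose k hk using h1
    obtain ⟨K, hK⟩ := ((fin_V N).image k).bddAbove
    refine ⟨⟨ZFSet.vonNeumann (K+1 : ℕ), hm.2 (by rw [ZFSet.rank_vonNeumann]; exact Ordinal.natCast_lt_omega0 _)⟩, fun x hx => ?_⟩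
    obtain ⟨y, h2, h3⟩ := hk x.1 x.2 hx
    refine ⟨y, ZFSet.mem_vonNeumann.2 ?_, h3⟩
    rw [h2]
    have : k x.1 ≤ K := hK ⟨x.1, by rw [Set.mem_setOf_eq, ← hN]; exact ZFSet.rank_lt_of_mem hx, rfl⟩
    exact_mod_cast Nat.lt_succ_of_le this
theorem adm_ge {β : Ordinal.{0}} (h : Admissible β) : Ordinal.omega0 ≤ β := by
  obtain ⟨x, h1, h2, rfl⟩ := (adm_iff β).1 h
  haveI : KM x := ⟨h1, h2⟩
  rw [Ordinal.omega0_le]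
  intro n
  apply le_of_lt
  induction n with
  | zero => simpa using ZFSet.rank_lt_of_mem (M_emp (M := x))
  | succ n ih => simpa using M_lim ih
theorem main (hwf : WellFounded SpectorRel) (A : Set ℕ) : (∀ c < 1 + (hwf.apply A).rank, Ordinal.enumOrd {o | Admissible o} c < omega1 A) ∧
    omega1 A = Ordinal.enumOrd {o | Admissible o} (1 + (hwf.apply A).rank) := by
  induction A using hwf.induction with
  | _ A ih =>
    have h0 : ∀ c < 1 + (hwf.apply A).rank, Ordinal.enumOrd {o | Admissible o} c < omega1 A := by
      intro c hc
      by_cases h1 : c < 1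
      · rw [Ordinal.lt_one_iff_zero.1 h1]
        refine lt_of_le_of_lt (Ordinal.enumOrd_le_of_forall_lt adm_omega fun b hb => absurd hb _root_.not_lt_zero) ?_
        rw [omega1_eq]; exact omega_lt_w1 A
      · obtain ⟨c', rfl⟩ : ∃ c', c = 1 + c' := ⟨c - 1, (Ordinal.add_sub_cancel_of_le (not_lt.1 h1)).symm⟩
        have hc' : c' < (hwf.apply A).rank := lt_of_add_lt_add_left hc
        rw [Acc.rank_eq, Ordinal.lt_iSup_iff] at hc'
        obtain ⟨⟨B, hB⟩, h2⟩ := hc'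
        have h3 : c' ≤ (hwf.apply B).rank := Order.lt_succ_iff.1 h2
        have h4 : omega1 B < omega1 A := by rw [omega1_eq, omega1_eq]; exact F7a hB
        rcases h3.lt_or_eq with h3 | h3
        · exact ((ih B hB).1 _ (by gcongr)).trans h4
        · rw [h3, ← (ih B hB).2]; exact h4
    refine ⟨h0, le_antisymm ?_ (Ordinal.enumOrd_le_of_forall_lt (adm_omega1 A) h0)⟩
    rw [Ordinal.enumOrd]
    refine le_csInf ⟨_, adm_omega1 A, h0⟩ ?_
    rintro b ⟨hb, hb2⟩
    by_contra hlt
    rw [not_le, omega1_eq] at hlt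
    have e0 : Ordinal.omega0 ≤ Ordinal.enumOrd {o | Admissible o} 0 := by
      rw [Ordinal.enumOrd]
      exact le_csInf ⟨_, adm_omega, fun c hc => absurd hc _root_.not_lt_zero⟩ fun b hb => adm_ge hb.1
    have h1 := e0.trans_lt (hb2 0 (lt_of_lt_of_le zero_lt_one le_self_add))
    obtain ⟨B, hB, h2⟩ := gen hb h1 hlt
    have h3 := hb2 (1 + (hwf.apply B).rank) (by gcongr; exact Acc.rank_lt_of_rel _ hB)
    rw [← (ih B hB).2, omega1_eq, h2] at h3
    exact lt_irrefl _ h3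
/-- Lutz–Walsh.  For any real `A`, the Spector rank of `A` (the
rank of `A` in the well-founded relation `A ≺ B ↔ 𝒪^A ≤_H B`) equals `α` if and only
if `ω₁^A` is the `(1+α)`-th admissible ordinal. -/
theorem statement_14 (hwf : WellFounded SpectorRel) (A : Set ℕ) (α : Ordinal) :
    (hwf.apply A).rank = α ↔ omega1 A = Ordinal.enumOrd {o | Admissible o} (1 + α) := by
  obtain ⟨h1, h2⟩ := main hwf A
  constructor
  · rintro rfl; exact h2
  · intro h
    rcases lt_trichotomy (hwf.apply A).rank α with h3 | h3 | h3
    · exfalso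
      rw [Ordinal.enumOrd] at h
      rcases Set.eq_empty_or_nonempty ({o | Admissible o} ∩ {b | ∀ c, c < 1 + α → Ordinal.enumOrd {o | Admissible o} c < b}) with h4 | h4
      · rw [h4, Ordinal.sInf_empty] at h
        have := omega_lt_w1 A
        rw [← omega1_eq, h] at this
        exact _root_.not_lt_zero this
      · have h5 := (csInf_mem h4).2 (1 + (hwf.apply A).rank) (by gcongr)
        rw [← h, ← h2] at h5
        exact lt_irrefl _ h5
    · exact h3
    · have := h1 (1 + α) (by gcongr)
      rw [← h] at this
      exact absurd this (lt_irrefl _)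
end SpectorRankFormalization
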